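/- arXiv:1805.07168 — 2 statements merged into one kernel-verified Lean document; each statement's English description precedes it below -/
import Mathlib

section
/- For every integer d ≥ 3 there exist constants c > 0 and γ > 0 such that for every chain length N ≥ 2, every nonempty irreducible string x over {1,…,d} (a word with no two adjacent equal letters) of length k with k ≤ N and N − k even, and every function v : {1,…,d}^N → ℝ that vanishes outside the set S_x of words of length N whose irreducible string equals x and satisfies Σ_{w ∈ S_x} v(w) = 0, one has ⟨v, H v⟩ ≥ c · N^{−γ} · Σ_w v(w)². That is, the pair-flip Hamiltonian restricted to any irreducible subspace has an inverse-polynomial spectral gap. -/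
open scoped Classical

/-- One step of the stack-based reduction: push the letter if the stack is empty or
its top differs from the current letter, otherwise pop the top. -/
def redStep {d : ℕ} (s : List (Fin d)) (a : Fin d) : List (Fin d) :=
  match s with
  | [] => [a]
  | b :: rest => if a = b then rest else a :: b :: rest

/-- The irreducible string of a word: the final stack content read from bottom to top. -/
def irrOf {d N : ℕ} (w : Fin N → Fin d) : List (Fin d) :=
  ((List.ofFn w).foldl redStep []).reverse

/-- A word is fully reducible if its irreducible string is empty. -/
def FullyReducible {d N : ℕ} (w : Fin N → Fin d) : Prop := irrOf w = []

/-- The word `w` with the letters at positions `i` and `i+1` both replaced by `t'`. -/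
def flipAt {d N : ℕ} (w : Fin N → Fin d) (i : ℕ) (t' : Fin d) : Fin N → Fin d :=
  fun p => if (p : ℕ) = i ∨ (p : ℕ) = i + 1 then t' else w p

/-- The letters of `w` at positions `i` and `i+1` both equal `t`. -/
def hasPair {d N : ℕ} (w : Fin N → Fin d) (i : ℕ) (t : Fin d) : Prop :=
  ∀ p : Fin N, ((p : ℕ) = i ∨ (p : ℕ) = i + 1) → w p = t

/-- The quadratic form ⟨v, H v⟩ of the pair-flip Hamiltonian on a chain of length `N`:
`∑_{i=1}^{N−1} ∑_{t < t'} ∑_{w : w_i = w_{i+1} = t} (v(w) − v(w^{(i; t→t')}))²`. -/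
noncomputable def quadForm (d N : ℕ) (v : (Fin N → Fin d) → ℝ) : ℝ :=
  ∑ i ∈ Finset.range (N - 1), ∑ t : Fin d, ∑ t' : Fin d,
    if t < t' then
      (∑ w : Fin N → Fin d,
        if hasPair w i t then (v w - v (flipAt w i t')) ^ 2 else 0)
    else 0



/-! Part 1: numeric walk counts -/
/-- number of walks of length `m` from distance `r` to the target -/
noncomputable def Wn (p β : ℝ) : ℕ → ℕ → ℝ
  | 0, 0 => 1
  | 0, _ + 1 => 0
  | m + 1, 0 => β * Wn p β m 1
  | m + 1, r + 1 => Wn p β m r + p * Wn p β m (r + 2)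

theorem Wn_nonneg {p β : ℝ} (hp : 0 < p) (hβ : 0 < β) : ∀ m r, 0 ≤ Wn p β m r := by
  intro m
  induction m with
  | zero => intro r; cases r <;> simp [Wn]
  | succ m ih =>
    intro r
    cases r with
    | zero => simp only [Wn]; exact mul_nonneg hβ.le (ih 1)
    | succ r => simp only [Wn]; have := ih r; have := ih (r+2); positivity

theorem Wn_pos {p β : ℝ} (hp : 0 < p) (hβ : 0 < β) : ∀ m r n, m = r + 2 * n → 0 < Wn p β m r := by
  intro m
  induction m with
  | zero => intro r n h; obtain rfl : r = 0 := by omega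
            simp [Wn]
  | succ m ih =>
    intro r n h
    cases r with
    | zero => simp only [Wn]; exact mul_pos hβ (ih 1 (n-1) (by omega))
    | succ r =>
      simp only [Wn]
      have h1 := ih r n (by omega)
      have := Wn_nonneg hp hβ m (r+2)
      positivity

theorem Wn_zero {p β : ℝ} : ∀ m r, (∀ n, m ≠ r + 2 * n) → Wn p β m r = 0 := by
  intro m
  induction m with
  | zero => intro r h
            cases r with
            | zero => exact absurd rfl (h 0)
            | succ r => simp [Wn]
  | succ m ih =>
    intro r h
    cases r with
    | zero => simp only [Wn]; rw [ih 1 (fun n hn => h (n+1) (by omega))]; simp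
    | succ r =>
      simp only [Wn]
      rw [ih r (fun n hn => h n (by omega)), ih (r+2) (fun n hn => h (n+1) (by omega))]; simp

theorem Wn_mlr {p β : ℝ} (hp : 0 < p) (hβ : 0 < β) : ∀ m s j,
    Wn p β (m+2) s * Wn p β m (s + 2*j) ≤ Wn p β m s * Wn p β (m+2) (s+2*j) := by
  intro m
  induction m with
  | zero =>
    intro s j
    rcases Nat.eq_zero_or_pos j with rfl | hj
    · simp [mul_comm]
    · rw [Wn_zero 0 (s+2*j) (fun n => by omega)]
      rw [mul_zero]
      exact mul_nonneg (Wn_nonneg hp hβ _ _) (Wn_nonneg hp hβ _ _)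
  | succ m ih =>
    intro s j
    rcases Nat.eq_zero_or_pos j with rfl | hj
    · simp [mul_comm]
    obtain ⟨k, rfl⟩ : ∃ k, j = k + 1 := ⟨j-1, by omega⟩
    cases s with
    | zero =>
      have e1 : 0 + 2 * (k+1) = (2*k+1) + 1 := by ring
      rw [e1]
      have e2 : Wn p β (m+1+2) 0 = β * Wn p β (m+2) 1 := rfl
      have e3 : Wn p β (m+1) 0 = β * Wn p β m 1 := rfl
      have e4 : Wn p β (m+1) (2*k+1+1) = Wn p β m (2*k+1) + p * Wn p β m (2*k+1+2) := rfl
      have e5 : Wn p β (m+1+2) (2*k+1+1) = Wn p β (m+2) (2*k+1) + p * Wn p β (m+2) (2*k+1+2) := rfl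
      rw [e2, e3, e4, e5]
      have h1 := ih 1 k
      have h2 := ih 1 (k+1)
      rw [show 1 + 2*k = 2*k+1 by ring] at h1
      rw [show 1 + 2*(k+1) = 2*k+1+2 by ring] at h2
      nlinarith [mul_le_mul_of_nonneg_left h1 hβ.le, mul_le_mul_of_nonneg_left h2 (mul_pos hβ hp).le]
    | succ r =>
      have e1 : r + 1 + 2 * (k+1) = (r+2*k+2) + 1 := by ring
      rw [e1]
      have e2 : Wn p β (m+1+2) (r+1) = Wn p β (m+2) r + p * Wn p β (m+2) (r+2) := rfl
      have e3 : Wn p β (m+1) (r+1) = Wn p β m r + p * Wn p β m (r+2) := rfl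
      have e4 : Wn p β (m+1) (r+2*k+2+1) = Wn p β m (r+2*k+2) + p * Wn p β m (r+2*k+2+2) := rfl
      have e5 : Wn p β (m+1+2) (r+2*k+2+1) = Wn p β (m+2) (r+2*k+2) + p * Wn p β (m+2) (r+2*k+2+2) := rfl
      rw [e2, e3, e4, e5]
      have h1 := ih r (k+1)
      have h2 := ih r (k+2)
      have h3 := ih (r+2) k
      have h4 := ih (r+2) (k+1)
      rw [show r + 2*(k+1) = r+2*k+2 by ring] at h1
      rw [show r + 2*(k+2) = r+2*k+2+2 by ring] at h2
      rw [show r + 2 + 2*k = r+2*k+2 by ring] at h3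
      rw [show r + 2 + 2*(k+1) = r+2*k+2+2 by ring] at h4
      nlinarith [mul_le_mul_of_nonneg_left h2 hp.le, mul_le_mul_of_nonneg_left h3 hp.le,
        mul_le_mul_of_nonneg_left h4 (mul_pos hp hp).le]

/-- number of walks from distance `r+j` of length `m` which hit distance `r` within `t` steps -/
noncomputable def Xn (p β : ℝ) (r : ℕ) : ℕ → ℕ → ℕ → ℝ
  | _, m, 0 => Wn p β m r
  | 0, _, _ + 1 => 0
  | _ + 1, 0, _ + 1 => 0
  | t + 1, m + 1, j + 1 => Xn p β r t m j + p * Xn p β r t m (j + 2)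

theorem Xn_zero_right (p β : ℝ) (r t m : ℕ) : Xn p β r t m 0 = Wn p β m r := by
  cases t <;> cases m <;> rfl

theorem Xn_nonneg {p β : ℝ} (hp : 0 < p) (hβ : 0 < β) (r : ℕ) : ∀ t m j, 0 ≤ Xn p β r t m j := by
  intro t
  induction t with
  | zero => intro m j; cases j with
    | zero => rw [Xn_zero_right]; exact Wn_nonneg hp hβ _ _
    | succ j => simp [Xn]
  | succ t ih => intro m j; cases j with
    | zero => rw [Xn_zero_right]; exact Wn_nonneg hp hβ _ _
    | succ j => cases m with
      | zero => simp [Xn]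
      | succ m => simp only [Xn]; have := ih m j; have := ih m (j+2); positivity

theorem Xn_le {p β : ℝ} (hp : 0 < p) (hβ : 0 < β) (r : ℕ) : ∀ t m j, Xn p β r t m j ≤ Wn p β m (r+j) := by
  intro t
  induction t with
  | zero => intro m j; cases j with
    | zero => rw [Xn_zero_right]; simp
    | succ j => simp [Xn]; exact Wn_nonneg hp hβ _ _
  | succ t ih => intro m j; cases j with
    | zero => rw [Xn_zero_right]; simp
    | succ j => cases m with
      | zero => simp [Xn]; exact Wn_nonneg hp hβ _ _
      | succ m =>
        have e : Wn p β (m+1) (r+(j+1)) = Wn p β m (r+j) + p * Wn p β m (r+(j+2)) := rfl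
        rw [e]; simp only [Xn]
        have h1 := ih m j
        have h2 := mul_le_mul_of_nonneg_left (ih m (j+2)) hp.le
        linarith

theorem Xn_mono_j {p β : ℝ} (hp : 0 < p) (hβ : 0 < β) (r : ℕ) : ∀ t m j k,
    Xn p β r t m (j+2*k) * Wn p β m (r+j) ≤ Xn p β r t m j * Wn p β m (r+(j+2*k)) := by
  intro t
  induction t with
  | zero =>
    intro m j k
    cases j with
    | zero =>
      rw [Xn_zero_right, mul_comm]
      exact mul_le_mul_of_nonneg_left (Xn_le hp hβ r _ _ _) (Wn_nonneg hp hβ _ _)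
    | succ j =>
      rw [show j + 1 + 2*k = (j+2*k)+1 by ring]
      simp [Xn]
  | succ t ih =>
    intro m j k
    cases j with
    | zero =>
      rw [Xn_zero_right, mul_comm]
      exact mul_le_mul_of_nonneg_left (Xn_le hp hβ r _ _ _) (Wn_nonneg hp hβ _ _)
    | succ j =>
      rcases Nat.eq_zero_or_pos k with rfl | hk
      · simp
      obtain ⟨k, rfl⟩ : ∃ k', k = k' + 1 := ⟨k-1, by omega⟩
      rw [show j + 1 + 2*(k+1) = (j+2*k+2)+1 by ring]
      cases m with
      | zero => simp [Xn]
      | succ m =>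
        have e1 : Wn p β (m+1) (r+(j+1)) = Wn p β m (r+j) + p * Wn p β m (r+(j+2)) := rfl
        have e2 : Wn p β (m+1) (r+(j+2*k+2+1)) = Wn p β m (r+(j+2*k+2)) + p * Wn p β m (r+(j+2*k+2+2)) := rfl
        rw [e1, e2]; simp only [Xn]
        have h1 := ih m j (k+1)
        have h2 := ih m j (k+2)
        have h3 := ih m (j+2) k
        have h4 := ih m (j+2) (k+1)
        rw [show j + 2*(k+1) = j+2*k+2 by ring] at h1
        rw [show j + 2*(k+2) = j+2*k+2+2 by ring] at h2
        rw [show j + 2 + 2*k = j+2*k+2 by ring] at h3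
        rw [show j + 2 + 2*(k+1) = j+2*k+2+2 by ring] at h4
        nlinarith [mul_le_mul_of_nonneg_left h2 hp.le, mul_le_mul_of_nonneg_left h3 hp.le,
          mul_le_mul_of_nonneg_left h4 (mul_pos hp hp).le]

theorem cross_aux {a c a2 c2 A C A2 C2 : ℝ} (hA : 0 ≤ A) (hC : 0 ≤ C) (hA2 : 0 ≤ A2) (hC2 : 0 ≤ C2)
    (ha : 0 ≤ a) (hc : 0 ≤ c) (ha2 : 0 ≤ a2) (hc2 : 0 ≤ c2)
    (hcC : c ≤ C) (hAC : A = 0 → C = 0) (hAA2 : A2 = 0 → A = 0) (hCC2 : C2 = 0 → C = 0)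
    (h1 : a2 * A ≤ a * A2) (h2 : c2 * C ≤ c * C2) (h3 : c * A ≤ a * C) (h4 : c2 * A2 ≤ a2 * C2)
    (h5 : A2 * C ≤ A * C2) : a2 * C + c2 * A ≤ a * C2 + c * A2 := by
  rcases hA.eq_or_lt with h0 | hA
  · rw [hAC h0.symm, ← h0]; nlinarith [mul_nonneg ha hC2, mul_nonneg hc hA2]
  have hA2 : 0 < A2 := lt_of_le_of_ne hA2 (fun h => hA.ne' (hAA2 h.symm))
  rcases hC.eq_or_lt with h0 | hC
  · have : c2 * A * A2 ≤ a * C2 * A2 := by nlinarith [mul_le_mul_of_nonneg_right h4 hA.le, mul_le_mul_of_nonneg_right h1 hC2]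
    have := le_of_mul_le_mul_right this hA2
    rw [← h0]; nlinarith [mul_nonneg hc hA2.le]
  have hC2 : 0 < C2 := lt_of_le_of_ne hC2 (fun h => hC.ne' (hCC2 h.symm))
  have k1 : a2 * C * A ≤ a * A2 * C := by nlinarith
  have k2 : c2 * A * C ≤ c * C2 * A := by nlinarith
  have k3 : 0 ≤ (a * C - c * A) * (A * C2 - A2 * C) := mul_nonneg (by linarith) (by linarith)
  have : (a2 * C + c2 * A) * (A * C) ≤ (a * C2 + c * A2) * (A * C) := by
    nlinarith [mul_le_mul_of_nonneg_right k1 hC.le, mul_le_mul_of_nonneg_right k2 hA.le]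
  exact le_of_mul_le_mul_right this (mul_pos hA hC)

theorem Wn_ne {p β : ℝ} {m r : ℕ} (h : Wn p β m r ≠ 0) : ∃ n, m = r + 2*n := by
  by_contra hh
  push Not at hh
  exact h (Wn_zero m r hh)

theorem Xn_mono_m {p β : ℝ} (hp : 0 < p) (hβ : 0 < β) (r : ℕ) : ∀ t m j,
    Xn p β r t (m+2) j * Wn p β m (r+j) ≤ Xn p β r t m j * Wn p β (m+2) (r+j) := by
  intro t
  induction t with
  | zero =>
    intro m j
    cases j with
    | zero => rw [Xn_zero_right, Xn_zero_right, mul_comm]; rfl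
    | succ j => simp [Xn]
  | succ t ih =>
    intro m j
    cases j with
    | zero => rw [Xn_zero_right, Xn_zero_right, mul_comm]; rfl
    | succ j =>
      cases m with
      | zero => simp [Xn, Wn]
      | succ m =>
        have e1 : Wn p β (m+1) (r+(j+1)) = Wn p β m (r+j) + p * Wn p β m (r+(j+2)) := rfl
        have e2 : Wn p β (m+1+2) (r+(j+1)) = Wn p β (m+2) (r+j) + p * Wn p β (m+2) (r+(j+2)) := rfl
        have e3 : Xn p β r (t+1) (m+1+2) (j+1) = Xn p β r t (m+2) j + p * Xn p β r t (m+2) (j+2) := rfl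
        rw [e1, e2, e3]; simp only [Xn]
        have h1 := ih m j
        have h2 := ih m (j+2)
        have h3 := Xn_mono_j hp hβ r t m j 1
        have h4 := Xn_mono_j hp hβ r t (m+2) j 1
        have h5 := Wn_mlr hp hβ m (r+j) 1
        have hW := Wn_nonneg hp hβ
        have hX := Xn_nonneg hp hβ r
        have key := cross_aux (hW m (r+j)) (hW m (r+(j+2))) (hW (m+2) (r+j)) (hW (m+2) (r+(j+2)))
          (hX t m j) (hX t m (j+2)) (hX t (m+2) j) (hX t (m+2) (j+2)) (Xn_le hp hβ r _ _ _)
          (fun h => by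
            by_contra hh
            obtain ⟨n, hn⟩ := Wn_ne hh
            exact (Wn_pos hp hβ m (r+j) (n+1) (by omega)).ne' h)
          (fun h => by
            by_contra hh
            obtain ⟨n, hn⟩ := Wn_ne hh
            exact (Wn_pos hp hβ (m+2) (r+j) (n+1) (by omega)).ne' h)
          (fun h => by
            by_contra hh
            obtain ⟨n, hn⟩ := Wn_ne hh
            exact (Wn_pos hp hβ (m+2) (r+(j+2)) (n+1) (by omega)).ne' h)
          h1 h2 h3 h4 h5
        nlinarith [mul_le_mul_of_nonneg_left key hp.le, mul_le_mul_of_nonneg_left h2 (mul_pos hp hp).le]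

theorem Xn_eq_sum (p β : ℝ) (r : ℕ) : ∀ t m j, Xn p β r t (m+1) (j+1) =
    ∑ σ ∈ Finset.range t, if σ ≤ m then Wn p p σ j * Wn p β (m-σ) r else 0 := by
  intro t
  induction t with
  | zero => intro m j; simp [Xn]
  | succ t ih =>
    intro m j
    simp only [Xn]
    rw [Finset.sum_range_succ']
    have hj2 : Xn p β r t m (j+2) = ∑ σ ∈ Finset.range t, if σ + 1 ≤ m then Wn p p σ (j+1) * Wn p β (m-(σ+1)) r else 0 := by
      cases m with
      | zero => cases t <;> simp [Xn]
      | succ m => rw [ih m (j+1)]; simp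
    rw [hj2]
    cases j with
    | zero =>
      rw [Xn_zero_right]
      simp only [Wn, Nat.zero_le, if_true, Nat.sub_zero, one_mul]
      rw [add_comm, Finset.mul_sum]
      congr 1
      apply Finset.sum_congr rfl; intro σ _
      split_ifs <;> ring
    | succ j =>
      have hj1 : Xn p β r t m (j+1) = ∑ σ ∈ Finset.range t, if σ + 1 ≤ m then Wn p p σ j * Wn p β (m-(σ+1)) r else 0 := by
        cases m with
        | zero => cases t <;> simp [Xn]
        | succ m => rw [ih m j]; simp
      rw [hj1, Finset.mul_sum, ← Finset.sum_add_distrib]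
      simp only [Wn, zero_mul, ite_self, add_zero]
      apply Finset.sum_congr rfl; intro σ _
      split_ifs <;> ring

theorem Xn_full (p β : ℝ) (r : ℕ) : ∀ t m j, m ≤ t → Xn p β r t m j = Wn p β m (r+j) := by
  intro t
  induction t with
  | zero =>
    intro m j h
    obtain rfl : m = 0 := by omega
    cases j with
    | zero => rw [Xn_zero_right]; rfl
    | succ j => rw [show r + (j+1) = (r+j)+1 by ring]; simp [Xn, Wn]
  | succ t ih =>
    intro m j h
    cases j with
    | zero => rw [Xn_zero_right]; rfl
    | succ j =>
      cases m with
      | zero => rw [show r + (j+1) = (r+j)+1 by ring]; simp [Xn, Wn]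
      | succ m =>
        simp only [Xn]
        rw [ih m j (by omega), ih m (j+2) (by omega)]; rfl

/-- ratio monotone along the diagonal -/
theorem Wn_R1 {p β : ℝ} (hp : 0 < p) (hβ : 0 < β) (m s : ℕ) :
    Wn p β (m+2) s * Wn p β (m+1) (s+1) ≤ Wn p β m s * Wn p β (m+3) (s+1) := by
  have e1 : Wn p β (m+1) (s+1) = Wn p β m s + p * Wn p β m (s+2) := rfl
  have e2 : Wn p β (m+3) (s+1) = Wn p β (m+2) s + p * Wn p β (m+2) (s+2) := rfl
  rw [e1, e2]
  have := Wn_mlr hp hβ m s 1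
  rw [mul_one] at this
  nlinarith [mul_le_mul_of_nonneg_left this hp.le]

theorem Wn_ratio_diag {p β : ℝ} (hp : 0 < p) (hβ : 0 < β) (n : ℕ) : ∀ r,
    Wn p β (2*n+2) 0 * Wn p β (2*n+r) r ≤ Wn p β (2*n) 0 * Wn p β (2*n+r+2) r := by
  intro r
  induction r with
  | zero => simp [mul_comm]
  | succ r ih =>
    have h := Wn_R1 hp hβ (2*n+r) r
    have p1 := Wn_pos hp hβ (2*n+r) r n (by omega)
    have p2 := Wn_pos hp hβ (2*n+r+1) (r+1) n (by omega)
    have p3 := Wn_pos hp hβ (2*n) 0 n (by omega)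
    rw [show 2*n+(r+1) = 2*n+r+1 by ring, show 2*n+r+1+2=2*n+r+3 by ring]
    have : (Wn p β (2*n+2) 0 * Wn p β (2*n+r+1) (r+1)) * Wn p β (2*n+r) r ≤ (Wn p β (2*n) 0 * Wn p β (2*n+r+3) (r+1)) * Wn p β (2*n+r) r := by
      nlinarith [mul_le_mul_of_nonneg_right ih p2.le, mul_le_mul_of_nonneg_left h p3.le]
    exact le_of_mul_le_mul_right this p1

theorem Wn_logconvex {p β : ℝ} (hp : 0 < p) (hβ : 0 < β) (i : ℕ) : ∀ k,
    Wn p β (2*i+2) 0 * Wn p β (2*(i+k)) 0 ≤ Wn p β (2*i) 0 * Wn p β (2*(i+k)+2) 0 := by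
  intro k
  induction k with
  | zero => simp [mul_comm]
  | succ k ih =>
    have h := Wn_R1 hp hβ (2*(i+k)) 0
    have e1 : Wn p β (2*(i+k)+2) 0 = β * Wn p β (2*(i+k)+1) 1 := rfl
    have e2 : Wn p β (2*(i+k)+4) 0 = β * Wn p β (2*(i+k)+3) 1 := rfl
    have h' : Wn p β (2*(i+k)+2) 0 * Wn p β (2*(i+k)+2) 0 ≤ Wn p β (2*(i+k)) 0 * Wn p β (2*(i+k)+4) 0 := by
      rw [e2]; nth_rewrite 2 [e1]
      simp only [zero_add] at h
      nlinarith [mul_le_mul_of_nonneg_left h hβ.le]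
    have p1 := Wn_pos hp hβ (2*(i+k)) 0 (i+k) (by omega)
    have p2 := Wn_pos hp hβ (2*(i+k)+2) 0 (i+k+1) (by omega)
    have p3 := Wn_pos hp hβ (2*i) 0 i (by omega)
    rw [show 2*(i+(k+1)) = 2*(i+k)+2 by ring, show 2*(i+k)+2+2=2*(i+k)+4 by ring]
    have : (Wn p β (2*i+2) 0 * Wn p β (2*(i+k)+2) 0) * Wn p β (2*(i+k)) 0 ≤ (Wn p β (2*i) 0 * Wn p β (2*(i+k)+4) 0) * Wn p β (2*(i+k)) 0 := by
      nlinarith [mul_le_mul_of_nonneg_right ih p2.le, mul_le_mul_of_nonneg_left h' p3.le]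
    exact le_of_mul_le_mul_right this p1

theorem Wn_special (p : ℝ) : ∀ m r J, m < r + 2 * J →
    Wn p (p+1) m r = ∑ j ∈ Finset.range J, Wn p p m (r+2*j) := by
  intro m
  induction m with
  | zero =>
    intro r J h
    cases r with
    | zero =>
      obtain ⟨J, rfl⟩ : ∃ J', J = J'+1 := ⟨J-1, by omega⟩
      rw [Finset.sum_range_succ']
      simp [Wn, Nat.mul_add]
    | succ r =>
      simp only [Wn]
      symm; apply Finset.sum_eq_zero; intro j _
      rw [show r+1+2*j = (r+2*j)+1 by ring]; simp [Wn]
  | succ m ih =>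
    intro r J h
    cases r with
    | zero =>
      obtain ⟨J, rfl⟩ : ∃ J', J = J'+1 := ⟨J-1, by omega⟩
      simp only [Wn]
      rw [ih 1 J (by omega)]
      have : ∀ j, Wn p p (m+1) (0+2*(j+1)) = Wn p p m (1+2*j) + p * Wn p p m (1+2*(j+1)) := by
        intro j
        rw [show 0+2*(j+1) = (1+2*j)+1 by ring, show 1+2*(j+1) = (1+2*j)+2 by ring]; rfl
      have e0 : Wn p p (m+1) (0+2*0) = p * Wn p p m 1 := rfl
      have h2 : ∑ j ∈ Finset.range J, Wn p p m (1+2*j) = ∑ j ∈ Finset.range J, Wn p p m (1+2*(j+1)) + Wn p p m 1 := by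
        have := Finset.sum_range_succ' (fun j => Wn p p m (1+2*j)) J
        rw [Finset.sum_range_succ, Wn_zero m (1+2*J) (fun n => by omega)] at this
        simpa using this
      rw [Finset.sum_range_succ' (fun j => Wn p p (m+1) (0+2*j)) J, e0]
      simp only [this, Finset.sum_add_distrib, ← Finset.mul_sum]
      linear_combination p * h2
    | succ r =>
      simp only [Wn]
      rw [ih r J (by omega), ih (r+2) J (by omega), Finset.mul_sum, ← Finset.sum_add_distrib]
      apply Finset.sum_congr rfl; intro j _
      rw [show r+1+2*j = (r+2*j)+1 by ring, show r+2+2*j = (r+2*j)+2 by ring]; rfl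

theorem Wn_cmp {p β : ℝ} (hp : 0 < p) (hβ : β = p ∨ β = p+1) (n : ℕ) :
    Wn p p (2*n+2) 0 * Wn p β (2*n) 0 ≤ Wn p p (2*n) 0 * Wn p β (2*n+2) 0 := by
  rcases hβ with rfl | rfl
  · rw [mul_comm]
  · rw [Wn_special p (2*n) 0 (n+2) (by omega), Wn_special p (2*n+2) 0 (n+2) (by omega)]
    rw [Finset.mul_sum, Finset.mul_sum]
    apply Finset.sum_le_sum; intro j _
    exact Wn_mlr hp hp (2*n) 0 j

/-- N3 -/
theorem Wn_N3 {p β : ℝ} (hp : 0 < p) (hβ : β = p ∨ β = p+1) (i n r : ℕ) (h : i ≤ n) :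
    Wn p p (2*i+2) 0 * Wn p β (2*n+r) r ≤ Wn p p (2*i) 0 * Wn p β (2*n+r+2) r := by
  have hβ0 : 0 < β := by rcases hβ with rfl | rfl <;> linarith
  obtain ⟨k, rfl⟩ := Nat.exists_eq_add_of_le h
  have h1 := Wn_logconvex hp hp i k
  have h2 := Wn_cmp hp hβ (i+k)
  have h3 := Wn_ratio_diag hp hβ0 (i+k) r
  have q1 := Wn_pos hp hp (2*i) 0 i (by omega)
  have q2 := Wn_pos hp hp (2*(i+k)) 0 (i+k) (by omega)
  have q3 := Wn_pos hp hβ0 (2*(i+k)) 0 (i+k) (by omega)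
  have q4 := Wn_pos hp hβ0 (2*(i+k)+r) r (i+k) (by omega)
  have h1' := (div_le_div_iff₀ q1 q2).2 (by linarith : Wn p p (2*i+2) 0 * Wn p p (2*(i+k)) 0 ≤ Wn p p (2*(i+k)+2) 0 * Wn p p (2*i) 0)
  have h2' := (div_le_div_iff₀ q2 q3).2 (by linarith : Wn p p (2*(i+k)+2) 0 * Wn p β (2*(i+k)) 0 ≤ Wn p β (2*(i+k)+2) 0 * Wn p p (2*(i+k)) 0)
  have h3' := (div_le_div_iff₀ q3 q4).2 (by linarith : Wn p β (2*(i+k)+2) 0 * Wn p β (2*(i+k)+r) r ≤ Wn p β (2*(i+k)+r+2) r * Wn p β (2*(i+k)) 0)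
  have := (div_le_div_iff₀ q1 q4).1 (h1'.trans (h2'.trans h3'))
  linarith

theorem sum_range_even (g : ℕ → ℝ) (hg : ∀ k, g (2*k+1) = 0) (i : ℕ) :
    ∑ σ ∈ Finset.range (2*i), g σ = ∑ k ∈ Finset.range i, g (2*k) := by
  induction i with
  | zero => simp
  | succ i ih =>
    rw [show 2*(i+1) = 2*i+1+1 by ring, Finset.sum_range_succ, Finset.sum_range_succ, hg, ih, Finset.sum_range_succ]
    ring

theorem Xn_even (p β : ℝ) (r i m : ℕ) : Xn p β r (2*i) (m+1) 1 =
    ∑ k ∈ Finset.range i, Wn p p (2*k) 0 * (if 2*k ≤ m then Wn p β (m-2*k) r else 0) := by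
  rw [Xn_eq_sum, sum_range_even]
  · apply Finset.sum_congr rfl; intro k _; split_ifs <;> simp
  · intro k; rw [Wn_zero (2*k+1) 0 (fun n => by omega)]; simp

theorem Wn_conv (p β : ℝ) (r i m : ℕ) (h : m < 2 * i) : Wn p β (m+1) (r+1) =
    ∑ k ∈ Finset.range i, Wn p p (2*k) 0 * (if 2*k ≤ m then Wn p β (m-2*k) r else 0) := by
  rw [← Xn_even, Xn_full p β r (2*i) (m+1) 1 (by omega)]

theorem Wn_catalan (p : ℝ) : ∀ i, Wn p p (2*i) 0 = p^i * (catalan i : ℝ) := by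
  intro i
  induction i using Nat.strong_induction_on with
  | _ i ih =>
    cases i with
    | zero => simp [Wn]
    | succ i =>
      have e : Wn p p (2*(i+1)) 0 = p * Wn p p (2*i+1) (0+1) := rfl
      rw [e, Wn_conv p p 0 (i+1) (2*i) (by omega), catalan_succ, Finset.mul_sum]
      push_cast
      rw [Finset.sum_range, Finset.mul_sum]
      apply Finset.sum_congr rfl
      intro k _
      have hk := k.2
      rw [if_pos (by omega), ih k (by omega), show 2*i-2*(k:ℕ) = 2*(i-k) by omega, ih (i-k) (by omega)]
      have : p^(i+1) = p * (p^(k:ℕ) * p^(i-k)) := by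
        rw [← pow_add, ← pow_succ']; congr 1; omega
      rw [this]; ring

theorem catalan_le (i : ℕ) : (catalan i : ℝ) ≤ 4^i := by
  have h : catalan i ≤ 4^i := by
    rw [catalan_eq_centralBinom_div]
    refine (Nat.div_le_self _ _).trans ?_
    rw [Nat.centralBinom_eq_two_mul_choose]
    refine (Nat.choose_le_two_pow _ _).trans ?_
    rw [pow_mul]; norm_num
  exact_mod_cast h

theorem le_catalan (i : ℕ) : (4:ℝ)^i ≤ 2 * (i+1)^2 * (catalan i : ℝ) := by
  have h : 4^i ≤ 2 * (i+1)^2 * catalan i := by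
    rcases Nat.eq_zero_or_pos i with rfl | hi
    · simp
    have h1 := Nat.four_pow_le_two_mul_self_mul_centralBinom i hi
    have h2 : (i+1) * catalan i = i.centralBinom := succ_mul_catalan_eq_centralBinom i
    rw [← h2] at h1
    nlinarith [Nat.zero_le (catalan i)]
  exact_mod_cast h

theorem Wn_submul {p : ℝ} (hp : 0 < p) (i j : ℕ) (M : ℝ) (hi : (i:ℝ)+1 ≤ M) (hj : (j:ℝ)+1 ≤ M) :
    (4*p)^(i+j) ≤ 4 * M^4 * (Wn p p (2*i) 0 * Wn p p (2*j) 0) := by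
  have hM : 0 ≤ M := by have := Nat.cast_nonneg (α := ℝ) i; linarith
  rw [Wn_catalan, Wn_catalan]
  have h1 : (4:ℝ)^i ≤ 2 * M^2 * catalan i := (le_catalan i).trans (by gcongr)
  have h2 : (4:ℝ)^j ≤ 2 * M^2 * catalan j := (le_catalan j).trans (by gcongr)
  have h3 : (4:ℝ)^i * 4^j ≤ (2 * M^2 * catalan i) * (2 * M^2 * catalan j) := by gcongr
  calc (4*p)^(i+j) = (p^i * p^j) * ((4:ℝ)^i * 4^j) := by rw [mul_pow, pow_add, pow_add]; ring
    _ ≤ (p^i * p^j) * ((2 * M^2 * catalan i) * (2 * M^2 * catalan j)) := by gcongr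
    _ = _ := by ring

theorem Wn_le_four {p : ℝ} (hp : 0 < p) (i : ℕ) : Wn p p (2*i) 0 ≤ (4*p)^i := by
  rw [Wn_catalan, mul_pow, mul_comm]
  gcongr
  exact catalan_le i


section PFwords

variable {d : ℕ}

/-- words of length m, as a finset of lists -/
noncomputable def words (d m : ℕ) : Finset (List (Fin d)) :=
  (Finset.univ : Finset (Fin m → Fin d)).image List.ofFn

theorem mem_words {m : ℕ} {l : List (Fin d)} : l ∈ words d m ↔ l.length = m := by
  simp only [words, Finset.mem_image, Finset.mem_univ, true_and]
  constructor
  · rintro ⟨f, rfl⟩; simp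
  · rintro rfl; exact ⟨l.get, List.ofFn_get l⟩

theorem sum_words_zero (F : List (Fin d) → ℝ) : ∑ w ∈ words d 0, F w = F [] := by
  have : words d 0 = {[]} := by
    ext l; simp [mem_words]
  rw [this]; simp

theorem sum_words_succ (m : ℕ) (F : List (Fin d) → ℝ) :
    ∑ w ∈ words d (m+1), F w = ∑ a : Fin d, ∑ w ∈ words d m, F (a :: w) := by
  rw [← Finset.sum_product' Finset.univ (words d m) (fun a w => F (a :: w))]
  symm
  refine Finset.sum_nbij (fun x => x.1 :: x.2) ?_ ?_ ?_ ?_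
  · rintro ⟨a, w⟩ h; simp [mem_words] at h ⊢; exact h
  · rintro ⟨a, w⟩ _ ⟨a', w'⟩ _ h; simpa using h
  · intro l hl
    simp [mem_words] at hl
    cases l with
    | nil => simp at hl
    | cons a w => exact ⟨(a, w), by simpa [mem_words] using hl, rfl⟩
  · intros; rfl

/-- the word w empties the stack s, never pushing z on the empty stack -/
def ok (z : Option (Fin d)) : List (Fin d) → List (Fin d) → Prop
  | s, [] => s = []
  | [], a :: w => some a ≠ z ∧ ok z [a] w
  | b :: s, a :: w => if a = b then ok z s w else ok z (a :: b :: s) w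

theorem ok_nil (z : Option (Fin d)) (s : List (Fin d)) : ok z s [] ↔ s = [] := by
  cases s <;> simp [ok]
theorem ok_nil_cons (z : Option (Fin d)) (a : Fin d) (w : List (Fin d)) :
    ok z [] (a :: w) ↔ some a ≠ z ∧ ok z [a] w := by simp [ok]
theorem ok_cons_self (z : Option (Fin d)) (a : Fin d) (s w : List (Fin d)) :
    ok z (a :: s) (a :: w) ↔ ok z s w := by simp [ok]
theorem ok_cons_ne (z : Option (Fin d)) {a b : Fin d} (h : a ≠ b) (s w : List (Fin d)) :
    ok z (b :: s) (a :: w) ↔ ok z (a :: b :: s) w := by simp [ok, h]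

theorem ok_length (z : Option (Fin d)) (w : List (Fin d)) : ∀ s, ok z s w → ∃ n, w.length = s.length + 2 * n := by
  induction w with
  | nil => intro s h; rw [ok_nil] at h; subst h; exact ⟨0, rfl⟩
  | cons a w ih =>
    intro s h
    cases s with
    | nil =>
      rw [ok_nil_cons] at h
      obtain ⟨n, hn⟩ := ih _ h.2
      exact ⟨n+1, by simp at hn ⊢; omega⟩
    | cons b s =>
      by_cases hab : a = b
      · subst hab; rw [ok_cons_self] at h
        obtain ⟨n, hn⟩ := ih _ h
        exact ⟨n, by simp at hn ⊢; omega⟩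
      · rw [ok_cons_ne z hab] at h
        obtain ⟨n, hn⟩ := ih _ h
        exact ⟨n+1, by simp at hn ⊢; omega⟩

theorem ok_parse (z : Option (Fin d)) (b : Fin d) (s w : List (Fin d)) : ∀ t,
    ok z (t ++ b :: s) w ↔ ∃ y w', w = y ++ b :: w' ∧ ok (some b) t y ∧ ok z s w' := by
  induction w with
  | nil => intro t; rw [ok_nil]; simp
  | cons a w ih =>
    intro t
    cases t with
    | nil =>
      rw [List.nil_append]
      by_cases hab : a = b
      · subst hab; rw [ok_cons_self]
        constructor
        · intro h; exact ⟨[], w, rfl, by rw [ok_nil], h⟩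
        · rintro ⟨y, w', h1, h2, h3⟩
          cases y with
          | nil => simp at h1; subst h1; exact h3
          | cons c y =>
            simp at h1; obtain ⟨rfl, rfl⟩ := h1
            rw [ok_nil_cons] at h2; exact absurd rfl h2.1
      · rw [ok_cons_ne z hab]
        have := ih [a]
        rw [List.singleton_append] at this
        rw [this]
        constructor
        · rintro ⟨y, w', rfl, h2, h3⟩
          exact ⟨a :: y, w', rfl, by rw [ok_nil_cons]; exact ⟨by simpa using hab, h2⟩, h3⟩
        · rintro ⟨y, w', h1, h2, h3⟩
          cases y with
          | nil => simp at h1; exact absurd h1.1 hab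
          | cons c y =>
            simp at h1; obtain ⟨rfl, rfl⟩ := h1
            rw [ok_nil_cons] at h2; exact ⟨y, w', rfl, h2.2, h3⟩
    | cons c t =>
      rw [List.cons_append]
      by_cases hac : a = c
      · subst hac; rw [ok_cons_self, ih]
        constructor
        · rintro ⟨y, w', rfl, h2, h3⟩
          exact ⟨a :: y, w', rfl, by rwa [ok_cons_self], h3⟩
        · rintro ⟨y, w', h1, h2, h3⟩
          cases y with
          | nil => rw [ok_nil] at h2; simp at h2
          | cons c y =>
            simp at h1; obtain ⟨rfl, rfl⟩ := h1
            rw [ok_cons_self] at h2; exact ⟨y, w', rfl, h2, h3⟩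
      · rw [ok_cons_ne z hac]
        have := ih (a :: c :: t)
        simp only [List.cons_append] at this
        rw [this]
        constructor
        · rintro ⟨y, w', rfl, h2, h3⟩
          exact ⟨a :: y, w', rfl, by rwa [ok_cons_ne _ hac], h3⟩
        · rintro ⟨y, w', h1, h2, h3⟩
          cases y with
          | nil => rw [ok_nil] at h2; simp at h2
          | cons c y =>
            simp at h1; obtain ⟨rfl, rfl⟩ := h1
            rw [ok_cons_ne _ hac] at h2; exact ⟨y, w', rfl, h2, h3⟩

theorem ok_parse_unique (b : Fin d) (w w' y : List (Fin d)) : ∀ t y', ok (some b) t y → ok (some b) t y' →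
    y ++ b :: w = y' ++ b :: w' → y = y' ∧ w = w' := by
  induction y with
  | nil =>
    intro t y' h1 h2 h
    rw [ok_nil] at h1; subst h1
    cases y' with
    | nil => simpa using h
    | cons c y' =>
      simp at h; rw [ok_nil_cons] at h2; obtain ⟨rfl, _⟩ := h; exact absurd rfl h2.1
  | cons a y ih =>
    intro t y' h1 h2 h
    cases y' with
    | nil =>
      rw [ok_nil] at h2; subst h2
      simp at h; rw [ok_nil_cons] at h1; obtain ⟨rfl, _⟩ := h; exact absurd rfl h1.1
    | cons c y' =>
      simp at h
      obtain ⟨rfl, h⟩ := h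
      cases t with
      | nil =>
        rw [ok_nil_cons] at h1 h2
        obtain ⟨h3, h4⟩ := ih _ _ h1.2 h2.2 h
        simp [h3, h4]
      | cons e t =>
        by_cases hae : a = e
        · subst hae
          rw [ok_cons_self] at h1 h2
          obtain ⟨h3, h4⟩ := ih _ _ h1 h2 h
          simp [h3, h4]
        · rw [ok_cons_ne _ hae] at h1 h2
          obtain ⟨h3, h4⟩ := ih _ _ h1 h2 h
          simp [h3, h4]

theorem ok_append (z : Option (Fin d)) (w1 w2 : List (Fin d)) (h2 : ok z [] w2) : ∀ s, ok z s w1 → ok z s (w1 ++ w2) := by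
  induction w1 with
  | nil => intro s h; rw [ok_nil] at h; subst h; exact h2
  | cons a w ih =>
    intro s h
    cases s with
    | nil => rw [List.cons_append]; rw [ok_nil_cons] at h ⊢; exact ⟨h.1, ih _ h.2⟩
    | cons b s =>
      rw [List.cons_append]
      by_cases hab : a = b
      · subst hab; rw [ok_cons_self] at h ⊢; exact ih _ h
      · rw [ok_cons_ne _ hab] at h ⊢; exact ih _ h

/-- stack compatible with the floor letter -/
def Good (z : Option (Fin d)) (s : List (Fin d)) : Prop := (s ++ z.toList).IsChain (· ≠ ·)

theorem ok_triple (z : Option (Fin d)) (a : Fin d) (q p : List (Fin d)) : ∀ s, Good z s →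
    ok z s (p ++ a :: q) → ok z s (p ++ a :: a :: a :: q) := by
  induction p with
  | nil =>
    intro s hs h
    simp only [List.nil_append] at *
    cases s with
    | nil =>
      rw [ok_nil_cons] at h ⊢
      refine ⟨h.1, ?_⟩
      rw [ok_cons_self, ok_nil_cons]; exact h
    | cons b s =>
      by_cases hab : a = b
      · subst hab
        rw [ok_cons_self] at h ⊢
        cases s with
        | nil =>
          rw [ok_nil_cons, ok_cons_self]
          refine ⟨?_, h⟩
          rintro rfl
          simp [Good] at hs
        | cons c s =>
          have : a ≠ c := by
            simp [Good] at hs; exact hs.1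
          rw [ok_cons_ne _ this, ok_cons_self]; exact h
      · rw [ok_cons_ne _ hab] at h ⊢
        rw [ok_cons_self, ok_cons_ne _ hab]; exact h
  | cons c p ih =>
    intro s hs h
    rw [List.cons_append] at *
    cases s with
    | nil =>
      rw [ok_nil_cons] at h ⊢
      refine ⟨h.1, ih _ ?_ h.2⟩
      cases z with
      | none => simp [Good]
      | some e => simp [Good]; simpa using h.1
    | cons b s =>
      by_cases hab : c = b
      · subst hab
        rw [ok_cons_self] at h ⊢
        refine ih _ ?_ h
        simp only [Good, List.cons_append] at hs ⊢
        exact hs.tail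
      · rw [ok_cons_ne _ hab] at h ⊢
        refine ih _ ?_ h
        simp only [Good, List.cons_append] at hs ⊢
        exact List.isChain_cons_cons.2 ⟨hab, hs⟩

/-- words of length m emptying the stack s -/
noncomputable def L (z : Option (Fin d)) (s : List (Fin d)) (m : ℕ) : Finset (List (Fin d)) :=
  (words d m).filter (ok z s)

theorem mem_L {z : Option (Fin d)} {s : List (Fin d)} {m : ℕ} {w : List (Fin d)} :
    w ∈ L z s m ↔ w.length = m ∧ ok z s w := by
  simp [L, mem_words]

theorem sum_L_nil (z : Option (Fin d)) (m : ℕ) (F : List (Fin d) → ℝ) :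
    ∑ w ∈ L z [] (m+1), F w = ∑ c : Fin d, if some c ≠ z then ∑ w ∈ L z [c] m, F (c :: w) else 0 := by
  unfold L
  rw [Finset.sum_filter, sum_words_succ]
  refine Finset.sum_congr rfl fun c _ => ?_
  simp only [ok_nil_cons]
  split_ifs with h
  · simp only [h, ne_eq, not_false_eq_true, true_and, Finset.sum_filter]
  · simp [h]

theorem sum_L_cons (z : Option (Fin d)) (b : Fin d) (s : List (Fin d)) (m : ℕ) (F : List (Fin d) → ℝ) :
    ∑ w ∈ L z (b :: s) (m+1), F w = ∑ w ∈ L z s m, F (b :: w) +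
      ∑ a ∈ Finset.univ.erase b, ∑ w ∈ L z (a :: b :: s) m, F (a :: w) := by
  unfold L
  rw [Finset.sum_filter, sum_words_succ, ← Finset.add_sum_erase _ _ (Finset.mem_univ b)]
  congr 1
  · simp only [ok_cons_self, Finset.sum_filter]
  · refine Finset.sum_congr rfl fun a ha => ?_
    simp only [ok_cons_ne _ (Finset.ne_of_mem_erase ha), Finset.sum_filter]

/-- branching number at the floor -/
noncomputable def bet (d : ℕ) (z : Option (Fin d)) : ℝ := if z = none then (d:ℝ) else (d:ℝ) - 1

theorem card_L (z : Option (Fin d)) (m : ℕ) : ∀ s, ((L z s m).card : ℝ) = Wn ((d:ℝ)-1) (bet d z) m s.length := by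
  induction m with
  | zero =>
    intro s
    rw [Finset.cast_card, L, Finset.sum_filter, sum_words_zero]
    simp only [ok_nil]
    cases s <;> simp [Wn]
  | succ m ih =>
    intro s
    rw [Finset.cast_card]
    cases s with
    | nil =>
      rw [sum_L_nil]
      simp only [← Finset.cast_card, ih, List.length_cons, List.length_nil]
      rw [← Finset.sum_filter, Finset.sum_const]
      simp only [List.length_cons, List.length_nil, Wn, nsmul_eq_mul, zero_add]
      congr 1
      cases z with
      | none => simp [bet]
      | some e =>
        simp only [bet, reduceCtorEq, if_false]
        have : (Finset.univ.filter fun c : Fin d => some c ≠ some e) = Finset.univ.erase e := by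
          ext c; simp
        rw [this, Finset.card_erase_of_mem (Finset.mem_univ _), Finset.card_univ, Fintype.card_fin]
        have : 1 ≤ d := e.pos
        push_cast [this]; rfl
    | cons b s =>
      rw [sum_L_cons]
      simp only [← Finset.cast_card, ih, List.length_cons, List.length_nil]
      rw [Finset.sum_const, Finset.card_erase_of_mem (Finset.mem_univ _), Finset.card_univ, Fintype.card_fin]
      have : 1 ≤ d := b.pos
      simp only [List.length_cons, nsmul_eq_mul, Wn]
      push_cast [this]; rfl

/-- tail words after the first return -/
noncomputable def LB (z : Option (Fin d)) (s : List (Fin d)) (m i : ℕ) : Finset (List (Fin d)) :=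
  if 2*i ≤ m then L z s (m-2*i) else ∅

theorem LB_succ (z : Option (Fin d)) (s : List (Fin d)) (m i : ℕ) : LB z s (m+2) (i+1) = LB z s m i := by
  unfold LB
  have : 2*(i+1) ≤ m+2 ↔ 2*i ≤ m := by omega
  simp only [this, show m+2-2*(i+1) = m-2*i by omega]

theorem mem_LB {z : Option (Fin d)} {s : List (Fin d)} {m i : ℕ} {w : List (Fin d)} :
    w ∈ LB z s m i ↔ w.length + 2*i = m ∧ ok z s w := by
  unfold LB
  split_ifs with h
  · rw [mem_L]
    have : w.length = m - 2*i ↔ w.length + 2*i = m := by omega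
    rw [this]
  · simp; intro h1; omega

theorem sum_parse (z : Option (Fin d)) (b : Fin d) (s : List (Fin d)) (m n : ℕ) (hn : m < 2*n) (F : List (Fin d) → ℝ) :
    ∑ w ∈ L z (b :: s) (m+1), F w = ∑ i ∈ Finset.range n, ∑ y ∈ L (some b) [] (2*i), ∑ w' ∈ LB z s m i,
      F (y ++ b :: w') := by
  simp only [← Finset.sum_product' (L (some b) [] _) (LB z s m _) (fun y w' => F (y ++ b :: w'))]
  rw [Finset.sum_sigma']
  symm
  refine Finset.sum_nbij (fun x => x.2.1 ++ b :: x.2.2) ?_ ?_ ?_ ?_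
  · rintro ⟨i, y, w'⟩ h
    simp [mem_L, mem_LB] at h ⊢
    refine ⟨by omega, ?_⟩
    have := (ok_parse z b s (y ++ b :: w') []).2 ⟨y, w', rfl, h.2.1.2, h.2.2.2⟩
    simpa using this
  · rintro ⟨i, y, w⟩ h1 ⟨i', y', w'⟩ h2 h
    simp [mem_L, mem_LB] at h1 h2 h
    obtain ⟨rfl, rfl⟩ := ok_parse_unique b w w' y [] y' h1.2.1.2 h2.2.1.2 h
    obtain rfl : i = i' := by omega
    rfl
  · intro l hl
    rw [Finset.mem_coe, mem_L] at hl
    obtain ⟨y, w', rfl, h2, h3⟩ := (ok_parse z b s l []).1 (by simpa using hl.2)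
    obtain ⟨k, hk⟩ := ok_length _ _ _ h2
    have hl := hl.1
    simp at hl hk
    refine ⟨⟨k, y, w'⟩, ?_, rfl⟩
    simp [mem_L, mem_LB]
    refine ⟨by omega, ⟨hk, h2⟩, by omega, h3⟩
  · intros; rfl

end PFwords


section PFker

/-- size of the tail family -/
noncomputable def bn (p β : ℝ) (r m i : ℕ) : ℝ := if 2*i ≤ m then Wn p β (m-2*i) r else 0

theorem bn_succ (p β : ℝ) (r m i : ℕ) : bn p β r (m+2) (i+1) = bn p β r m i := by
  unfold bn
  have : 2*(i+1) ≤ m+2 ↔ 2*i ≤ m := by omega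
  simp only [this, show m+2-2*(i+1) = m-2*i by omega]

theorem ker_num {p β : ℝ} (hp : 0 < p) (hβ : β = p ∨ β = p+1) (r m : ℕ) :
    ∃ dd ee : ℕ → ℝ, dd 0 = 0 ∧ (∀ i, 0 ≤ dd i) ∧ (∀ i, 0 ≤ ee i) ∧
      (∀ i, dd i + ee i = Wn p β (m+1) (r+1) * (Wn p p (2*i) 0 * bn p β r (m+2) i)) ∧
      (∀ i, dd (i+1) + ee i = Wn p β (m+3) (r+1) * (Wn p p (2*i) 0 * bn p β r m i)) := by
  have hβ0 : 0 < β := by rcases hβ with rfl | rfl <;> linarith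
  set a : ℕ → ℝ := fun i => Wn p p (2*i) 0 with ha
  set Q : ℕ → ℝ := fun i => ∑ k ∈ Finset.range i, a k * bn p β r m k with hQ
  set P : ℕ → ℝ := fun i => ∑ k ∈ Finset.range i, a k * bn p β r (m+2) k with hP
  set T := Wn p β (m+1) (r+1)
  set T2 := Wn p β (m+3) (r+1)
  have hQX : ∀ i, Q i = Xn p β r (2*i) (m+1) 1 := fun i => (Xn_even p β r i m).symm
  have hPX : ∀ i, P i = Xn p β r (2*i) (m+3) 1 := fun i => (Xn_even p β r i (m+2)).symm
  have hQs : ∀ i, Q (i+1) = Q i + a i * bn p β r m i := fun i => Finset.sum_range_succ _ _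
  have hPs : ∀ i, P (i+1) = P i + a i * bn p β r (m+2) i := fun i => Finset.sum_range_succ _ _
  refine ⟨fun i => T2 * Q i - T * P i, fun i => T * P (i+1) - T2 * Q i, ?_, ?_, ?_, ?_, ?_⟩
  · simp [hQ, hP]
  · intro i
    have := Xn_mono_m hp hβ0 r (2*i) (m+1) 1
    simp only [hQX, hPX]
    change Xn p β r (2*i) (m+3) 1 * T ≤ Xn p β r (2*i) (m+1) 1 * T2 at this
    linarith
  · intro i
    have key : ∀ l, (T * P (i+l+1) - T2 * Q (i+l)) ≤ T * P (i+1) - T2 * Q i := by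
      intro l
      induction l with
      | zero => exact le_rfl
      | succ l ih =>
        refine le_trans ?_ ih
        rw [← add_assoc, hPs (i+l+1), hQs (i+l), bn_succ]
        by_cases hb : bn p β r m (i+l) = 0
        · rw [hb]; simp
        · have hb' := hb
          unfold bn at hb
          split_ifs at hb with h1
          · obtain ⟨k, hk⟩ := Wn_ne hb
            have h3 := Wn_N3 hp hβ (i+l) (i+l+k) (r+1) (by omega)
            rw [show 2*(i+l+k) + (r+1) = m+1 by omega] at h3
            change a (i+l+1) * T ≤ a (i+l) * T2 at h3
            have h4 : 0 ≤ bn p β r m (i+l) := by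
              unfold bn; split_ifs; exact Wn_nonneg hp hβ0 _ _
            nlinarith
          · exact absurd rfl hb
    refine le_trans ?_ (key (m+2))
    have h1 : P (i+(m+2)+1) = T2 := (Wn_conv p β r (i+(m+2)+1) (m+2) (by omega)).symm
    have h2 : Q (i+(m+2)) = T := (Wn_conv p β r (i+(m+2)) m (by omega)).symm
    rw [h1, h2]; linarith
  · intro i; simp only [hPs]; ring
  · intro i; simp only [hPs, hQs]; rw [show a i = Wn p p (2*i) 0 from rfl]; ring

variable {d : ℕ}

/-- w is u with a pair of equal letters inserted -/
def Ins (u w : List (Fin d)) : Prop := ∃ p q t, u = p ++ q ∧ w = p ++ t :: t :: q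

theorem Ins.cons {u w : List (Fin d)} (c : Fin d) (h : Ins u w) : Ins (c :: u) (c :: w) := by
  obtain ⟨p, q, t, rfl, rfl⟩ := h
  exact ⟨c :: p, q, t, rfl, rfl⟩

theorem Ins.append_left {u w : List (Fin d)} (y : List (Fin d)) (h : Ins u w) : Ins (y ++ u) (y ++ w) := by
  obtain ⟨p, q, t, rfl, rfl⟩ := h
  exact ⟨y ++ p, q, t, by simp, by simp⟩

theorem Ins.append_right {u w : List (Fin d)} (y : List (Fin d)) (h : Ins u w) : Ins (u ++ y) (w ++ y) := by
  obtain ⟨p, q, t, rfl, rfl⟩ := h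
  exact ⟨p, q ++ y, t, by simp, by simp⟩

abbrev BF (d : ℕ) := List (Fin d) → List (Fin d) → ℝ

/-- pullback of two-variable functions -/
def pull (g : List (Fin d) → List (Fin d)) : BF d →ₗ[ℝ] BF d where
  toFun Φ := fun w u => Φ (g w) (g u)
  map_add' _ _ := rfl
  map_smul' _ _ := rfl

theorem pull_apply (g : List (Fin d) → List (Fin d)) (Φ : BF d) : pull g Φ = fun w u => Φ (g w) (g u) := rfl

/-- evaluation functional -/
def evAt (w u : List (Fin d)) : BF d →ₗ[ℝ] ℝ where
  toFun Φ := Φ w u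
  map_add' _ _ := rfl
  map_smul' _ _ := rfl

theorem evAt_apply (w u : List (Fin d)) (Φ : BF d) : evAt w u Φ = Φ w u := rfl

/-- positive functional: transport plan from P to Q along insertions -/
def IsKer (P Q : Finset (List (Fin d))) (T : BF d →ₗ[ℝ] ℝ) : Prop :=
  (∀ Φ : BF d, (∀ w ∈ P, ∀ u ∈ Q, Ins u w → 0 ≤ Φ w u) → 0 ≤ T Φ) ∧
  (∀ F : List (Fin d) → ℝ, T (fun w _ => F w) = Q.card * ∑ w ∈ P, F w) ∧
  (∀ G : List (Fin d) → ℝ, T (fun _ u => G u) = P.card * ∑ u ∈ Q, G u)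

def HasKer (P Q : Finset (List (Fin d))) : Prop := ∃ T, IsKer P Q T

theorem HasKer_empty (P : Finset (List (Fin d))) : HasKer P ∅ :=
  ⟨0, by intro Φ _; simp, by simp, by simp⟩

theorem HasKer_zero (z : Option (Fin d)) (s : List (Fin d)) : HasKer (L z s 2) (L z s 0) := by
  cases s with
  | cons b s =>
    have : L z (b :: s) 0 = ∅ := by
      ext w; simp [mem_L]; rintro rfl; simp [ok_nil]
    rw [this]; exact HasKer_empty _
  | nil =>
    have h0 : L z [] 0 = {[]} := by
      ext w; simp [mem_L]; rintro rfl; simp [ok_nil]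
    rw [h0]
    refine ⟨∑ w ∈ L z [] 2, evAt w [], ?_, ?_, ?_⟩
    · intro Φ hΦ
      simp only [LinearMap.sum_apply, evAt_apply]
      refine Finset.sum_nonneg fun w hw => hΦ w hw [] (by simp) ?_
      rw [mem_L] at hw
      obtain ⟨h1, h2⟩ := hw
      match w, h1 with
      | [a, c], _ =>
        rw [ok_nil_cons] at h2
        by_cases hac : c = a
        · subst hac; exact ⟨[], [], c, rfl, rfl⟩
        · rw [ok_cons_ne _ hac, ok_nil] at h2; simp at h2
    · intro F; simp [LinearMap.sum_apply, evAt_apply]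
    · intro G; simp [LinearMap.sum_apply, evAt_apply]

theorem bet_cases (hd : 3 ≤ d) (z : Option (Fin d)) :
    bet d z = (d:ℝ)-1 ∨ bet d z = ((d:ℝ)-1)+1 := by
  unfold bet; split_ifs
  · right; ring
  · left; rfl

theorem card_LB (z : Option (Fin d)) (s : List (Fin d)) (m i : ℕ) :
    ((LB z s m i).card : ℝ) = bn ((d:ℝ)-1) (bet d z) s.length m i := by
  unfold LB bn
  split_ifs with h
  · rw [card_L]
  · simp

theorem HasKer_L (hd : 3 ≤ d) (k : ℕ) : ∀ (z : Option (Fin d)) (s : List (Fin d)),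
    HasKer (L z s (k+2)) (L z s k) := by
  have hd' : (3:ℝ) ≤ d := by exact_mod_cast hd
  have hp : (0:ℝ) < (d:ℝ) - 1 := by linarith
  induction k using Nat.strong_induction_on with
  | _ k ih =>
    intro z s
    rcases k with _ | m
    · exact HasKer_zero z s
    rcases s with _ | ⟨b, s⟩
    · -- empty stack
      have h : ∀ c : Fin d, HasKer (L z [c] (m+2)) (L z [c] m) := fun c => ih m (by omega) z [c]
      choose T hT using h
      have hcard : ∀ n (c : Fin d), ((L z [] (n+1)).card : ℝ) = bet d z * (L z [c] n).card := by
        intro n c; rw [card_L, card_L]; rfl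
      have hb : 0 < bet d z := by rcases bet_cases hd z with h | h <;> rw [h] <;> linarith
      refine ⟨∑ c, if some c ≠ z then bet d z • (T c).comp (pull (List.cons c)) else 0, ?_, ?_, ?_⟩
      · intro Φ hΦ
        rw [LinearMap.sum_apply]
        refine Finset.sum_nonneg fun c _ => ?_
        split_ifs with hc
        · rw [LinearMap.smul_apply, LinearMap.comp_apply, smul_eq_mul]
          refine mul_nonneg hb.le ((hT c).1 _ fun w hw u hu hI => hΦ _ ?_ _ ?_ (hI.cons c))
          · rw [mem_L] at hw ⊢; exact ⟨by simp [hw.1], by rw [ok_nil_cons]; exact ⟨hc, hw.2⟩⟩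
          · rw [mem_L] at hu ⊢; exact ⟨by simp [hu.1], by rw [ok_nil_cons]; exact ⟨hc, hu.2⟩⟩
        · simp
      · intro F
        rw [LinearMap.sum_apply, sum_L_nil, Finset.mul_sum]
        refine Finset.sum_congr rfl fun c _ => ?_
        split_ifs with hc
        · rw [LinearMap.smul_apply, LinearMap.comp_apply, smul_eq_mul, pull_apply, (hT c).2.1, hcard m c]
          ring
        · simp
      · intro G
        rw [LinearMap.sum_apply, sum_L_nil, Finset.mul_sum]
        refine Finset.sum_congr rfl fun c _ => ?_
        split_ifs with hc
        · rw [LinearMap.smul_apply, LinearMap.comp_apply, smul_eq_mul, pull_apply, (hT c).2.2, hcard (m+2) c]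
          ring
        · simp
    · -- nonempty stack
      obtain ⟨dd, ee, hd0, hdd, hee, hde1, hde2⟩ := ker_num hp (bet_cases hd z) s.length m
      have hβ0 : 0 < bet d z := by rcases bet_cases hd z with h | h <;> rw [h] <;> linarith
      have hA : ∀ i, ∃ T : BF d →ₗ[ℝ] ℝ, 2*i ≤ m → IsKer (L (some b) [] (2*(i+1))) (L (some b) [] (2*i)) T := by
        intro i
        by_cases hi : 2*i ≤ m
        · obtain ⟨T, hT⟩ := ih (2*i) (by omega) (some b) []
          exact ⟨T, fun _ => hT⟩
        · exact ⟨0, fun h => absurd h hi⟩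
      choose TA hTA using hA
      have hB : ∀ i, HasKer (LB z s (m+2) i) (LB z s m i) := by
        intro i
        by_cases hi : 2*i ≤ m
        · have := ih (m-2*i) (by omega) z s
          unfold LB
          rw [if_pos hi, if_pos (by omega), show m+2-2*i = m-2*i+2 by omega]; exact this
        · have : LB z s m i = ∅ := by unfold LB; rw [if_neg hi]
          rw [this]; exact HasKer_empty _
      choose TB hTB using hB
      set a : ℕ → ℝ := fun i => Wn ((d:ℝ)-1) ((d:ℝ)-1) (2*i) 0 with ha
      have hca : ∀ i, ((L (some b) [] (2*i)).card : ℝ) = a i := by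
        intro i; rw [card_L]; simp [bet, ha]
      have ha0 : ∀ i, 0 < a i := fun i => Wn_pos hp hp _ _ i (by simp)
      set B : ℕ → ℝ := fun i => bn ((d:ℝ)-1) (bet d z) s.length m i with hBd
      set B2 : ℕ → ℝ := fun i => bn ((d:ℝ)-1) (bet d z) s.length (m+2) i with hB2d
      have hcB : ∀ i, ((LB z s m i).card : ℝ) = B i := card_LB z s m
      have hcB2 : ∀ i, ((LB z s (m+2) i).card : ℝ) = B2 i := card_LB z s (m+2)
      have hB0 : ∀ i, 0 ≤ B i := fun i => by rw [← hcB]; positivity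
      have hB20 : ∀ i, 0 ≤ B2 i := fun i => by rw [← hcB2]; positivity
      have hBB : ∀ i, B i ≠ 0 → B2 i ≠ 0 := by
        intro i h
        simp only [hBd, hB2d, bn] at h ⊢
        split_ifs at h with hi
        · obtain ⟨n, hn⟩ := Wn_ne h
          rw [if_pos (by omega)]
          exact (Wn_pos hp hβ0 _ _ (n+1) (by omega)).ne'
        · exact absurd rfl h
      have hT1 : ((L z (b :: s) (m+1)).card : ℝ) = Wn ((d:ℝ)-1) (bet d z) (m+1) (s.length+1) := card_L _ _ _
      have hT3 : ((L z (b :: s) (m+3)).card : ℝ) = Wn ((d:ℝ)-1) (bet d z) (m+3) (s.length+1) := card_L _ _ _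
      rw [← hT1] at hde1
      rw [← hT3] at hde2
      change ∀ i, dd i + ee i = _ * (a i * B2 i) at hde1
      change ∀ i, dd (i+1) + ee i = _ * (a i * B i) at hde2
      obtain ⟨n, hn⟩ : ∃ n, n = m + 1 := ⟨_, rfl⟩
      -- the functional
      let TT : BF d →ₗ[ℝ] ℝ := ∑ i ∈ Finset.range (n+1),
        ((dd (i+1) / (a (i+1) * a i * B i)) • ∑ w' ∈ LB z s m i, (TA i).comp (pull (fun y => y ++ b :: w')) +
         (ee i / (a i * B2 i * B i)) • ∑ y ∈ L (some b) [] (2*i), (TB i).comp (pull (fun w => y ++ b :: w)))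
      have hTT : ∀ Φ, TT Φ = ∑ i ∈ Finset.range (n+1),
        ((dd (i+1) / (a (i+1) * a i * B i)) * ∑ w' ∈ LB z s m i, TA i (fun w u => Φ (w ++ b :: w') (u ++ b :: w')) +
         (ee i / (a i * B2 i * B i)) * ∑ y ∈ L (some b) [] (2*i), TB i (fun w u => Φ (y ++ b :: w) (y ++ b :: u))) := by
        intro Φ
        simp only [TT, LinearMap.sum_apply, LinearMap.add_apply, LinearMap.smul_apply, LinearMap.comp_apply,
          pull_apply, smul_eq_mul]
      have hmem : ∀ k i y w', y ∈ L (some b) [] (2*i) → w' ∈ LB z s k i → y ++ b :: w' ∈ L z (b :: s) (k+1) := by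
        intro k i y w' hy hw
        rw [mem_L] at hy ⊢; rw [mem_LB] at hw
        refine ⟨by simp; omega, ?_⟩
        have := (ok_parse z b s (y ++ b :: w') []).2 ⟨y, w', rfl, hy.2, hw.2⟩
        simpa using this
      have hle : ∀ i w', w' ∈ LB z s m i → 2*i ≤ m := by
        intro i w' h; rw [mem_LB] at h; omega
      have hee0 : ∀ i, B i = 0 → ee i = 0 := by
        intro i h
        have h1 := hde2 i; rw [h] at h1
        have := hdd (i+1); have := hee i; nlinarith
      have hdd0 : ∀ i, B i = 0 → dd (i+1) = 0 := by
        intro i h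
        have h1 := hde2 i; rw [h] at h1
        have := hdd (i+1); have := hee i; nlinarith
      refine ⟨TT, ?_, ?_, ?_⟩
      · intro Φ hΦ
        rw [hTT]
        refine Finset.sum_nonneg fun i _ => add_nonneg (mul_nonneg ?_ ?_) (mul_nonneg ?_ ?_)
        · have := hdd (i+1); have := ha0 i; have := ha0 (i+1); have := hB0 i; positivity
        · refine Finset.sum_nonneg fun w' hw' => ?_
          refine (hTA i (hle i w' hw')).1 _ fun w hw u hu hI => hΦ _ ?_ _ ?_ (hI.append_right _)
          · exact hmem (m+2) (i+1) _ _ hw (by rw [LB_succ]; exact hw')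
          · exact hmem m i _ _ hu hw'
        · have := hee i; have := ha0 i; have := hB20 i; have := hB0 i; positivity
        · refine Finset.sum_nonneg fun y hy => ?_
          refine (hTB i).1 _ fun w hw u hu hI => hΦ _ ?_ _ ?_ ((hI.cons b).append_left _)
          · exact hmem (m+2) i _ _ hy hw
          · exact hmem m i _ _ hy hu
      · intro F
        rw [hTT]
        set S : ℕ → ℝ := fun i => ∑ y ∈ L (some b) [] (2*i), ∑ w' ∈ LB z s (m+2) i, F (y ++ b :: w') with hS
        have e1 : ∀ i, (dd (i+1) / (a (i+1) * a i * B i)) * ∑ w' ∈ LB z s m i, TA i (fun w _ => F (w ++ b :: w')) =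
            dd (i+1) / (a (i+1) * B2 (i+1)) * S (i+1) := by
          intro i
          have h1 : ∑ w' ∈ LB z s m i, TA i (fun w _ => F (w ++ b :: w')) = a i * S (i+1) := by
            rw [hS]; simp only []
            rw [Finset.sum_comm, LB_succ, Finset.mul_sum]
            refine Finset.sum_congr rfl fun w' hw' => ?_
            rw [(hTA i (hle i w' hw')).2.1 (fun w => F (w ++ b :: w')), hca]
          rw [h1, show B2 (i+1) = B i from bn_succ _ _ _ _ _]
          have := (ha0 i).ne'
          have := (ha0 (i+1)).ne'
          by_cases hb0 : B i = 0
          · rw [hdd0 i hb0]; simp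
          · field_simp
        have e2 : ∀ i, (ee i / (a i * B2 i * B i)) * ∑ y ∈ L (some b) [] (2*i), TB i (fun w _ => F (y ++ b :: w)) =
            ee i / (a i * B2 i) * S i := by
          intro i
          have h1 : ∑ y ∈ L (some b) [] (2*i), TB i (fun w _ => F (y ++ b :: w)) = B i * S i := by
            rw [hS]; simp only []
            rw [Finset.mul_sum]
            refine Finset.sum_congr rfl fun y hy => ?_
            rw [(hTB i).2.1 (fun w => F (y ++ b :: w)), hcB]
          rw [h1]
          have := (ha0 i).ne'
          by_cases hb0 : B i = 0
          · rw [hee0 i hb0]; simp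
          · have := hBB i hb0
            field_simp
        simp only [e1, e2]
        rw [sum_parse z b s (m+2) (n+2) (by omega)]
        change _ = _ * ∑ i ∈ Finset.range (n+1+1), S i
        rw [Finset.sum_add_distrib]
        have e3 : ∀ i, ((L z (b :: s) (m+1)).card : ℝ) * S i = dd i / (a i * B2 i) * S i + ee i / (a i * B2 i) * S i := by
          intro i
          by_cases hb0 : B2 i = 0
          · have : LB z s (m+2) i = ∅ := by
              rw [← hcB2] at hb0
              exact Finset.card_eq_zero.1 (by exact_mod_cast hb0)
            simp [hS, this]
          · have := (ha0 i).ne'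
            rw [← add_mul, ← add_div, hde1]; field_simp
        have hSlast : S (n+1) = 0 := by
          have : LB z s (m+2) (n+1) = ∅ := by unfold LB; rw [if_neg (by omega)]
          simp [hS, this]
        rw [Finset.mul_sum]
        simp only [e3]
        rw [Finset.sum_add_distrib]
        congr 1
        · rw [Finset.sum_range_succ' (fun i => dd i / (a i * B2 i) * S i), hd0]; simp
        · rw [Finset.sum_range_succ (fun i => ee i / (a i * B2 i) * S i) (n+1), hSlast]; simp
      · intro G
        rw [hTT, sum_parse z b s m (n+1) (by omega), Finset.mul_sum]
        refine Finset.sum_congr rfl fun i _ => ?_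
        by_cases hb0 : B i = 0
        · have : LB z s m i = ∅ := by
            rw [← hcB] at hb0
            exact Finset.card_eq_zero.1 (by exact_mod_cast hb0)
          rw [hdd0 i hb0, hee0 i hb0, this]; simp
        · have h1 : ∑ w' ∈ LB z s m i, TA i (fun _ u => G (u ++ b :: w')) = a (i+1) *
              ∑ y ∈ L (some b) [] (2*i), ∑ w' ∈ LB z s m i, G (y ++ b :: w') := by
            rw [Finset.sum_comm, Finset.mul_sum]
            refine Finset.sum_congr rfl fun w' hw' => ?_
            rw [(hTA i (hle i w' hw')).2.2 (fun w => G (w ++ b :: w')), hca]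
          have h2 : ∑ y ∈ L (some b) [] (2*i), TB i (fun _ u => G (y ++ b :: u)) = B2 i *
              ∑ y ∈ L (some b) [] (2*i), ∑ w' ∈ LB z s m i, G (y ++ b :: w') := by
            rw [Finset.mul_sum]
            refine Finset.sum_congr rfl fun y hy => ?_
            rw [(hTB i).2.2 (fun w => G (y ++ b :: w)), hcB2]
          rw [h1, h2]
          have := (ha0 i).ne'
          have := (ha0 (i+1)).ne'
          have := hBB i hb0
          have h5 := hde2 i
          have h6 : ((L z (b :: s) (m+1+2)).card : ℝ) = (dd (i+1) + ee i) / (a i * B i) := by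
            rw [h5]; field_simp
          rw [h6]
          field_simp

end PFker


section PFhop
variable {d : ℕ}

def AdjLt (w1 w2 : List (Fin d)) : Prop :=
  ∃ a t t' b, t < t' ∧ w1 = a ++ t :: t :: b ∧ w2 = a ++ t' :: t' :: b

/-- Dirichlet energy on a family of words -/
noncomputable def En (S : Finset (List (Fin d))) (f : List (Fin d) → ℝ) : ℝ :=
  ∑ w1 ∈ S, ∑ w2 ∈ S, if AdjLt w1 w2 then (f w1 - f w2)^2 else 0

def Hop (z : Option (Fin d)) (s : List (Fin d)) (w1 w2 : List (Fin d)) : Prop :=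
  ∃ u, ok z s u ∧ Ins u w1 ∧ Ins u w2

noncomputable def HopE (z : Option (Fin d)) (s : List (Fin d)) (m : ℕ) (f : List (Fin d) → ℝ) : ℝ :=
  ∑ w1 ∈ L z s m, ∑ w2 ∈ L z s m, if Hop z s w1 w2 then (f w1 - f w2)^2 else 0

theorem En_nonneg (S : Finset (List (Fin d))) (f : List (Fin d) → ℝ) : 0 ≤ En S f :=
  Finset.sum_nonneg fun _ _ => Finset.sum_nonneg fun _ _ => by split_ifs <;> positivity

theorem HopE_nonneg (z : Option (Fin d)) (s : List (Fin d)) (m : ℕ) (f : List (Fin d) → ℝ) : 0 ≤ HopE z s m f :=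
  Finset.sum_nonneg fun _ _ => Finset.sum_nonneg fun _ _ => by split_ifs <;> positivity

theorem single_le_En {S : Finset (List (Fin d))} (f : List (Fin d) → ℝ) {w1 w2 : List (Fin d)} (h1 : w1 ∈ S) (h2 : w2 ∈ S)
    (h : AdjLt w1 w2) : (f w1 - f w2)^2 ≤ En S f := by
  have e1 := Finset.single_le_sum (f := fun w1 => ∑ w2 ∈ S, if AdjLt w1 w2 then (f w1 - f w2)^2 else 0)
    (fun w _ => Finset.sum_nonneg fun _ _ => by split_ifs <;> positivity) h1
  have e2 := Finset.single_le_sum (f := fun w2 => if AdjLt w1 w2 then (f w1 - f w2)^2 else 0)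
    (fun w _ => by split_ifs <;> positivity) h2
  simp only [h, if_true] at e2
  exact e2.trans e1

theorem samepos_le {S : Finset (List (Fin d))} (f : List (Fin d) → ℝ) (a b : List (Fin d)) (t t' : Fin d)
    (h1 : a ++ t :: t :: b ∈ S) (h2 : a ++ t' :: t' :: b ∈ S) :
    |f (a ++ t :: t :: b) - f (a ++ t' :: t' :: b)| ≤ Real.sqrt (En S f) := by
  rcases lt_trichotomy t t' with h | h | h
  · exact Real.abs_le_sqrt (single_le_En f h1 h2 ⟨a, t, t', b, h, rfl, rfl⟩)
  · subst h; simp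
  · rw [abs_sub_comm]; exact Real.abs_le_sqrt (single_le_En f h2 h1 ⟨a, t', t, b, h, rfl, rfl⟩)

noncomputable def Su (z : Option (Fin d)) (s : List (Fin d)) (m : ℕ) (u : List (Fin d)) : Finset (List (Fin d)) :=
  (L z s m).filter (Ins u)

theorem mem_Su {z : Option (Fin d)} {s : List (Fin d)} {m : ℕ} {u w : List (Fin d)} :
    w ∈ Su z s m u ↔ w ∈ L z s m ∧ Ins u w := by simp [Su]

theorem Su_path {z : Option (Fin d)} {s : List (Fin d)} (hs : Good z s) (m : ℕ) (f : List (Fin d) → ℝ)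
    (a0 : Fin d) (u' : List (Fin d)) (hu : ok z s (a0 :: u')) (hm : (a0 :: u').length + 2 = m) :
    ∀ n (p q : List (Fin d)) t, p.length = n → a0 :: u' = p ++ q → p ++ t :: t :: q ∈ L z s m →
    |f (p ++ t :: t :: q) - f (a0 :: a0 :: a0 :: u')| ≤ (n+1) * Real.sqrt (En (Su z s m (a0 :: u')) f) := by
  intro n
  induction n with
  | zero =>
    intro p q t hp he hw
    obtain rfl : p = [] := List.length_eq_zero_iff.1 hp
    simp only [List.nil_append] at he hw ⊢
    subst he
    have h2 : a0 :: a0 :: a0 :: u' ∈ L z s m := by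
      rw [mem_L]; exact ⟨by simp at hm ⊢; omega, ok_triple z a0 u' [] s hs hu⟩
    have := samepos_le (S := Su z s m (a0 :: u')) f [] (a0 :: u') t a0
      (mem_Su.2 ⟨hw, [], a0 :: u', t, rfl, rfl⟩) (mem_Su.2 ⟨h2, [], a0 :: u', a0, rfl, rfl⟩)
    simpa using this
  | succ n ih =>
    intro p q t hp he hw
    obtain ⟨p', a, rfl⟩ : ∃ p' a, p = p' ++ [a] := by
      rcases List.eq_nil_or_concat p with h | ⟨p', a, h⟩
      · subst h; simp at hp
      · exact ⟨p', a, by simpa using h⟩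
    have he' : a0 :: u' = p' ++ a :: q := by simpa using he
    have h2 : p' ++ a :: a :: (a :: q) ∈ L z s m := by
      rw [mem_L]; refine ⟨?_, ok_triple z a q p' s hs (he' ▸ hu)⟩
      rw [he'] at hm; simp at hm ⊢; omega
    have h3 := ih p' (a :: q) a (by simpa using hp) he' h2
    have h4 := samepos_le (S := Su z s m (a0 :: u')) f (p' ++ [a]) q t a
      (mem_Su.2 ⟨hw, p' ++ [a], q, t, he, rfl⟩)
      (mem_Su.2 ⟨by simpa using h2, p' ++ [a], q, a, he, rfl⟩)
    have h5 : (p' ++ [a]) ++ a :: a :: q = p' ++ a :: a :: a :: q := by simp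
    rw [h5] at h4
    have := abs_sub_le (f (p' ++ [a] ++ t :: t :: q)) (f (p' ++ a :: a :: a :: q)) (f (a0 :: a0 :: a0 :: u'))
    push_cast
    linarith

theorem Su_le {z : Option (Fin d)} {s : List (Fin d)} (hs : Good z s) (m : ℕ) (f : List (Fin d) → ℝ)
    (u : List (Fin d)) (hu : ok z s u) {w1 w2 : List (Fin d)} (h1 : w1 ∈ Su z s m u) (h2 : w2 ∈ Su z s m u) :
    (f w1 - f w2)^2 ≤ (2*m)^2 * En (Su z s m u) f := by
  have hE := En_nonneg (Su z s m u) f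
  have hD := Real.sqrt_nonneg (En (Su z s m u) f)
  have key : |f w1 - f w2| ≤ 2 * m * Real.sqrt (En (Su z s m u) f) := by
    have g1 := h1
    have g2 := h2
    rw [mem_Su] at h1 h2
    obtain ⟨h1, p, q, t, e1, e2⟩ := h1
    obtain ⟨h2, p', q', t', e1', e2'⟩ := h2
    have hlen : u.length + 2 = m := by
      rw [mem_L] at h1; rw [← h1.1, e1, e2]; simp; omega
    cases u with
    | nil =>
      obtain ⟨rfl, rfl⟩ : p = [] ∧ q = [] := by simpa using e1.symm
      obtain ⟨rfl, rfl⟩ : p' = [] ∧ q' = [] := by simpa using e1'.symm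
      subst e2 e2'
      have := samepos_le f [] [] t t' g1 g2
      simp at hlen; subst hlen
      refine this.trans ?_
      push_cast; nlinarith
    | cons a0 u' =>
      subst e2 e2'
      have k1 := Su_path hs m f a0 u' hu hlen p.length p q t rfl e1 h1
      have k2 := Su_path hs m f a0 u' hu hlen p'.length p' q' t' rfl e1' h2
      have l1 : (p.length:ℝ)+1 ≤ m := by
        have : p.length + 1 ≤ m := by rw [← hlen, e1]; simp; omega
        exact_mod_cast this
      have l2 : (p'.length:ℝ)+1 ≤ m := by
        have : p'.length + 1 ≤ m := by rw [← hlen, e1']; simp; omega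
        exact_mod_cast this
      have := abs_sub_le (f (p ++ t :: t :: q)) (f (a0 :: a0 :: a0 :: u')) (f (p' ++ t' :: t' :: q'))
      rw [abs_sub_comm (f (a0 :: a0 :: a0 :: u'))] at this
      nlinarith
  calc (f w1 - f w2)^2 = |f w1 - f w2|^2 := (sq_abs _).symm
    _ ≤ (2 * m * Real.sqrt (En (Su z s m u) f))^2 := by gcongr
    _ = _ := by rw [mul_pow, Real.sq_sqrt hE]

theorem Su_card (z : Option (Fin d)) (s : List (Fin d)) (m : ℕ) (u : List (Fin d)) :
    (Su z s m u).card ≤ m * d := by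
  have : Su z s m u ⊆ (Finset.range m ×ˢ (Finset.univ : Finset (Fin d))).image
      (fun x => u.take x.1 ++ x.2 :: x.2 :: u.drop x.1) := by
    intro w hw
    rw [mem_Su, mem_L] at hw
    obtain ⟨⟨h1, _⟩, p, q, t, e1, e2⟩ := hw
    refine Finset.mem_image.2 ⟨(p.length, t), ?_, ?_⟩
    · simp; rw [← h1, e2]; simp
    · simp [e1, e2]
  refine (Finset.card_le_card this).trans (Finset.card_image_le.trans ?_)
  simp

theorem pre_card (m : ℕ) (w : List (Fin d)) (hw : w.length = m) (Q : Finset (List (Fin d))) :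
    (Q.filter (fun u => Ins u w)).card ≤ m := by
  have : Q.filter (fun u => Ins u w) ⊆ (Finset.range m).image
      (fun k => w.take k ++ w.drop (k+2)) := by
    intro u hu
    rw [Finset.mem_filter] at hu
    obtain ⟨_, p, q, t, e1, e2⟩ := hu
    refine Finset.mem_image.2 ⟨p.length, ?_, ?_⟩
    · simp; rw [← hw, e2]; simp
    · simp [e1, e2, List.drop_append]
  refine (Finset.card_le_card this).trans (Finset.card_image_le.trans ?_)
  simp

theorem HopE_le {z : Option (Fin d)} {s : List (Fin d)} (hs : Good z s) (m : ℕ) (f : List (Fin d) → ℝ) :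
    HopE z s m f ≤ 4 * m^5 * d^2 * En (L z s m) f := by
  set U := L z s (m-2) with hU
  have step1 : HopE z s m f ≤ ∑ u ∈ U, ∑ w1 ∈ Su z s m u, ∑ w2 ∈ Su z s m u, (f w1 - f w2)^2 := by
    have : ∑ u ∈ U, ∑ w1 ∈ Su z s m u, ∑ w2 ∈ Su z s m u, (f w1 - f w2)^2 =
        ∑ w1 ∈ L z s m, ∑ w2 ∈ L z s m, ∑ u ∈ U, if Ins u w1 ∧ Ins u w2 then (f w1 - f w2)^2 else 0 := by
      simp only [Su, Finset.sum_filter]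
      rw [Finset.sum_comm]
      refine Finset.sum_congr rfl fun w1 _ => ?_
      rw [Finset.sum_comm]
      refine Finset.sum_congr rfl fun u _ => ?_
      by_cases h : Ins u w1 <;> simp [h]
    rw [this]
    refine Finset.sum_le_sum fun w1 hw1 => Finset.sum_le_sum fun w2 _ => ?_
    split_ifs with h
    · obtain ⟨u, hu, i1, i2⟩ := h
      have hu' : u ∈ U := by
        rw [hU, mem_L]; refine ⟨?_, hu⟩
        rw [mem_L] at hw1
        obtain ⟨p, q, t, rfl, rfl⟩ := i1
        have := hw1.1; simp at this ⊢; omega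
      have := Finset.single_le_sum (f := fun u => if Ins u w1 ∧ Ins u w2 then (f w1 - f w2)^2 else 0)
        (fun _ _ => by split_ifs <;> positivity) hu'
      simpa [i1, i2] using this
    · exact Finset.sum_nonneg fun _ _ => by split_ifs <;> positivity
  have step2 : ∑ u ∈ U, ∑ w1 ∈ Su z s m u, ∑ w2 ∈ Su z s m u, (f w1 - f w2)^2 ≤
      ∑ u ∈ U, 4 * m^4 * d^2 * En (Su z s m u) f := by
    refine Finset.sum_le_sum fun u hu => ?_
    have hu' : ok z s u := (mem_L.1 hu).2
    have hE := En_nonneg (Su z s m u) f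
    have hc : ((Su z s m u).card : ℝ) ≤ m * d := by exact_mod_cast Su_card z s m u
    calc ∑ w1 ∈ Su z s m u, ∑ w2 ∈ Su z s m u, (f w1 - f w2)^2
        ≤ ∑ w1 ∈ Su z s m u, ∑ w2 ∈ Su z s m u, (2*m)^2 * En (Su z s m u) f :=
          Finset.sum_le_sum fun w1 h1 => Finset.sum_le_sum fun w2 h2 => Su_le hs m f u hu' h1 h2
      _ = ((Su z s m u).card)^2 * ((2*m)^2 * En (Su z s m u) f) := by
          simp only [Finset.sum_const, nsmul_eq_mul]; ring
      _ ≤ (m*d)^2 * ((2*m)^2 * En (Su z s m u) f) := by gcongr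
      _ = _ := by ring
  have step3 : ∑ u ∈ U, En (Su z s m u) f ≤ m * En (L z s m) f := by
    simp only [En, Su, Finset.sum_filter]
    rw [Finset.sum_comm, Finset.mul_sum]
    refine Finset.sum_le_sum fun w1 hw1 => ?_
    have hle : ∑ u ∈ U, (if Ins u w1 then (1:ℝ) else 0) ≤ m := by
      rw [← Finset.sum_filter, ← Finset.cast_card]
      exact_mod_cast pre_card m w1 (mem_L.1 hw1).1 U
    set A := ∑ w2 ∈ L z s m, if AdjLt w1 w2 then (f w1 - f w2)^2 else 0 with hA
    have hA0 : 0 ≤ A := Finset.sum_nonneg fun _ _ => by split_ifs <;> positivity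
    refine le_trans (Finset.sum_le_sum (g := fun u => (if Ins u w1 then (1:ℝ) else 0) * A) fun u _ => ?_) ?_
    · split_ifs with h
      · rw [one_mul]
        refine Finset.sum_le_sum fun w2 _ => ?_
        by_cases h3 : Ins u w2
        · rw [if_pos h3]
        · rw [if_neg h3]; split_ifs <;> positivity
      · simp
    · rw [← Finset.sum_mul]; gcongr
  rw [← Finset.mul_sum] at step2
  calc HopE z s m f ≤ 4 * m^4 * d^2 * ∑ u ∈ U, En (Su z s m u) f := step1.trans step2
    _ ≤ 4 * m^4 * d^2 * (m * En (L z s m) f) := by gcongr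
    _ = _ := by ring

end PFhop


section PFvar
variable {ι κ : Type*}

noncomputable def mu (S : Finset ι) (f : ι → ℝ) : ℝ := (∑ i ∈ S, f i) / S.card

noncomputable def vr (S : Finset ι) (f : ι → ℝ) : ℝ := ∑ i ∈ S, (f i - mu S f)^2

theorem card_mul_mu (S : Finset ι) (f : ι → ℝ) : S.card * mu S f = ∑ i ∈ S, f i := by
  unfold mu
  rcases S.eq_empty_or_nonempty with rfl | h
  · simp
  · have : (S.card : ℝ) ≠ 0 := by exact_mod_cast h.card_pos.ne'
    field_simp

theorem vr_nonneg (S : Finset ι) (f : ι → ℝ) : 0 ≤ vr S f := Finset.sum_nonneg fun _ _ => sq_nonneg _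

theorem vr_decomp (S : Finset ι) (f : ι → ℝ) (c : ℝ) :
    ∑ i ∈ S, (f i - c)^2 = vr S f + S.card * (mu S f - c)^2 := by
  have h := card_mul_mu S f
  unfold vr
  have e : ∀ x, ∑ i ∈ S, (f i - x)^2 = ∑ i ∈ S, (f i)^2 - 2 * x * ∑ i ∈ S, f i + S.card * x^2 := by
    intro x
    simp only [sub_sq, Finset.sum_add_distrib, Finset.sum_sub_distrib, Finset.sum_const, nsmul_eq_mul]
    congr 2
    rw [Finset.mul_sum]; exact Finset.sum_congr rfl fun i _ => by ring
  rw [e, e, ← h]; ring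

theorem vr_le (S : Finset ι) (f : ι → ℝ) (c : ℝ) : vr S f ≤ ∑ i ∈ S, (f i - c)^2 := by
  rw [vr_decomp]; have : 0 ≤ (S.card:ℝ) * (mu S f - c)^2 := by positivity
  linarith

theorem efron_stein (A : Finset ι) (B : Finset κ) (g : ι → κ → ℝ) :
    ∑ a ∈ A, ∑ b ∈ B, (g a b - mu B (fun b => mu A (fun a => g a b)))^2 ≤
      ∑ b ∈ B, vr A (fun a => g a b) + ∑ a ∈ A, vr B (g a) := by
  rw [Finset.sum_comm]
  have : ∀ b ∈ B, ∑ a ∈ A, (g a b - mu B (fun b => mu A (fun a => g a b)))^2 ≤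
      vr A (fun a => g a b) + ∑ a ∈ A, (g a b - mu B (g a))^2 := by
    intro b _
    rw [vr_decomp]
    gcongr
    rcases A.eq_empty_or_nonempty with rfl | hA
    · simp
    have hA0 : (0:ℝ) < A.card := by exact_mod_cast hA.card_pos
    have e1 : (A.card : ℝ) * (mu A (fun a => g a b) - mu B (fun b => mu A (fun a => g a b)))
        = ∑ a ∈ A, (g a b - mu B (g a)) := by
      rw [mul_sub, card_mul_mu, Finset.sum_sub_distrib]
      congr 1
      unfold mu
      rw [← Finset.sum_div, Finset.sum_comm, ← Finset.sum_div]
      field_simp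
    have e2 := sq_sum_le_card_mul_sum_sq (s := A) (f := fun a => g a b - mu B (g a))
    rw [← e1, mul_pow] at e2
    nlinarith
  refine (Finset.sum_le_sum this).trans (le_of_eq ?_)
  rw [Finset.sum_add_distrib]
  congr 1
  rw [Finset.sum_comm]; rfl

theorem chain_sq (c H : ℝ) (hc : 0 ≤ c) (a : ℕ → ℝ) (i : ℕ) (h : ∀ l < i, c * (a (l+1) - a l)^2 ≤ H) :
    c * (a i - a 0)^2 ≤ i^2 * H := by
  have e1 : a i - a 0 = ∑ l ∈ Finset.range i, (a (l+1) - a l) := (Finset.sum_range_sub a i).symm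
  have e2 := sq_sum_le_card_mul_sum_sq (s := Finset.range i) (f := fun l => a (l+1) - a l)
  rw [← e1, Finset.card_range] at e2
  calc c * (a i - a 0)^2 ≤ c * (i * ∑ l ∈ Finset.range i, (a (l+1) - a l)^2) := by gcongr
    _ = i * ∑ l ∈ Finset.range i, c * (a (l+1) - a l)^2 := by rw [← Finset.mul_sum]; ring
    _ ≤ i * ∑ l ∈ Finset.range i, H := by
      gcongr with l hl; exact h l (Finset.mem_range.1 hl)
    _ = i^2 * H := by simp; ring

end PFvar

section PFtrans
variable {d : ℕ}

theorem IsKer.toK {P Q : Finset (List (Fin d))} {T : BF d →ₗ[ℝ] ℝ} (h : IsKer P Q T) :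
    ∃ K : BF d, (∀ w ∈ P, ∀ u ∈ Q, 0 ≤ K w u) ∧ (∀ w ∈ P, ∀ u ∈ Q, ¬ Ins u w → K w u = 0) ∧
      (∀ w ∈ P, ∑ u ∈ Q, K w u = Q.card) ∧ (∀ u ∈ Q, ∑ w ∈ P, K w u = P.card) := by
  obtain ⟨hpos, hF, hG⟩ := h
  have mono : ∀ Φ Ψ : BF d, (∀ w ∈ P, ∀ u ∈ Q, Ins u w → Φ w u = Ψ w u) → T Φ = T Ψ := by
    intro Φ Ψ he
    have h1 := hpos (Φ - Ψ) fun w hw u hu hI => by simp [he w hw u hu hI]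
    have h2 := hpos (Ψ - Φ) fun w hw u hu hI => by simp [he w hw u hu hI]
    rw [map_sub] at h1 h2
    linarith
  refine ⟨fun w u => T (fun w' u' => if w' = w ∧ u' = u then 1 else 0), ?_, ?_, ?_, ?_⟩
  · intro w _ u _
    exact hpos _ fun _ _ _ _ _ => by split_ifs <;> norm_num
  · intro w hw u hu hI
    refine (mono _ 0 ?_).trans (map_zero T)
    intro w' _ u' _ hI'
    simp; rintro rfl rfl; exact hI hI'
  · intro w hw
    rw [← map_sum]
    have := hF (fun w' => if w' = w then 1 else 0)
    simp only [Finset.sum_ite_eq', hw, if_true, mul_one] at this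
    rw [← this]
    apply mono
    intro w' hw' u' hu' _
    rw [Finset.sum_apply, Finset.sum_apply]
    by_cases h : w' = w <;> simp [h, hu']
  · intro u hu
    rw [← map_sum]
    have := hG (fun u' => if u' = u then 1 else 0)
    simp only [Finset.sum_ite_eq', hu, if_true, mul_one] at this
    rw [← this]
    apply mono
    intro w' hw' u' hu' _
    rw [Finset.sum_apply, Finset.sum_apply]
    by_cases h : u' = u <;> simp [h, hw']

theorem app_inj {F : Finset (List (Fin d))} (G : Finset (List (Fin d))) {n : ℕ} (hF : ∀ y ∈ F, y.length = n) :
    Set.InjOn (fun x : List (Fin d) × List (Fin d) => x.1 ++ x.2) (F ×ˢ G : Finset _) := by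
  rintro ⟨y, w⟩ h1 ⟨y', w'⟩ h2 h
  simp at h1 h2 h
  have := List.append_inj h (by rw [hF _ h1.1, hF _ h2.1])
  simp [this]

theorem app_sum_le {F G S : Finset (List (Fin d))} {n : ℕ} (hF : ∀ y ∈ F, y.length = n)
    (hS : ∀ y ∈ F, ∀ w ∈ G, y ++ w ∈ S) (g : List (Fin d) → ℝ) (hg : ∀ w, 0 ≤ g w) :
    ∑ y ∈ F, ∑ w ∈ G, g (y ++ w) ≤ ∑ w ∈ S, g w := by
  rw [← Finset.sum_product' F G (fun y w => g (y ++ w))]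
  rw [← Finset.sum_image (f := g) (g := fun x : List (Fin d) × List (Fin d) => x.1 ++ x.2) (app_inj G hF)]
  refine Finset.sum_le_sum_of_subset_of_nonneg ?_ fun _ _ _ => hg _
  intro w hw
  obtain ⟨⟨y, w'⟩, h, rfl⟩ := Finset.mem_image.1 hw
  simp at h
  exact hS _ h.1 _ h.2

theorem transport {z : Option (Fin d)} {s : List (Fin d)} {m : ℕ} {F1 F2 G1 G2 : Finset (List (Fin d))}
    (hF : HasKer F2 F1) (hG : HasKer G2 G1) {n1 n2 : ℕ}
    (hn1 : ∀ y ∈ F1, y.length = n1) (hn2 : ∀ y ∈ F2, y.length = n2)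
    (hL1 : ∀ y ∈ F2, ∀ w ∈ G1, y ++ w ∈ L z s m) (hL2 : ∀ y ∈ F1, ∀ w ∈ G2, y ++ w ∈ L z s m)
    (hok : ∀ y ∈ F1, ∀ w ∈ G1, ok z s (y ++ w)) (f : List (Fin d) → ℝ)
    (hpos1 : (0:ℝ) < F2.card * G1.card) (hpos2 : (0:ℝ) < F1.card * G2.card) :
    (F2.card * G1.card) * ((∑ y ∈ F1, ∑ w ∈ G2, f (y ++ w)) / (F1.card * G2.card) -
      (∑ y ∈ F2, ∑ w ∈ G1, f (y ++ w)) / (F2.card * G1.card))^2 ≤ HopE z s m f := by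
  obtain ⟨TF, hTF⟩ := hF
  obtain ⟨TG, hTG⟩ := hG
  obtain ⟨KF, f1, f2, f3, f4⟩ := hTF.toK
  obtain ⟨KG, g1, g2, g3, g4⟩ := hTG.toK
  set A := ∑ y ∈ F2, ∑ w ∈ G1, f (y ++ w) with hA
  set B := ∑ y ∈ F1, ∑ w ∈ G2, f (y ++ w) with hB
  set N1 : ℝ := F2.card * G1.card with hN1
  set N2 : ℝ := F1.card * G2.card with hN2
  set H := HopE z s m f
  have eA : ∑ y ∈ F2, ∑ w ∈ G1, ∑ y' ∈ F1, ∑ w' ∈ G2, KF y y' * KG w' w * f (y ++ w) = N2 * A := by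
    rw [hA, Finset.mul_sum]
    refine Finset.sum_congr rfl fun y hy => ?_
    rw [Finset.mul_sum]
    refine Finset.sum_congr rfl fun w hw => ?_
    simp only [← Finset.sum_mul, ← Finset.mul_sum]
    rw [g4 w hw, f3 y hy]
  have eB : ∑ y ∈ F2, ∑ w ∈ G1, ∑ y' ∈ F1, ∑ w' ∈ G2, KF y y' * KG w' w * f (y' ++ w') = N1 * B := by
    have : ∀ y ∈ F2, ∑ w ∈ G1, ∑ y' ∈ F1, ∑ w' ∈ G2, KF y y' * KG w' w * f (y' ++ w') =
        ∑ y' ∈ F1, ∑ w' ∈ G2, KF y y' * (G1.card * f (y' ++ w')) := by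
      intro y _
      rw [Finset.sum_comm]
      refine Finset.sum_congr rfl fun y' _ => ?_
      rw [Finset.sum_comm]
      refine Finset.sum_congr rfl fun w' hw' => ?_
      rw [← Finset.sum_mul, ← Finset.mul_sum, g3 w' hw']; ring
    rw [Finset.sum_congr rfl this, Finset.sum_comm, hB, Finset.mul_sum]
    refine Finset.sum_congr rfl fun y' hy' => ?_
    rw [Finset.sum_comm, Finset.mul_sum]
    refine Finset.sum_congr rfl fun w' hw' => ?_
    rw [← Finset.sum_mul, f4 y' hy']; ring
  have e1 : ∑ y ∈ F2, ∑ w ∈ G1, ∑ y' ∈ F1, ∑ w' ∈ G2, KF y y' * KG w' w = N2 * N1 := by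
    have : ∀ y ∈ F2, ∀ w ∈ G1, ∑ y' ∈ F1, ∑ w' ∈ G2, KF y y' * KG w' w = N2 := by
      intro y hy w hw
      simp only [← Finset.mul_sum, g4 w hw, ← Finset.sum_mul, f3 y hy]; rw [hN2]
    rw [Finset.sum_congr rfl fun y hy => Finset.sum_congr rfl fun w hw => this y hy w hw]
    simp only [Finset.sum_const, nsmul_eq_mul]; rw [hN1]; ring
  have eS : ∑ y ∈ F2, ∑ w ∈ G1, ∑ y' ∈ F1, ∑ w' ∈ G2, KF y y' * KG w' w * (f (y ++ w) - f (y' ++ w'))^2 ≤ N2 * H := by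
    let h : List (Fin d) → List (Fin d) → ℝ := fun w1 w2 => if Hop z s w1 w2 then (f w1 - f w2)^2 else 0
    have hh : ∀ w1 w2, 0 ≤ h w1 w2 := fun _ _ => by simp only [h]; split_ifs <;> positivity
    have b1 : ∀ y ∈ F2, ∀ w ∈ G1, ∀ y' ∈ F1, ∀ w' ∈ G2,
        KF y y' * KG w' w * (f (y ++ w) - f (y' ++ w'))^2 ≤ N2 * h (y ++ w) (y' ++ w') := by
      intro y hy w hw y' hy' w' hw'
      by_cases i1 : Ins y' y
      · by_cases i2 : Ins w w'
        · have hop : Hop z s (y ++ w) (y' ++ w') :=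
            ⟨y' ++ w, hok y' hy' w hw, i1.append_right w, i2.append_left y'⟩
          simp only [h, if_pos hop]
          have k1 : KF y y' ≤ F1.card := by
            rw [← f3 y hy]; exact Finset.single_le_sum (f := fun u => KF y u) (fun u hu => f1 y hy u hu) hy'
          have k2 : KG w' w ≤ G2.card := by
            rw [← g4 w hw]; exact Finset.single_le_sum (f := fun u => KG u w) (fun u hu => g1 u hu w hw) hw'
          have := f1 y hy y' hy'
          have := g1 w' hw' w hw
          rw [hN2]; gcongr
        · rw [g2 w' hw' w hw i2]; have := hh (y ++ w) (y' ++ w'); simp; positivity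
      · rw [f2 y hy y' hy' i1]; have := hh (y ++ w) (y' ++ w'); simp; positivity
    calc _ ≤ ∑ y ∈ F2, ∑ w ∈ G1, ∑ y' ∈ F1, ∑ w' ∈ G2, N2 * h (y ++ w) (y' ++ w') :=
          Finset.sum_le_sum fun y hy => Finset.sum_le_sum fun w hw => Finset.sum_le_sum fun y' hy' =>
            Finset.sum_le_sum fun w' hw' => b1 y hy w hw y' hy' w' hw'
      _ = N2 * ∑ y ∈ F2, ∑ w ∈ G1, ∑ y' ∈ F1, ∑ w' ∈ G2, h (y ++ w) (y' ++ w') := by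
          simp only [Finset.mul_sum]
      _ ≤ N2 * ∑ y ∈ F2, ∑ w ∈ G1, ∑ w2 ∈ L z s m, h (y ++ w) w2 := by
          gcongr with y hy w hw
          exact app_sum_le hn1 hL2 _ (fun _ => hh _ _)
      _ ≤ N2 * H := by
          gcongr
          exact app_sum_le hn2 hL1 (fun w1 => ∑ w2 ∈ L z s m, h w1 w2) (fun _ => Finset.sum_nonneg fun _ _ => hh _ _)
  -- Cauchy-Schwarz via a quadratic
  have hquad : ∀ x : ℝ, 0 ≤ ∑ y ∈ F2, ∑ w ∈ G1, ∑ y' ∈ F1, ∑ w' ∈ G2,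
      KF y y' * KG w' w * ((f (y ++ w) - f (y' ++ w')) - x)^2 := by
    intro x
    refine Finset.sum_nonneg fun y hy => Finset.sum_nonneg fun w hw => Finset.sum_nonneg fun y' hy' =>
      Finset.sum_nonneg fun w' hw' => ?_
    have := f1 y hy y' hy'
    have := g1 w' hw' w hw
    positivity
  have hexp : ∀ x : ℝ, ∑ y ∈ F2, ∑ w ∈ G1, ∑ y' ∈ F1, ∑ w' ∈ G2,
      KF y y' * KG w' w * ((f (y ++ w) - f (y' ++ w')) - x)^2 =
      ∑ y ∈ F2, ∑ w ∈ G1, ∑ y' ∈ F1, ∑ w' ∈ G2, KF y y' * KG w' w * (f (y ++ w) - f (y' ++ w'))^2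
      - 2 * x * (N2 * A - N1 * B) + x^2 * (N2 * N1) := by
    intro x
    rw [← eA, ← eB, ← e1]
    simp only [Finset.mul_sum, ← Finset.sum_sub_distrib, ← Finset.sum_add_distrib]
    refine Finset.sum_congr rfl fun y hy => Finset.sum_congr rfl fun w hw => Finset.sum_congr rfl fun y' hy' =>
      Finset.sum_congr rfl fun w' hw' => ?_
    ring
  have hx := hquad (A / N1 - B / N2)
  rw [hexp] at hx
  have h3 : N2 * A - N1 * B = N2 * N1 * (A / N1 - B / N2) := by field_simp
  rw [h3] at hx
  have h4 : N2 * (N1 * (A / N1 - B / N2)^2) ≤ N2 * H := by nlinarith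
  have h5 := le_of_mul_le_mul_left h4 hpos2
  calc N1 * (B / N2 - A / N1)^2 = N1 * (A / N1 - B / N2)^2 := by ring
    _ ≤ H := h5

end PFtrans


section PFnum

theorem Wn_mono_beta {p β : ℝ} (hp : 0 < p) (hβ : p ≤ β) : ∀ m r, Wn p p m r ≤ Wn p β m r := by
  intro m
  induction m with
  | zero => intro r; cases r <;> simp [Wn]
  | succ m ih =>
    intro r
    cases r with
    | zero =>
      simp only [Wn]
      have := Wn_nonneg hp hp m 1
      have := ih 1
      have := hp.le.trans hβ
      gcongr
    | succ r =>
      simp only [Wn]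
      have := ih r
      have := ih (r+2)
      gcongr

theorem Wn_superadd {p β : ℝ} (hp : 0 < p) (hβ : p ≤ β) (k : ℕ) : ∀ j r,
    Wn p p (2*k) 0 * Wn p β j r ≤ Wn p β (j+2*k) r := by
  have hβ0 : 0 < β := lt_of_lt_of_le hp hβ
  intro j
  induction j with
  | zero =>
    intro r
    cases r with
    | zero => simpa [Wn] using Wn_mono_beta hp hβ (2*k) 0
    | succ r => simpa [Wn] using Wn_nonneg hp hβ0 (2*k) (r+1)
  | succ j ih =>
    intro r
    rw [show j+1+2*k = (j+2*k)+1 by ring]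
    cases r with
    | zero =>
      simp only [Wn]
      have := ih 1
      nlinarith
    | succ r =>
      simp only [Wn]
      have := ih r
      have := ih (r+2)
      nlinarith

theorem part_cmp {p β : ℝ} (hp : 0 < p) (hβ : p ≤ β) (r m i l : ℕ) (hl : l ≤ i) (M : ℝ) (hM : (i:ℝ)+1 ≤ M) :
    Wn p p (2*i) 0 * bn p β r m i ≤ 4 * M^4 * (Wn p p (2*l) 0 * bn p β r m l) := by
  have hβ0 : 0 < β := lt_of_lt_of_le hp hβ
  have hM0 : 0 ≤ M := by have := Nat.cast_nonneg (α := ℝ) i; linarith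
  have hl' : (l:ℝ) ≤ i := by exact_mod_cast hl
  have hli : ((i-l : ℕ):ℝ) ≤ i := by exact_mod_cast Nat.sub_le i l
  have hb : 0 ≤ bn p β r m i := by unfold bn; split_ifs; exacts [Wn_nonneg hp hβ0 _ _, le_rfl]
  have h1 : Wn p p (2*i) 0 ≤ 4 * M^4 * (Wn p p (2*l) 0 * Wn p p (2*(i-l)) 0) := by
    refine (Wn_le_four hp i).trans ?_
    have := Wn_submul hp l (i-l) M (by linarith) (by linarith)
    rwa [show l + (i-l) = i by omega] at this
  have h2 : Wn p p (2*(i-l)) 0 * bn p β r m i ≤ bn p β r m l := by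
    unfold bn
    split_ifs with h3 h4 h4
    · have := Wn_superadd hp hβ (i-l) (m-2*i) r
      rwa [show m-2*i+2*(i-l) = m-2*l by omega] at this
    · omega
    · rw [mul_zero]; exact Wn_nonneg hp hβ0 _ _
    · simp
  have ha := Wn_nonneg hp hp (2*l) 0
  calc Wn p p (2*i) 0 * bn p β r m i ≤ 4 * M^4 * (Wn p p (2*l) 0 * Wn p p (2*(i-l)) 0) * bn p β r m i := by gcongr
    _ = 4 * M^4 * (Wn p p (2*l) 0 * (Wn p p (2*(i-l)) 0 * bn p β r m i)) := by ring
    _ ≤ _ := by gcongr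

end PFnum

section PFclos
variable {d : ℕ}

theorem HasKer.image {P Q : Finset (List (Fin d))} (h : HasKer P Q) (g : List (Fin d) → List (Fin d))
    (hg : Function.Injective g) (hI : ∀ u w, Ins u w → Ins (g u) (g w)) : HasKer (P.image g) (Q.image g) := by
  obtain ⟨T, h1, h2, h3⟩ := h
  refine ⟨T.comp (pull g), ?_, ?_, ?_⟩
  · intro Φ hΦ
    rw [LinearMap.comp_apply, pull_apply]
    exact h1 _ fun w hw u hu hi => hΦ _ (Finset.mem_image_of_mem _ hw) _ (Finset.mem_image_of_mem _ hu) (hI _ _ hi)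
  · intro F
    rw [LinearMap.comp_apply, pull_apply, h2 (fun w => F (g w)), Finset.card_image_of_injective _ hg,
      Finset.sum_image fun _ _ _ _ h => hg h]
  · intro F
    rw [LinearMap.comp_apply, pull_apply, h3 (fun w => F (g w)), Finset.card_image_of_injective _ hg,
      Finset.sum_image fun _ _ _ _ h => hg h]

/-- all concatenations -/
noncomputable def appS (D Y : Finset (List (Fin d))) : Finset (List (Fin d)) :=
  (D ×ˢ Y).image (fun x => x.1 ++ x.2)

theorem mem_appS {D Y : Finset (List (Fin d))} {w : List (Fin d)} :
    w ∈ appS D Y ↔ ∃ u ∈ D, ∃ y ∈ Y, w = u ++ y := by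
  simp only [appS, Finset.mem_image, Finset.mem_product, Prod.exists]
  constructor
  · rintro ⟨a, b, ⟨h1, h2⟩, rfl⟩; exact ⟨a, h1, b, h2, rfl⟩
  · rintro ⟨a, h1, b, h2, rfl⟩; exact ⟨a, b, ⟨h1, h2⟩, rfl⟩

theorem sum_appS {D : Finset (List (Fin d))} (Y : Finset (List (Fin d))) {n : ℕ} (hD : ∀ y ∈ D, y.length = n)
    (F : List (Fin d) → ℝ) : ∑ w ∈ appS D Y, F w = ∑ u ∈ D, ∑ y ∈ Y, F (u ++ y) := by
  unfold appS
  rw [Finset.sum_image (app_inj Y hD), Finset.sum_product]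

theorem card_appS {D : Finset (List (Fin d))} (Y : Finset (List (Fin d))) {n : ℕ} (hD : ∀ y ∈ D, y.length = n) :
    (appS D Y).card = D.card * Y.card := by
  unfold appS
  rw [Finset.card_image_of_injOn (app_inj Y hD), Finset.card_product]

theorem HasKer.appS {P Q : Finset (List (Fin d))} (h : HasKer P Q) (Y : Finset (List (Fin d))) {n1 n2 : ℕ}
    (hP : ∀ y ∈ P, y.length = n1) (hQ : ∀ y ∈ Q, y.length = n2) : HasKer (_root_.appS P Y) (_root_.appS Q Y) := by
  obtain ⟨T, h1, h2, h3⟩ := h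
  refine ⟨(Y.card:ℝ) • ∑ y ∈ Y, T.comp (pull (fun w => w ++ y)), ?_, ?_, ?_⟩
  · intro Φ hΦ
    rw [LinearMap.smul_apply, LinearMap.sum_apply, smul_eq_mul]
    refine mul_nonneg (by positivity) (Finset.sum_nonneg fun y hy => ?_)
    rw [LinearMap.comp_apply, pull_apply]
    exact h1 _ fun w hw u hu hi => hΦ _ (mem_appS.2 ⟨w, hw, y, hy, rfl⟩) _ (mem_appS.2 ⟨u, hu, y, hy, rfl⟩)
      (hi.append_right y)
  · intro F
    rw [LinearMap.smul_apply, LinearMap.sum_apply, smul_eq_mul, sum_appS Y hP, card_appS Y hQ, Finset.sum_comm,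
      Finset.mul_sum, Finset.mul_sum]
    refine Finset.sum_congr rfl fun y _ => ?_
    rw [LinearMap.comp_apply, pull_apply, h2 (fun w => F (w ++ y))]; push_cast; ring
  · intro F
    rw [LinearMap.smul_apply, LinearMap.sum_apply, smul_eq_mul, sum_appS Y hQ, card_appS Y hP, Finset.sum_comm,
      Finset.mul_sum, Finset.mul_sum]
    refine Finset.sum_congr rfl fun y _ => ?_
    rw [LinearMap.comp_apply, pull_apply, h3 (fun w => F (w ++ y))]; push_cast; ring

/-- primitive excursions with first letter c and half-length k -/
noncomputable def DD (c : Fin d) : ℕ → Finset (List (Fin d))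
  | 0 => {[]}
  | k+1 => (L (some c) [] (2*k)).image (fun u => c :: (u ++ [c]))

theorem wrap_inj (c : Fin d) : Function.Injective (fun u : List (Fin d) => c :: (u ++ [c])) := by
  intro u v h; simpa using h

theorem DD_length (c : Fin d) (k : ℕ) : ∀ y ∈ DD c k, y.length = 2*k := by
  intro y hy
  cases k with
  | zero => simp [DD] at hy; simp [hy]
  | succ k =>
    obtain ⟨u, hu, rfl⟩ := Finset.mem_image.1 hy
    have := (mem_L.1 hu).1
    simp; omega

theorem DD_ok (z : Option (Fin d)) (c : Fin d) (hc : some c ≠ z) (k : ℕ) : ∀ y ∈ DD c k, ok z [] y := by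
  intro y hy
  cases k with
  | zero => simp [DD] at hy; simp [hy, ok_nil]
  | succ k =>
    obtain ⟨u, hu, rfl⟩ := Finset.mem_image.1 hy
    have := (mem_L.1 hu).2
    rw [ok_nil_cons]
    exact ⟨hc, (ok_parse z c [] _ []).2 ⟨u, [], rfl, this, by rw [ok_nil]⟩⟩

theorem DD_card (c : Fin d) (k : ℕ) : ((DD c (k+1)).card : ℝ) = Wn ((d:ℝ)-1) ((d:ℝ)-1) (2*k) 0 := by
  rw [DD, Finset.card_image_of_injective _ (wrap_inj c), card_L]; simp [bet]

theorem DD_ker (hd : 3 ≤ d) (c : Fin d) (k : ℕ) : HasKer (DD c (k+1)) (DD c k) := by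
  cases k with
  | succ k =>
    have := HasKer_L hd (2*k) (some c) []
    refine this.image _ (wrap_inj c) ?_
    intro u w h; exact (h.append_right _).cons c
  | zero =>
    have h0 : L (some c) [] (2*0) = {[]} := by
      ext w; simp [mem_L]; rintro rfl; simp [ok_nil]
    have h1 : DD c 1 = {[c, c]} := by simp [DD]; rw [show L (some c) [] 0 = {[]} from h0]; simp
    rw [zero_add, h1]
    refine ⟨evAt [c,c] [], ?_, ?_, ?_⟩
    · intro Φ h
      rw [evAt_apply]; exact h _ (by simp) _ (by simp [DD]) ⟨[], [], c, rfl, rfl⟩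
    · intro F; simp [evAt_apply, DD]
    · intro F; simp [evAt_apply, DD]

end PFclos


section PFcons
variable {d : ℕ}

theorem vr_prod_le {ι κ : Type*} (A : Finset ι) (B : Finset κ) (g : ι → κ → ℝ) :
    vr (A ×ˢ B) (fun x => g x.1 x.2) ≤ ∑ b ∈ B, vr A (fun a => g a b) + ∑ a ∈ A, vr B (g a) := by
  refine (vr_le _ _ (mu B (fun b => mu A (fun a => g a b)))).trans ?_
  rw [Finset.sum_product]
  exact efron_stein A B g

theorem AdjLt.app_right {w1 w2 : List (Fin d)} (h : AdjLt w1 w2) (q : List (Fin d)) : AdjLt (w1 ++ q) (w2 ++ q) := by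
  obtain ⟨a, t, t', b, h, rfl, rfl⟩ := h
  exact ⟨a, t, t', b ++ q, h, by simp, by simp⟩

theorem AdjLt.app_left {w1 w2 : List (Fin d)} (h : AdjLt w1 w2) (q : List (Fin d)) : AdjLt (q ++ w1) (q ++ w2) := by
  obtain ⟨a, t, t', b, h, rfl, rfl⟩ := h
  exact ⟨q ++ a, t, t', b, h, by simp, by simp⟩

theorem AdjLt.cons {w1 w2 : List (Fin d)} (h : AdjLt w1 w2) (c : Fin d) : AdjLt (c :: w1) (c :: w2) := by
  obtain ⟨a, t, t', b, h, rfl, rfl⟩ := h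
  exact ⟨c :: a, t, t', b, h, by simp, by simp⟩

theorem cross_le {ι κ : Type*} (A : Finset ι) (B : Finset κ) (H : ι → κ → ℝ) (hH : ∀ a b, 0 ≤ H a b)
    {y : ι} {w : κ} (hy : y ∈ A) (hw : w ∈ B) (h0 : H y w = 0) :
    ∑ a ∈ A, H a w + ∑ b ∈ B, H y b ≤ ∑ a ∈ A, ∑ b ∈ B, H a b := by
  rw [← Finset.add_sum_erase A (fun a => ∑ b ∈ B, H a b) hy, ← Finset.add_sum_erase A (fun a => H a w) hy, h0, zero_add, add_comm]
  gcongr with a ha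
  exact Finset.single_le_sum (f := fun b => H a b) (fun b _ => hH a b) hw

theorem En_parse (z : Option (Fin d)) (b : Fin d) (s : List (Fin d)) (m n : ℕ) (hn : m < 2*n) (f : List (Fin d) → ℝ) :
    ∑ i ∈ Finset.range n, (∑ w ∈ LB z s m i, En (L (some b) [] (2*i)) (fun y => f (y ++ b :: w)) +
      ∑ y ∈ L (some b) [] (2*i), En (LB z s m i) (fun w => f (y ++ b :: w))) ≤ En (L z (b :: s) (m+1)) f := by
  let h : List (Fin d) → List (Fin d) → ℝ := fun w1 w2 => if AdjLt w1 w2 then (f w1 - f w2)^2 else 0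
  have hh : ∀ w1 w2, 0 ≤ h w1 w2 := fun _ _ => by simp only [h]; split_ifs <;> positivity
  have hself : ∀ w, h w w = 0 := fun w => by simp [h]
  have e : En (L z (b :: s) (m+1)) f = ∑ i ∈ Finset.range n, ∑ y ∈ L (some b) [] (2*i), ∑ w ∈ LB z s m i,
      ∑ i' ∈ Finset.range n, ∑ y' ∈ L (some b) [] (2*i'), ∑ w' ∈ LB z s m i', h (y ++ b :: w) (y' ++ b :: w') := by
    unfold En
    rw [sum_parse z b s m n hn]
    refine Finset.sum_congr rfl fun i _ => Finset.sum_congr rfl fun y _ => Finset.sum_congr rfl fun w _ => ?_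
    rw [sum_parse z b s m n hn]
  rw [e]
  refine Finset.sum_le_sum fun i hi => ?_
  have l1 : ∀ w, En (L (some b) [] (2*i)) (fun y => f (y ++ b :: w)) ≤
      ∑ y ∈ L (some b) [] (2*i), ∑ y' ∈ L (some b) [] (2*i), h (y ++ b :: w) (y' ++ b :: w) := by
    intro w; unfold En
    refine Finset.sum_le_sum fun y _ => Finset.sum_le_sum fun y' _ => ?_
    by_cases ha : AdjLt y y'
    · simp only [h, if_pos ha, if_pos (ha.app_right (b :: w))]; exact le_rfl
    · rw [if_neg ha]; exact hh _ _
  have l2 : ∀ y, En (LB z s m i) (fun w => f (y ++ b :: w)) ≤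
      ∑ w ∈ LB z s m i, ∑ w' ∈ LB z s m i, h (y ++ b :: w) (y ++ b :: w') := by
    intro y; unfold En
    refine Finset.sum_le_sum fun w _ => Finset.sum_le_sum fun w' _ => ?_
    by_cases ha : AdjLt w w'
    · simp only [h, if_pos ha, if_pos ((ha.cons b).app_left y)]; exact le_rfl
    · rw [if_neg ha]; exact hh _ _
  calc _ ≤ ∑ w ∈ LB z s m i, ∑ y ∈ L (some b) [] (2*i), ∑ y' ∈ L (some b) [] (2*i), h (y ++ b :: w) (y' ++ b :: w)
        + ∑ y ∈ L (some b) [] (2*i), ∑ w ∈ LB z s m i, ∑ w' ∈ LB z s m i, h (y ++ b :: w) (y ++ b :: w') :=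
        add_le_add (Finset.sum_le_sum fun w _ => l1 w) (Finset.sum_le_sum fun y _ => l2 y)
    _ = ∑ y ∈ L (some b) [] (2*i), ∑ w ∈ LB z s m i, (∑ y' ∈ L (some b) [] (2*i), h (y ++ b :: w) (y' ++ b :: w) +
          ∑ w' ∈ LB z s m i, h (y ++ b :: w) (y ++ b :: w')) := by
        rw [Finset.sum_comm, ← Finset.sum_add_distrib]
        refine Finset.sum_congr rfl fun y _ => ?_
        rw [← Finset.sum_add_distrib]
    _ ≤ _ := by
        refine Finset.sum_le_sum fun y hy => Finset.sum_le_sum fun w hw => ?_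
        refine le_trans (cross_le (L (some b) [] (2*i)) (LB z s m i) (fun y' w' => h (y ++ b :: w) (y' ++ b :: w'))
          (fun _ _ => hh _ _) hy hw (hself _)) ?_
        exact Finset.single_le_sum (f := fun i' => ∑ y' ∈ L (some b) [] (2*i'), ∑ w' ∈ LB z s m i', h (y ++ b :: w) (y' ++ b :: w'))
          (fun i' _ => Finset.sum_nonneg fun _ _ => Finset.sum_nonneg fun _ _ => hh _ _) hi

theorem cons_step (hd : 3 ≤ d) (M X : ℝ) (hX : 0 ≤ X) (z : Option (Fin d)) (b : Fin d) (s : List (Fin d)) (m : ℕ)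
    (hM : (m:ℝ) + 2 ≤ M)
    (IHA : ∀ i, 2*i ≤ m → ∀ f, vr (L (some b) [] (2*i)) f ≤ X * En (L (some b) [] (2*i)) f)
    (IHB : ∀ i, 2*i ≤ m → ∀ f, vr (L z s (m-2*i)) f ≤ X * En (L z s (m-2*i)) f) (f : List (Fin d) → ℝ) :
    vr (L z (b :: s) (m+1)) f ≤ X * En (L z (b :: s) (m+1)) f + M^3 * (4*M^4) * HopE z (b :: s) (m+1) f := by
  have hd' : (3:ℝ) ≤ d := by exact_mod_cast hd
  have hp : (0:ℝ) < (d:ℝ) - 1 := by linarith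
  have hβ : (d:ℝ) - 1 ≤ bet d z := by rcases bet_cases hd z with h | h <;> rw [h] <;> linarith
  have hm0 : (0:ℝ) ≤ m := Nat.cast_nonneg m
  have hH := HopE_nonneg z (b :: s) (m+1) f
  set H := HopE z (b :: s) (m+1) f
  set A : ℕ → Finset (List (Fin d)) := fun i => L (some b) [] (2*i) with hA
  set B : ℕ → Finset (List (Fin d)) := fun i => LB z s m i with hB
  set G : List (Fin d) × List (Fin d) → ℝ := fun x => f (x.1 ++ b :: x.2) with hG
  set μ : ℕ → ℝ := fun i => mu (A i ×ˢ B i) G with hμ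
  have hca : ∀ i, ((A i).card : ℝ) = Wn ((d:ℝ)-1) ((d:ℝ)-1) (2*i) 0 := by
    intro i; simp only [hA]; rw [card_L]; simp [bet]
  have hcb : ∀ i, ((B i).card : ℝ) = bn ((d:ℝ)-1) (bet d z) s.length m i := card_LB z s m
  have ha0 : ∀ i, (0:ℝ) < (A i).card := fun i => by rw [hca]; exact Wn_pos hp hp _ _ i (by simp)
  have hcmp : ∀ i l, l ≤ i → i ≤ m → ((A i).card * (B i).card : ℝ) ≤ 4*M^4 * ((A l).card * (B l).card) := by
    intro i l hl hi
    rw [hca, hcb, hca, hcb]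
    have : (i:ℝ) ≤ m := by exact_mod_cast hi
    exact part_cmp hp hβ _ m i l hl M (by linarith)
  have hmem : ∀ i y w', y ∈ A i → w' ∈ B i → y ++ b :: w' ∈ L z (b :: s) (m+1) := by
    intro i y w' hy hw
    simp only [hA, hB] at hy hw
    rw [mem_L] at hy ⊢; rw [mem_LB] at hw
    refine ⟨by simp; omega, ?_⟩
    have := (ok_parse z b s (y ++ b :: w') []).2 ⟨y, w', rfl, hy.2, hw.2⟩
    simpa using this
  refine (vr_le _ _ (μ 0)).trans ?_
  rw [sum_parse z b s m (m+1) (by omega)]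
  have e1 : ∀ i, ∑ y ∈ L (some b) [] (2*i), ∑ w' ∈ LB z s m i, (f (y ++ b :: w') - μ 0)^2 =
      vr (A i ×ˢ B i) G + ((A i).card * (B i).card : ℝ) * (μ i - μ 0)^2 := by
    intro i
    have := vr_decomp (A i ×ˢ B i) G (μ 0)
    rw [Finset.sum_product, Finset.card_product] at this
    push_cast at this
    exact this
  simp only [e1]
  rw [Finset.sum_add_distrib]
  refine add_le_add ?_ ?_
  · refine le_trans ?_ (mul_le_mul_of_nonneg_left (En_parse z b s m (m+1) (by omega) f) hX)
    rw [Finset.mul_sum]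
    refine Finset.sum_le_sum fun i _ => ?_
    refine (vr_prod_le (A i) (B i) (fun y w => f (y ++ b :: w))).trans ?_
    rw [mul_add, Finset.mul_sum, Finset.mul_sum]
    by_cases hi : 2*i ≤ m
    · refine add_le_add (Finset.sum_le_sum fun w _ => IHA i hi _) (Finset.sum_le_sum fun y _ => ?_)
      have := IHB i hi (fun w => f (y ++ b :: w))
      simp only [hB, LB, if_pos hi]; exact this
    · simp [hB, LB, if_neg hi, vr, En]
  · have key : ∀ i ∈ Finset.range (m+1), ((A i).card * (B i).card : ℝ) * (μ i - μ 0)^2 ≤ M^2 * (4*M^4*H) := by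
      intro i hi
      rw [Finset.mem_range] at hi
      have hiM : (i:ℝ) ≤ M := by
        have : (i:ℝ) ≤ m := by exact_mod_cast Nat.lt_succ_iff.1 hi
        linarith
      by_cases hne : (B i).card = 0
      · rw [hne]; simp; positivity
      have hbi : (0:ℝ) < (B i).card := by exact_mod_cast Nat.pos_of_ne_zero hne
      have h2im : 2*i ≤ m := by
        by_contra hcon
        apply hne; simp [hB, LB, if_neg hcon]
      refine (chain_sq _ (4*M^4*H) (by positivity) μ i ?_).trans (by gcongr)
      intro l hl
      have hpl : ∀ l ≤ i, (0:ℝ) < (A l).card * (B l).card := by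
        intro l hl
        have := hcmp i l hl (by omega)
        have h2 : (0:ℝ) < (A i).card * (B i).card := mul_pos (ha0 i) hbi
        by_contra hcon
        push Not at hcon
        have : 4*M^4 * ((A l).card * (B l).card : ℝ) ≤ 0 := mul_nonpos_of_nonneg_of_nonpos (by positivity) hcon
        linarith
      have kA : HasKer (A (l+1)) (A l) := HasKer_L hd (2*l) (some b) []
      have kB : HasKer ((B l).image (List.cons b)) ((B (l+1)).image (List.cons b)) := by
        refine HasKer.image ?_ _ (List.cons_injective) fun u w h => h.cons b
        have := HasKer_L hd (m-2*(l+1)) z s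
        simp only [hB, LB]
        rw [if_pos (by omega), if_pos (by omega), show m - 2*l = m-2*(l+1)+2 by omega]
        exact this
      have hin : ∀ S : Finset (List (Fin d)), (S.image (List.cons b)).card = S.card :=
        fun S => Finset.card_image_of_injective _ (List.cons_injective)
      have htr := transport (z := z) (s := b :: s) (m := m+1) kA kB (n1 := 2*l) (n2 := 2*(l+1))
        (fun y hy => (mem_L.1 hy).1) (fun y hy => (mem_L.1 hy).1)
        (by
          intro y hy w hw
          obtain ⟨w', hw', rfl⟩ := Finset.mem_image.1 hw
          exact hmem (l+1) y w' hy hw')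
        (by
          intro y hy w hw
          obtain ⟨w', hw', rfl⟩ := Finset.mem_image.1 hw
          exact hmem l y w' hy hw')
        (by
          intro y hy w hw
          obtain ⟨w', hw', rfl⟩ := Finset.mem_image.1 hw
          have hy := (mem_L.1 hy).2
          simp only [hB] at hw'
          have hw' := (mem_LB.1 hw').2
          have := (ok_parse z b s (y ++ b :: w') []).2 ⟨y, w', rfl, hy, hw'⟩
          simpa using this)
        f (by rw [hin]; exact hpl (l+1) (by omega)) (by rw [hin]; exact hpl l (by omega))
      rw [hin, hin] at htr
      have hs : ∀ S : Finset (List (Fin d)), ∀ y, ∑ w ∈ S.image (List.cons b), f (y ++ w) = ∑ w ∈ S, f (y ++ b :: w) :=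
        fun S y => Finset.sum_image fun _ _ _ _ h => List.cons_injective h
      simp only [hs] at htr
      have hmu : ∀ l, (∑ y ∈ A l, ∑ w ∈ B l, f (y ++ b :: w)) / ((A l).card * (B l).card : ℝ) = μ l := by
        intro l
        simp only [hμ, mu]
        rw [Finset.sum_product, Finset.card_product]; push_cast; rfl
      rw [hmu, hmu] at htr
      calc ((A i).card * (B i).card : ℝ) * (μ (l+1) - μ l)^2
          ≤ (4*M^4 * ((A (l+1)).card * (B (l+1)).card)) * (μ (l+1) - μ l)^2 := by
            exact mul_le_mul_of_nonneg_right (hcmp i (l+1) (by omega) (by omega)) (sq_nonneg _)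
        _ = 4*M^4 * (((A (l+1)).card * (B (l+1)).card) * (μ l - μ (l+1))^2) := by ring
        _ ≤ 4*M^4 * H := by gcongr
    refine (Finset.sum_le_sum key).trans ?_
    rw [Finset.sum_const, Finset.card_range, nsmul_eq_mul]
    have : ((m+1:ℕ):ℝ) ≤ M := by push_cast; linarith
    calc ((m+1:ℕ):ℝ) * (M^2 * (4*M^4*H)) ≤ M * (M^2 * (4*M^4*H)) := by gcongr
      _ = _ := by ring

end PFcons


section PFnil
variable {d : ℕ}

theorem DD_card_pos (hd : 3 ≤ d) (c : Fin d) (k : ℕ) : (0:ℝ) < (DD c k).card := by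
  have hd' : (3:ℝ) ≤ d := by exact_mod_cast hd
  have hp : (0:ℝ) < (d:ℝ) - 1 := by linarith
  cases k with
  | zero => simp [DD]
  | succ k => rw [DD_card]; exact Wn_pos hp hp _ _ k (by simp)

theorem DD_cmp (hd : 3 ≤ d) (c c0 : Fin d) (l k : ℕ) (hk : k ≤ l) (M : ℝ) (hM : (l:ℝ) + 2 ≤ M) :
    ((DD c (l+1)).card : ℝ) ≤ 16 * d * M^4 * ((DD c (l+1-k)).card * (DD c0 k).card) := by
  have hd' : (3:ℝ) ≤ d := by exact_mod_cast hd
  have hp : (0:ℝ) < (d:ℝ) - 1 := by linarith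
  have hl0 : (0:ℝ) ≤ l := Nat.cast_nonneg l
  have hM1 : (1:ℝ) ≤ M^4 := one_le_pow₀ (by linarith)
  cases k with
  | zero =>
    have := DD_card_pos hd c (l+1)
    simp only [DD, Finset.card_singleton, Nat.cast_one, mul_one, Nat.sub_zero] at this ⊢
    have h1 : (1:ℝ) ≤ 16 * d * M^4 := by nlinarith
    nlinarith
  | succ j =>
    rw [show l + 1 - (j+1) = (l-1-j)+1 by omega, DD_card, DD_card, DD_card]
    refine (Wn_le_four hp l).trans ?_
    have e : l = (l-1-j) + j + 1 := by omega
    have hj : (j:ℝ) ≤ l := by exact_mod_cast (by omega : j ≤ l)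
    have hj2 : ((l-1-j : ℕ):ℝ) ≤ l := by exact_mod_cast (by omega : l-1-j ≤ l)
    have := Wn_submul hp (l-1-j) j M (by linarith) (by linarith)
    set W := Wn ((d:ℝ)-1) ((d:ℝ)-1) (2*(l-1-j)) 0 * Wn ((d:ℝ)-1) ((d:ℝ)-1) (2*j) 0 with hW
    have hW0 : 0 ≤ W := mul_nonneg (Wn_nonneg hp hp _ _) (Wn_nonneg hp hp _ _)
    calc (4*((d:ℝ)-1))^l = (4*((d:ℝ)-1))^((l-1-j)+j) * (4*((d:ℝ)-1)) := by rw [← pow_succ, ← e]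
      _ ≤ (4*M^4*W) * (4*(d:ℝ)) := by gcongr; linarith
      _ = _ := by ring

/-- mean of f over a product family -/
noncomputable def pm (F G : Finset (List (Fin d))) (f : List (Fin d) → ℝ) : ℝ :=
  (∑ y ∈ F, ∑ w ∈ G, f (y ++ w)) / (F.card * G.card)

theorem sector_part (hd : 3 ≤ d) (z : Option (Fin d)) (c c0 : Fin d) (hc : some c ≠ z) (hc0 : some c0 ≠ z)
    (m l : ℕ) (M : ℝ) (hM : (l:ℝ) + 2 ≤ M) (f : List (Fin d) → ℝ) :
    ((DD c (l+1)).card * (LB z [] m l).card : ℝ) *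
      (pm (DD c0 (l+1)) (LB z [] m l) f - pm (DD c (l+1)) (LB z [] m l) f)^2 ≤
      M^2 * (16 * d * M^4 * HopE z [] (m+2) f) := by
  have hl0 : (0:ℝ) ≤ l := Nat.cast_nonneg l
  have hH := HopE_nonneg z [] (m+2) f
  set H := HopE z [] (m+2) f
  set Y := LB z [] m l with hY
  have hM0 : 0 ≤ M := by linarith
  by_cases hne : Y.card = 0
  · rw [hne]; simp; positivity
  have hYp : (0:ℝ) < Y.card := by exact_mod_cast Nat.pos_of_ne_zero hne
  set a : ℕ → ℝ := fun k => pm (DD c (l+1-k)) (appS (DD c0 k) Y) f with ha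
  have a0 : a 0 = pm (DD c (l+1)) Y f := by
    have : appS (DD c0 0) Y = Y := by
      ext w; simp [mem_appS, DD]
    simp only [ha, this, Nat.sub_zero]
  have a1 : a (l+1) = pm (DD c0 (l+1)) Y f := by
    simp only [ha, Nat.sub_self, pm, DD, Finset.sum_singleton, Finset.card_singleton, List.nil_append]
    have e1 := sum_appS Y (DD_length c0 (l+1)) f
    have e2 := card_appS Y (DD_length c0 (l+1))
    simp only [DD] at e1 e2
    rw [e1, e2]; push_cast; rw [one_mul]
  rw [← a0, ← a1]
  refine (chain_sq _ (16*d*M^4*H) (by positivity) a (l+1) ?_).trans ?_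
  · intro k hk
    have hcG : ∀ k, ((appS (DD c0 k) Y).card : ℝ) = (DD c0 k).card * Y.card := by
      intro k; rw [card_appS Y (DD_length c0 k)]; push_cast; rfl
    have hsub : l + 1 - k = (l + 1 - (k+1)) + 1 := by omega
    have hokk : ∀ i j, ∀ y ∈ DD c i, ∀ w ∈ appS (DD c0 j) Y, ok z [] (y ++ w) := by
      intro i j y hy w hw
      obtain ⟨u, hu, y', hy', rfl⟩ := mem_appS.1 hw
      exact ok_append z _ _ (ok_append z _ _ (mem_LB.1 hy').2 _ (DD_ok z c0 hc0 _ u hu)) _ (DD_ok z c hc _ y hy)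
    have hmem : ∀ i j, i + j = l + 1 → ∀ y ∈ DD c i, ∀ w ∈ appS (DD c0 j) Y, y ++ w ∈ L z [] (m+2) := by
      intro i j hij y hy w hw
      rw [mem_L]
      refine ⟨?_, hokk i j y hy w hw⟩
      obtain ⟨u, hu, y', hy', rfl⟩ := mem_appS.1 hw
      have h1 := DD_length c i y hy
      have h2 := DD_length c0 j u hu
      have h3 := (mem_LB.1 hy').1
      simp; omega
    have kF : HasKer (DD c (l+1-k)) (DD c (l+1-(k+1))) := by
      rw [hsub]; exact DD_ker hd c _
    have kG : HasKer (appS (DD c0 (k+1)) Y) (appS (DD c0 k) Y) :=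
      (DD_ker hd c0 k).appS Y (DD_length c0 _) (DD_length c0 _)
    have htr := transport (z := z) (s := []) (m := m+2) kF kG (DD_length c _) (DD_length c _)
      (hmem _ _ (by omega)) (hmem _ _ (by omega)) (hokk _ _) f
      (by rw [hcG]; exact mul_pos (DD_card_pos hd c _) (mul_pos (DD_card_pos hd c0 _) hYp))
      (by rw [hcG]; exact mul_pos (DD_card_pos hd c _) (mul_pos (DD_card_pos hd c0 _) hYp))
    change _ * (a (k+1) - a k)^2 ≤ H at htr
    rw [hcG] at htr
    calc ((DD c (l+1)).card * Y.card : ℝ) * (a (k+1) - a k)^2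
        ≤ (16 * d * M^4 * ((DD c (l+1-k)).card * (DD c0 k).card) * Y.card) * (a (k+1) - a k)^2 :=
          mul_le_mul_of_nonneg_right (mul_le_mul_of_nonneg_right (DD_cmp hd c c0 l k (by omega) M hM) hYp.le) (sq_nonneg _)
      _ = 16 * d * M^4 * (((DD c (l+1-k)).card * ((DD c0 k).card * Y.card)) * (a (k+1) - a k)^2) := by ring
      _ ≤ 16 * d * M^4 * H := by gcongr
  · have : ((l+1:ℕ):ℝ) ≤ M := by push_cast; linarith
    gcongr

theorem sum_parse_DD (z : Option (Fin d)) (c : Fin d) (m n : ℕ) (hn : m < 2*n) (F : List (Fin d) → ℝ) :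
    ∑ w ∈ L z [c] (m+1), F (c :: w) = ∑ l ∈ Finset.range n, ∑ y ∈ DD c (l+1), ∑ w ∈ LB z [] m l, F (y ++ w) := by
  rw [sum_parse z c [] m n hn]
  refine Finset.sum_congr rfl fun l _ => ?_
  rw [DD, Finset.sum_image fun _ _ _ _ h => wrap_inj c h]
  refine Finset.sum_congr rfl fun y _ => Finset.sum_congr rfl fun w _ => ?_
  simp

theorem sector_diff (hd : 3 ≤ d) (z : Option (Fin d)) (c c0 : Fin d) (hc : some c ≠ z) (hc0 : some c0 ≠ z)
    (m : ℕ) (M : ℝ) (hM : (m:ℝ) + 2 ≤ M) (f : List (Fin d) → ℝ) :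
    ((L z [c] m).card : ℝ) * (mu (L z [c] m) (fun w => f (c :: w)) - mu (L z [c0] m) (fun w => f (c0 :: w)))^2 ≤
      M^3 * (16 * d * M^4) * HopE z [] (m+1) f := by
  have hH := HopE_nonneg z [] (m+1) f
  have hm0 : (0:ℝ) ≤ m := Nat.cast_nonneg m
  have hM0 : 0 ≤ M := by linarith
  cases m with
  | zero =>
    have : L z [c] 0 = ∅ := by
      ext w; simp [mem_L]; rintro rfl; simp [ok_nil]
    rw [this]; simp; positivity
  | succ m =>
    push_cast at hM hm0
    set H := HopE z [] (m+1+1) f with hHdef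
    set N : ℕ → ℝ := fun l => (DD c (l+1)).card * (LB z [] m l).card with hN
    have hN0 : ∀ l, (DD c0 (l+1)).card * (LB z [] m l).card = N l := by
      intro l; simp only [hN]; rw [DD_card, DD_card]
    have hcc : ∀ c : Fin d, ((L z [c] (m+1)).card : ℝ) = ∑ l ∈ Finset.range (m+1), ((DD c (l+1)).card * (LB z [] m l).card : ℝ) := by
      intro c
      have := sum_parse_DD z c m (m+1) (by omega) (fun _ => 1)
      simpa using this
    set n : ℝ := ∑ l ∈ Finset.range (m+1), N l with hn
    have hNn : ∀ l, 0 ≤ N l := fun l => by simp only [hN]; positivity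
    have hn0 : 0 ≤ n := Finset.sum_nonneg fun l _ => hNn l
    have c1 : ((L z [c] (m+1)).card : ℝ) = n := hcc c
    have c2 : ((L z [c0] (m+1)).card : ℝ) = n := by rw [hcc c0]; simp only [hN0]; rfl
    have hpm : ∀ F G : Finset (List (Fin d)), (F.card * G.card : ℝ) * pm F G f = ∑ y ∈ F, ∑ w ∈ G, f (y ++ w) := by
      intro F G
      unfold pm
      by_cases h : (F.card * G.card : ℝ) = 0
      · rw [h, zero_mul]
        rcases mul_eq_zero.1 h with h | h
        · rw [Nat.cast_eq_zero, Finset.card_eq_zero] at h; simp [h]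
        · rw [Nat.cast_eq_zero, Finset.card_eq_zero] at h; simp [h]
      · exact mul_div_cancel₀ _ h
    set δ : ℕ → ℝ := fun l => pm (DD c0 (l+1)) (LB z [] m l) f - pm (DD c (l+1)) (LB z [] m l) f with hδ
    have s1 := card_mul_mu (L z [c] (m+1)) (fun w => f (c :: w))
    have s2 := card_mul_mu (L z [c0] (m+1)) (fun w => f (c0 :: w))
    rw [sum_parse_DD z _ m (m+1) (by omega)] at s1 s2
    rw [c1] at s1; rw [c2] at s2
    have s3 : n * (mu (L z [c0] (m+1)) (fun w => f (c0 :: w)) - mu (L z [c] (m+1)) (fun w => f (c :: w))) =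
        ∑ l ∈ Finset.range (m+1), N l * δ l := by
      rw [mul_sub, s1, s2, ← Finset.sum_sub_distrib]
      refine Finset.sum_congr rfl fun l _ => ?_
      rw [← hpm, ← hpm, hN0]; simp only [hN, hδ]; ring
    have cs : (∑ l ∈ Finset.range (m+1), N l * δ l)^2 ≤ n * ∑ l ∈ Finset.range (m+1), N l * (δ l)^2 :=
      Finset.sum_sq_le_sum_mul_sum_of_sq_le_mul _ (fun l _ => hNn l) (fun l _ => mul_nonneg (hNn l) (sq_nonneg _))
        (fun l _ => le_of_eq (by ring))
    have bd : ∑ l ∈ Finset.range (m+1), N l * (δ l)^2 ≤ M^3 * (16*d*M^4) * H := by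
      refine (Finset.sum_le_sum (g := fun _ => M^2 * (16 * d * M^4 * H)) fun l hl => ?_).trans ?_
      · rw [Finset.mem_range] at hl
        have : (l:ℝ) ≤ m := by exact_mod_cast Nat.lt_succ_iff.1 hl
        exact sector_part hd z c c0 hc hc0 m l M (by linarith) f
      · rw [Finset.sum_const, Finset.card_range, nsmul_eq_mul]
        have : ((m+1:ℕ):ℝ) ≤ M := by push_cast; linarith
        calc ((m+1:ℕ):ℝ) * (M^2 * (16 * d * M^4 * H)) ≤ M * (M^2 * (16 * d * M^4 * H)) := by gcongr
          _ = _ := by ring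
    rw [c1]
    rcases hn0.eq_or_lt with h | h
    · rw [← h, zero_mul]; positivity
    · rw [← s3, mul_pow, sq n, mul_assoc] at cs
      have := le_of_mul_le_mul_left cs h
      refine le_trans (le_of_eq ?_) (this.trans bd)
      ring

theorem nil_step (hd : 3 ≤ d) (M X : ℝ) (hX : 0 ≤ X) (z : Option (Fin d)) (m : ℕ)
    (hM : (m:ℝ) + 2 ≤ M)
    (IH : ∀ c, some c ≠ z → ∀ f, vr (L z [c] m) f ≤ X * En (L z [c] m) f) (f : List (Fin d) → ℝ) :
    vr (L z [] (m+1)) f ≤ X * En (L z [] (m+1)) f + d * (M^3 * (16*d*M^4)) * HopE z [] (m+1) f := by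
  have hH := HopE_nonneg z [] (m+1) f
  have hm0 : (0:ℝ) ≤ m := Nat.cast_nonneg m
  have hM0 : 0 ≤ M := by linarith
  obtain ⟨c0, hc0⟩ : ∃ c0 : Fin d, some c0 ≠ z := by
    by_cases h : some (⟨0, by omega⟩ : Fin d) = z
    · refine ⟨⟨1, by omega⟩, ?_⟩
      rw [← h]; simp
    · exact ⟨_, h⟩
  set μ : Fin d → ℝ := fun c => mu (L z [c] m) (fun w => f (c :: w)) with hμ
  refine (vr_le _ _ (μ c0)).trans ?_
  rw [sum_L_nil]
  have hE : ∑ c : Fin d, (if some c ≠ z then En (L z [c] m) (fun w => f (c :: w)) else 0) ≤ En (L z [] (m+1)) f := by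
    unfold En
    rw [sum_L_nil]
    refine Finset.sum_le_sum fun c _ => ?_
    split_ifs with hc
    · refine Finset.sum_le_sum fun w1 _ => ?_
      rw [sum_L_nil]
      refine le_trans ?_ (Finset.single_le_sum (f := fun c' => if some c' ≠ z then ∑ w ∈ L z [c'] m,
        (if AdjLt (c :: w1) (c' :: w) then (f (c :: w1) - f (c' :: w))^2 else 0) else 0) ?_ (Finset.mem_univ c))
      · simp only [if_pos hc]
        refine Finset.sum_le_sum fun w2 _ => ?_
        by_cases ha : AdjLt w1 w2
        · rw [if_pos ha, if_pos (ha.cons c)]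
        · rw [if_neg ha]; split_ifs <;> positivity
      · intro c' _
        split_ifs
        · exact Finset.sum_nonneg fun _ _ => by split_ifs <;> positivity
        · exact le_rfl
    · exact le_rfl
  calc _ ≤ ∑ c : Fin d, (X * (if some c ≠ z then En (L z [c] m) (fun w => f (c :: w)) else 0) +
        M^3 * (16 * d * M^4) * HopE z [] (m+1) f) := by
        refine Finset.sum_le_sum fun c _ => ?_
        split_ifs with hc
        · rw [vr_decomp]
          exact add_le_add (IH c hc _) (sector_diff hd z c c0 hc hc0 m M hM f)
        · rw [mul_zero, zero_add]; positivity
    _ = X * (∑ c : Fin d, (if some c ≠ z then En (L z [c] m) (fun w => f (c :: w)) else 0)) +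
        d * (M^3 * (16*d*M^4)) * HopE z [] (m+1) f := by
        rw [Finset.sum_add_distrib, Finset.mul_sum, Finset.sum_const, Finset.card_univ, Fintype.card_fin, nsmul_eq_mul]
        ring
    _ ≤ _ := by gcongr

theorem main_ind (hd : 3 ≤ d) (N : ℕ) (M : ℝ) (hM : (N:ℝ) + 2 ≤ M) : ∀ m, m ≤ N → ∀ z s, Good z s → ∀ f : List (Fin d) → ℝ,
    vr (L z s m) f ≤ m * (64*d^4*M^12) * En (L z s m) f := by
  have hN0 : (0:ℝ) ≤ N := Nat.cast_nonneg N
  have hM0 : 0 ≤ M := by linarith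
  have hd' : (3:ℝ) ≤ d := by exact_mod_cast hd
  set R : ℝ := 64*d^4*M^12 with hR
  have hR0 : 0 ≤ R := by positivity
  intro m
  induction m using Nat.strong_induction_on with
  | _ m ih =>
  intro hmN z s hs f
  cases m with
  | zero =>
    have hsub : ∀ w ∈ L z s 0, w = [] := fun w hw => List.length_eq_zero_iff.1 (mem_L.1 hw).1
    have h1 := vr_le (L z s 0) f (f [])
    have : ∑ i ∈ L z s 0, (f i - f [])^2 = 0 := Finset.sum_eq_zero fun w hw => by rw [hsub w hw]; simp
    rw [this] at h1
    simpa using h1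
  | succ m =>
    have hmN' : (m:ℝ) + 1 ≤ N := by exact_mod_cast hmN
    have hE := En_nonneg (L z s (m+1)) f
    have hHop := HopE_le hs (m+1) f
    have hHop2 : HopE z s (m+1) f ≤ 4 * M^5 * d^2 * En (L z s (m+1)) f := by
      refine hHop.trans ?_
      have : ((m+1:ℕ):ℝ) ≤ M := by push_cast; linarith
      gcongr
    have mono : ∀ k ≤ m, ∀ z s, Good z s → ∀ f : List (Fin d) → ℝ, vr (L z s k) f ≤ (m*R) * En (L z s k) f := by
      intro k hk z s hs f
      refine (ih k (by omega) (by omega) z s hs f).trans ?_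
      have := En_nonneg (L z s k) f
      have : (k:ℝ) ≤ m := by exact_mod_cast hk
      gcongr
    have fin : ∀ C : ℝ, 0 ≤ C → C ≤ d * (M^3 * (16*d*M^4)) → C * HopE z s (m+1) f ≤ R * En (L z s (m+1)) f := by
      intro C hC0 hC
      have hH0 := HopE_nonneg z s (m+1) f
      calc C * HopE z s (m+1) f ≤ (d * (M^3 * (16*d*M^4))) * (4 * M^5 * d^2 * En (L z s (m+1)) f) := by gcongr
        _ = _ := by rw [hR]; ring
    have hgoal : ((m+1:ℕ):ℝ) * R * En (L z s (m+1)) f = m*R*En (L z s (m+1)) f + R*En (L z s (m+1)) f := by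
      push_cast; ring
    rw [hgoal]
    cases s with
    | nil =>
      refine (nil_step hd M (m*R) (by positivity) z m (by linarith) ?_ f).trans ?_
      · intro c hc f
        refine mono m le_rfl z [c] ?_ f
        unfold Good
        cases z with
        | none => simp
        | some b => simp at hc ⊢; exact hc
      · have := fin _ (by positivity) le_rfl
        linarith
    | cons b s =>
      refine (cons_step hd M (m*R) (by positivity) z b s m (by linarith) ?_ ?_ f).trans ?_
      · intro i hi f
        exact mono _ hi _ _ (by simp [Good]) f
      · intro i hi f
        refine mono _ (by omega) _ _ ?_ f
        unfold Good at hs ⊢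
        exact hs.tail
      · have := fin (M^3*(4*M^4)) (by positivity) (by
          have h7 : 0 ≤ M^3 * M^4 := by positivity
          have : (9:ℝ) ≤ d * d := by nlinarith
          nlinarith)
        linarith

end PFnil


section PFlink
variable {d : ℕ}

theorem ok_none_iff (l : List (Fin d)) : ∀ s, ok none s l ↔ l.foldl redStep s = [] := by
  induction l with
  | nil => intro s; rw [ok_nil]; rfl
  | cons a l ih =>
    intro s
    cases s with
    | nil => rw [ok_nil_cons, List.foldl_cons, ih]; simp [redStep]
    | cons b s =>
      rw [List.foldl_cons]
      by_cases h : a = b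
      · subst h; rw [ok_cons_self, ih]; simp [redStep]
      · rw [ok_cons_ne none h, ih]; simp [redStep, h]

theorem redStep_chain (s : List (Fin d)) (hs : s.IsChain (· ≠ ·)) (a : Fin d) :
    (redStep s a).IsChain (· ≠ ·) ∧ redStep (redStep s a) a = s := by
  cases s with
  | nil => simp [redStep]
  | cons b s =>
    by_cases h : a = b
    · subst h
      refine ⟨by simpa [redStep] using hs.tail, ?_⟩
      cases s with
      | nil => simp [redStep]
      | cons c s =>
        have : a ≠ c := (List.isChain_cons_cons.1 hs).1
        simp [redStep, this]
    · refine ⟨?_, by simp [redStep, h]⟩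
      simp only [redStep, if_neg h]
      exact List.isChain_cons_cons.2 ⟨h, hs⟩

theorem foldl_rev (l : List (Fin d)) : ∀ s : List (Fin d), s.IsChain (· ≠ ·) →
    l.reverse.foldl redStep (l.foldl redStep s) = s := by
  induction l with
  | nil => intro s _; rfl
  | cons a l ih =>
    intro s hs
    rw [List.foldl_cons, List.reverse_cons, List.foldl_append, ih _ (redStep_chain s hs a).1]
    exact (redStep_chain s hs a).2

theorem irr_iff {N : ℕ} (w : Fin N → Fin d) (x : List (Fin d)) (hx : x.IsChain (· ≠ ·)) :
    irrOf w = x ↔ ok none x.reverse (List.ofFn w).reverse := by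
  have hx' : x.reverse.IsChain (· ≠ ·) := by
    rw [List.isChain_reverse]
    exact hx.imp fun a b h => h.symm
  rw [ok_none_iff]
  unfold irrOf
  constructor
  · intro h
    rw [← h, List.reverse_reverse]
    exact foldl_rev _ [] (by simp)
  · intro h
    have := foldl_rev (List.ofFn w).reverse x.reverse hx'
    rw [h, List.reverse_reverse] at this
    rw [this, List.reverse_reverse]

/-- the list attached to a word -/
def phi {N : ℕ} (w : Fin N → Fin d) : List (Fin d) := (List.ofFn w).reverse

theorem phi_inj {N : ℕ} : Function.Injective (phi : (Fin N → Fin d) → List (Fin d)) := by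
  intro w w' h
  exact List.ofFn_injective (List.reverse_injective h)

theorem phi_surj {N : ℕ} (l : List (Fin d)) (h : l.length = N) : ∃ w : Fin N → Fin d, phi w = l := by
  subst h
  refine ⟨fun i => l.reverse[(i:ℕ)]'(by simp), ?_⟩
  unfold phi
  rw [List.reverse_eq_iff]
  apply List.ext_getElem <;> simp

theorem L_eq {N : ℕ} (x : List (Fin d)) (hx : x.IsChain (· ≠ ·)) :
    L none x.reverse N = (Finset.univ.filter fun w : Fin N → Fin d => irrOf w = x).image phi := by
  ext l
  rw [mem_L, Finset.mem_image]
  constructor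
  · rintro ⟨h1, h2⟩
    obtain ⟨w, rfl⟩ := phi_surj l h1
    exact ⟨w, by simpa using (irr_iff w x hx).2 h2, rfl⟩
  · rintro ⟨w, hw, rfl⟩
    refine ⟨by simp [phi], (irr_iff w x hx).1 (by simpa using hw)⟩

theorem adj_phi {N : ℕ} {w1 w2 : Fin N → Fin d} (h : AdjLt (phi w1) (phi w2)) :
    ∃ i ∈ Finset.range (N-1), ∃ t t' : Fin d, t < t' ∧ hasPair w1 i t ∧ w2 = flipAt w1 i t' := by
  obtain ⟨a, t, t', b, hlt, h1, h2⟩ := h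
  have e1 : List.ofFn w1 = b.reverse ++ t :: t :: a.reverse := by
    have := congrArg List.reverse h1; simpa [phi] using this
  have e2 : List.ofFn w2 = b.reverse ++ t' :: t' :: a.reverse := by
    have := congrArg List.reverse h2; simpa [phi] using this
  have hlen := congrArg List.length e1
  simp at hlen
  have g1 : ∀ p : Fin N, some (w1 p) = (b.reverse ++ t :: t :: a.reverse)[(p:ℕ)]? := by
    intro p; rw [← e1]; simp
  have g2 : ∀ p : Fin N, some (w2 p) = (b.reverse ++ t' :: t' :: a.reverse)[(p:ℕ)]? := by
    intro p; rw [← e2]; simp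
  refine ⟨b.length, Finset.mem_range.2 (by omega), t, t', hlt, ?_, ?_⟩
  · intro p hp
    have := g1 p
    rcases hp with hp | hp <;> rw [hp] at this <;> simpa [List.getElem?_append] using this
  · funext p
    unfold flipAt
    split_ifs with hp
    · have := g2 p
      rcases hp with hp | hp <;> rw [hp] at this <;> simpa [List.getElem?_append] using this
    · push Not at hp
      have h1 := g1 p
      have h2 := g2 p
      rw [List.getElem?_append] at h1 h2
      have : some (w2 p) = some (w1 p) := by
        rw [h1, h2]
        split_ifs with hlt
        · rfl
        · simp only [List.length_reverse] at hlt ⊢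
          obtain ⟨q, hq⟩ : ∃ q, (p:ℕ) - b.length = q + 2 := ⟨(p:ℕ) - b.length - 2, by omega⟩
          rw [hq]; simp
      exact Option.some.inj this

theorem En_le_quad {N : ℕ} (x : List (Fin d)) (hx : x.IsChain (· ≠ ·)) (v : (Fin N → Fin d) → ℝ) :
    En (L none x.reverse N) (Function.extend phi v 0) ≤ quadForm d N v := by
  rw [L_eq x hx]
  unfold En
  rw [Finset.sum_image fun _ _ _ _ h => phi_inj h]
  set S := (Finset.univ.filter fun w : Fin N → Fin d => irrOf w = x)
  have e : ∀ w1 : Fin N → Fin d, ∑ l ∈ S.image phi, (if AdjLt (phi w1) l then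
      (Function.extend phi v 0 (phi w1) - Function.extend phi v 0 l)^2 else 0) =
      ∑ w2 ∈ S, if AdjLt (phi w1) (phi w2) then (v w1 - v w2)^2 else 0 := by
    intro w1
    rw [Finset.sum_image fun _ _ _ _ h => phi_inj h]
    simp only [phi_inj.extend_apply]
  simp only [e]
  let T : (Fin N → Fin d) → (Fin N → Fin d) → ℕ → Fin d → Fin d → ℝ := fun w1 w2 i t t' =>
    if t < t' then (if hasPair w1 i t then (if w2 = flipAt w1 i t' then (v w1 - v w2)^2 else 0) else 0) else 0
  have hT : ∀ w1 w2 i t t', 0 ≤ T w1 w2 i t t' := by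
    intro w1 w2 i t t'; simp only [T]; split_ifs <;> positivity
  have b1 : ∀ w1 w2, (if AdjLt (phi w1) (phi w2) then (v w1 - v w2)^2 else 0) ≤
      ∑ i ∈ Finset.range (N-1), ∑ t, ∑ t', T w1 w2 i t t' := by
    intro w1 w2
    split_ifs with h
    · obtain ⟨i, hi, t, t', hlt, hp, hf⟩ := adj_phi h
      have s0 : (v w1 - v w2)^2 = T w1 w2 i t t' := by simp only [T, if_pos hlt, if_pos hp, if_pos hf]
      have s1 := Finset.single_le_sum (f := fun t' => T w1 w2 i t t') (fun _ _ => hT _ _ _ _ _) (Finset.mem_univ t')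
      have s2 := Finset.single_le_sum (f := fun t => ∑ t', T w1 w2 i t t')
        (fun _ _ => Finset.sum_nonneg fun _ _ => hT _ _ _ _ _) (Finset.mem_univ t)
      have s3 := Finset.single_le_sum (f := fun i => ∑ t, ∑ t', T w1 w2 i t t')
        (fun _ _ => Finset.sum_nonneg fun _ _ => Finset.sum_nonneg fun _ _ => hT _ _ _ _ _) hi
      rw [s0]; exact s1.trans (s2.trans s3)
    · exact Finset.sum_nonneg fun _ _ => Finset.sum_nonneg fun _ _ => Finset.sum_nonneg fun _ _ => hT _ _ _ _ _
  have hB : ∀ w1 w2, 0 ≤ ∑ i ∈ Finset.range (N-1), ∑ t, ∑ t', T w1 w2 i t t' := fun w1 w2 =>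
    Finset.sum_nonneg fun _ _ => Finset.sum_nonneg fun _ _ => Finset.sum_nonneg fun _ _ => hT _ _ _ _ _
  calc _ ≤ ∑ w1 ∈ S, ∑ w2 ∈ S, ∑ i ∈ Finset.range (N-1), ∑ t, ∑ t', T w1 w2 i t t' :=
        Finset.sum_le_sum fun w1 _ => Finset.sum_le_sum fun w2 _ => b1 w1 w2
    _ ≤ ∑ w1 ∈ S, ∑ w2, ∑ i ∈ Finset.range (N-1), ∑ t, ∑ t', T w1 w2 i t t' :=
        Finset.sum_le_sum fun w1 _ => Finset.sum_le_sum_of_subset_of_nonneg (Finset.subset_univ _) fun _ _ _ => hB _ _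
    _ ≤ ∑ w1, ∑ w2, ∑ i ∈ Finset.range (N-1), ∑ t, ∑ t', T w1 w2 i t t' :=
        Finset.sum_le_sum_of_subset_of_nonneg (Finset.subset_univ _) fun _ _ _ => Finset.sum_nonneg fun _ _ => hB _ _
    _ = ∑ w1, ∑ i ∈ Finset.range (N-1), ∑ t, ∑ t', ∑ w2, T w1 w2 i t t' := by
        refine Finset.sum_congr rfl fun w1 _ => ?_
        rw [Finset.sum_comm]
        refine Finset.sum_congr rfl fun i _ => ?_
        rw [Finset.sum_comm]
        refine Finset.sum_congr rfl fun t _ => ?_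
        rw [Finset.sum_comm]
    _ = ∑ i ∈ Finset.range (N-1), ∑ t, ∑ t', ∑ w1, ∑ w2, T w1 w2 i t t' := by
        rw [Finset.sum_comm]
        refine Finset.sum_congr rfl fun i _ => ?_
        rw [Finset.sum_comm]
        refine Finset.sum_congr rfl fun t _ => ?_
        rw [Finset.sum_comm]
    _ = quadForm d N v := by
        unfold quadForm
        refine Finset.sum_congr rfl fun i _ => Finset.sum_congr rfl fun t _ => Finset.sum_congr rfl fun t' _ => ?_
        simp only [T]
        split_ifs with h
        · refine Finset.sum_congr rfl fun w1 _ => ?_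
          split_ifs with hp
          · rw [Finset.sum_ite_eq' Finset.univ (flipAt w1 i t') (fun w2 => (v w1 - v w2)^2)]; simp
          · simp
        · simp

theorem link (hd : 3 ≤ d) (N : ℕ) (x : List (Fin d)) (hx : x.IsChain (· ≠ ·)) (v : (Fin N → Fin d) → ℝ)
    (hv : ∀ w : Fin N → Fin d, irrOf w ≠ x → v w = 0)
    (hs : (∑ w : Fin N → Fin d, (if irrOf w = x then v w else 0)) = 0) :
    ∑ w : Fin N → Fin d, (v w)^2 ≤ N * (64*d^4*((N:ℝ)+2)^12) * quadForm d N v := by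
  have hG : Good (none : Option (Fin d)) x.reverse := by
    unfold Good
    simp only [Option.toList_none, List.append_nil]
    rw [List.isChain_reverse]
    exact hx.imp fun a b h => h.symm
  have h1 := main_ind hd N ((N:ℝ)+2) le_rfl N le_rfl none x.reverse hG (Function.extend phi v 0)
  have h2 := En_le_quad x hx v
  have hm : mu (L none x.reverse N) (Function.extend phi v 0) = 0 := by
    unfold mu
    rw [L_eq x hx, Finset.sum_image fun _ _ _ _ h => phi_inj h]
    simp only [phi_inj.extend_apply]
    rw [Finset.sum_filter, hs, zero_div]
  have h3 : vr (L none x.reverse N) (Function.extend phi v 0) = ∑ w : Fin N → Fin d, (v w)^2 := by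
    unfold vr
    rw [hm, L_eq x hx, Finset.sum_image fun _ _ _ _ h => phi_inj h]
    simp only [phi_inj.extend_apply, sub_zero]
    rw [Finset.sum_filter]
    refine Finset.sum_congr rfl fun w _ => ?_
    split_ifs with h
    · rfl
    · rw [hv w h]; simp
  rw [← h3]
  exact h1.trans (by gcongr)

end PFlink

/-- the pair-flip Hamiltonian restricted to any irreducible subspace
has an inverse-polynomial spectral gap. -/
theorem pf_gap_lower_irreducible :
    ∀ d : ℕ, 3 ≤ d → ∃ c γ : ℝ, 0 < c ∧ 0 < γ ∧
      ∀ N : ℕ, 2 ≤ N → ∀ x : List (Fin d), x ≠ [] → x.Chain' (· ≠ ·) →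
        x.length ≤ N → Even (N - x.length) →
        ∀ v : (Fin N → Fin d) → ℝ,
          (∀ w : Fin N → Fin d, irrOf w ≠ x → v w = 0) →
          (∑ w : Fin N → Fin d, (if irrOf w = x then v w else 0)) = 0 →
          quadForm d N v ≥
            c * (N : ℝ) ^ (-γ) * ∑ w : Fin N → Fin d, (v w) ^ 2 := by
  intro d hd
  have hd' : (3:ℝ) ≤ d := by exact_mod_cast hd
  refine ⟨1 / (64 * d^4 * 2^12), ((13:ℕ):ℝ), by positivity, by norm_num, ?_⟩
  intro N hN x _ hx _ _ v hv hs
  have h := link hd N x hx v hv hs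
  have hN' : (2:ℝ) ≤ N := by exact_mod_cast hN
  have hq : 0 ≤ quadForm d N v := (En_nonneg _ _).trans (En_le_quad x hx v)
  have h2 : ∑ w : Fin N → Fin d, (v w)^2 ≤ (64*d^4*2^12 * (N:ℝ)^13) * quadForm d N v := by
    refine h.trans ?_
    refine mul_le_mul_of_nonneg_right ?_ hq
    have : ((N:ℝ)+2)^12 ≤ (2*N)^12 := by gcongr; linarith
    calc (N:ℝ) * (64*d^4*((N:ℝ)+2)^12) ≤ N * (64*d^4*(2*(N:ℝ))^12) := by gcongr
      _ = _ := by ring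
  rw [Real.rpow_neg (by positivity), Real.rpow_natCast, ge_iff_le]
  have hpos : (0:ℝ) < 64*d^4*2^12 * (N:ℝ)^13 := by positivity
  rw [show 1 / (64 * (d:ℝ)^4 * 2^12) * ((N:ℝ)^13)⁻¹ = (64*d^4*2^12 * (N:ℝ)^13)⁻¹ by
    rw [mul_inv, one_div]]
  rw [inv_mul_le_iff₀ hpos]
  exact h2
end

section
/- For every integer d ≥ 3 there exists a constant C > 0 such that for every n ≥ 1 there is a nonzero function v : {1,…,d}^{2n} → ℝ that vanishes on every word that is not fully reducible, satisfies Σ_{w fully reducible} v(w) = 0, and has ⟨v, H v⟩ ≤ C · n^{−2} · Σ_w v(w)². That is, the spectral gap of the pair-flip Hamiltonian restricted to the fully reducible subspace is O(n^{−2}). -/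
open scoped Classical

namespace PF

/-- sign attached to the bottom letter -/
noncomputable def sg {d : ℕ} (x y : Fin d) (o : Option (Fin d)) : ℝ :=
  if o = some x then 1 else if o = some y then -1 else 0

/-- signed height of a stack -/
noncomputable def gg {d : ℕ} (x y : Fin d) (s : List (Fin d)) : ℝ :=
  (s.length : ℝ) * sg x y s.getLast?

/-- signed area -/
noncomputable def area {d : ℕ} (x y : Fin d) : List (Fin d) → List (Fin d) → ℝ
  | s, [] => gg x y s
  | s, a :: u => gg x y s + area x y (redStep s a) u

/-- the walk is nonempty until the very end, where it is empty -/
def good {d : ℕ} : List (Fin d) → List (Fin d) → Prop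
  | s, [] => s = []
  | s, a :: u => s ≠ [] ∧ good (redStep s a) u

lemma good_foldl {d : ℕ} : ∀ (u s : List (Fin d)), good s u → u.foldl redStep s = []
  | [], s, h => by simpa [good] using h
  | a :: u, s, h => by
    simp only [List.foldl_cons]
    exact good_foldl u _ h.2

noncomputable def wsum (d m : ℕ) (Φ : List (Fin d) → ℝ) : ℝ :=
  ∑ w : Fin m → Fin d, Φ (List.ofFn w)

lemma wsum_zero (d : ℕ) (Φ : List (Fin d) → ℝ) : wsum d 0 Φ = Φ [] := by
  simp [wsum]

lemma wsum_succ (d m : ℕ) (Φ : List (Fin d) → ℝ) :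
    wsum d (m + 1) Φ = ∑ a : Fin d, wsum d m (fun u => Φ (a :: u)) := by
  unfold wsum
  rw [← (Fin.consEquiv (fun _ : Fin (m+1) => Fin d)).sum_comp, Fintype.sum_prod_type]
  simp [Fin.consEquiv, List.ofFn_succ]

lemma redStep_sum {d : ℕ} (b : Fin d) (r : List (Fin d)) (Φ : List (Fin d) → ℝ) (c : ℝ)
    (hc : ∀ a, a ≠ b → Φ (a :: b :: r) = c) :
    ∑ a : Fin d, Φ (redStep (b :: r) a) = Φ r + ((d : ℝ) - 1) * c := by
  have hd : 1 ≤ d := Nat.succ_le_of_lt (Fin.pos b)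
  rw [← Finset.add_sum_erase _ _ (Finset.mem_univ b)]
  have h1 : ∀ a ∈ Finset.univ.erase b, Φ (redStep (b :: r) a) = c := by
    intro a ha
    have hab : a ≠ b := Finset.ne_of_mem_erase ha
    simp only [redStep, hab, if_false]
    exact hc a hab
  rw [Finset.sum_congr rfl h1]
  simp [redStep, Finset.card_erase_of_mem, hd]

lemma redStep_sum_le {d : ℕ} (b : Fin d) (r : List (Fin d)) (Φ : List (Fin d) → ℝ) (c : ℝ)
    (hc : ∀ a, a ≠ b → Φ (a :: b :: r) ≤ c) :
    ∑ a : Fin d, Φ (redStep (b :: r) a) ≤ Φ r + ((d : ℝ) - 1) * c := by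
  have hd : 1 ≤ d := Nat.succ_le_of_lt (Fin.pos b)
  rw [← Finset.add_sum_erase _ _ (Finset.mem_univ b)]
  have h1 : ∀ a ∈ Finset.univ.erase b, Φ (redStep (b :: r) a) ≤ c := by
    intro a ha
    have hab : a ≠ b := Finset.ne_of_mem_erase ha
    simp only [redStep, hab, if_false]
    exact hc a hab
  have := Finset.sum_le_sum h1
  simp [Finset.card_erase_of_mem, hd] at this
  have e : redStep (b :: r) b = r := by simp [redStep]
  rw [e] at this
  rw [Finset.add_sum_erase _ (fun a => Φ (redStep (b :: r) a)) (Finset.mem_univ b)]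
  linarith

/-! counting fully reducing continuations -/
noncomputable def NN (d m : ℕ) (s : List (Fin d)) : ℝ :=
  wsum d m (fun u => if u.foldl redStep s = [] then 1 else 0)

noncomputable def QQ (d m : ℕ) (s : List (Fin d)) : ℝ :=
  wsum d m (fun u => if good s u then 1 else 0)

noncomputable def GG {d : ℕ} (x y : Fin d) (m : ℕ) (s : List (Fin d)) : ℝ :=
  wsum d m (fun u => if good s u then area x y s u else 0)

lemma NN_succ (d m : ℕ) (s : List (Fin d)) :
    NN d (m+1) s = ∑ a, NN d m (redStep s a) := by
  unfold NN
  rw [wsum_succ]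
  rfl

lemma NN_zero (d : ℕ) (s : List (Fin d)) : NN d 0 s = if s = [] then 1 else 0 := by
  unfold NN
  rw [wsum_zero]
  by_cases h : s = [] <;> simp [h]

lemma QQ_zero (d : ℕ) (s : List (Fin d)) : QQ d 0 s = if s = [] then 1 else 0 := by
  unfold QQ
  rw [wsum_zero]
  by_cases h : s = [] <;> simp [h, good]

lemma QQ_succ (d m : ℕ) (s : List (Fin d)) (hs : s ≠ []) :
    QQ d (m+1) s = ∑ a, QQ d m (redStep s a) := by
  simp [QQ, wsum_succ, good, hs]

lemma QQ_succ_nil (d m : ℕ) : QQ d (m+1) [] = 0 := by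
  simp [QQ, wsum_succ, good]
  simp [wsum]

lemma GG_zero {d : ℕ} (x y : Fin d) (s : List (Fin d)) : GG x y 0 s = 0 := by
  unfold GG
  rw [wsum_zero]
  by_cases h : s = [] <;> simp [h, good, area, gg]

lemma GG_succ_nil {d : ℕ} (x y : Fin d) (m : ℕ) : GG x y (m+1) [] = 0 := by
  simp [GG, wsum_succ, good]
  simp [wsum]

lemma GG_succ {d : ℕ} (x y : Fin d) (m : ℕ) (s : List (Fin d)) (hs : s ≠ []) :
    GG x y (m+1) s = gg x y s * QQ d (m+1) s + ∑ a, GG x y m (redStep s a) := by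
  rw [QQ_succ _ _ _ hs, Finset.mul_sum, ← Finset.sum_add_distrib]
  unfold GG
  rw [wsum_succ]
  refine Finset.sum_congr rfl fun a _ => ?_
  unfold QQ wsum
  rw [Finset.mul_sum, ← Finset.sum_add_distrib]
  refine Finset.sum_congr rfl fun u _ => ?_
  by_cases h : good (redStep s a) (List.ofFn u) <;> simp [good, hs, h, area]

lemma NN_big (d : ℕ) : ∀ (m : ℕ) (s : List (Fin d)), m < s.length → NN d m s = 0 := by
  intro m
  induction m with
  | zero =>
    intro s hs
    rw [NN_zero, if_neg]
    rintro rfl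
    simp at hs
  | succ m ih =>
    intro s hs
    cases s with
    | nil => simp at hs
    | cons b r =>
      rw [NN_succ, redStep_sum b r _ 0, ih] <;> simp at hs ⊢
      · omega
      · intro a _
        apply ih
        simp
        omega

lemma QQ_big (d : ℕ) : ∀ (m : ℕ) (s : List (Fin d)), m < s.length → QQ d m s = 0 := by
  intro m
  induction m with
  | zero =>
    intro s hs
    rw [QQ_zero, if_neg]
    rintro rfl
    simp at hs
  | succ m ih =>
    intro s hs
    cases s with
    | nil => simp at hs
    | cons b r =>
      rw [QQ_succ _ _ _ (by simp), redStep_sum b r _ 0, ih] <;> simp at hs ⊢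
      · omega
      · intro a _
        apply ih
        simp
        omega

lemma GG_big {d : ℕ} (x y : Fin d) : ∀ (m : ℕ) (s : List (Fin d)), m < s.length → GG x y m s = 0 := by
  intro m
  induction m with
  | zero =>
    intro s hs
    rw [GG_zero]
  | succ m ih =>
    intro s hs
    cases s with
    | nil => simp at hs
    | cons b r =>
      rw [GG_succ _ _ _ _ (by simp), QQ_big _ _ _ hs, redStep_sum b r _ 0, ih] <;> simp at hs ⊢
      · omega
      · intro a _
        apply ih
        simp
        omega

/-! binomial relations -/
lemma ch1 (n a : ℕ) (h : a ≤ n) : ((n:ℝ)+1) * (n.choose a : ℝ) = ((n+1).choose a : ℝ) * ((n:ℝ) + 1 - a) := by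
  have := Nat.choose_mul_succ_eq n a
  have h2 : ((n + 1 - a : ℕ) : ℝ) = (n:ℝ) + 1 - a := by
    rw [Nat.cast_sub (by omega)]; push_cast; ring
  rw [← h2]
  have h3 := congrArg (Nat.cast : ℕ → ℝ) this
  push_cast at h3
  linarith

lemma ch2 (n a : ℕ) : ((n:ℝ)+1) * (n.choose a : ℝ) = ((n+1).choose (a+1) : ℝ) * ((a:ℝ) + 1) := by
  exact_mod_cast Nat.add_one_mul_choose_eq n a

lemma NN_bound (d : ℕ) (hd : 3 ≤ d) : ∀ (m a : ℕ) (s : List (Fin d)), m = 2 * a + s.length →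
    ((m:ℝ) + 3) * NN d m s ≤ ((s.length : ℝ) + 3) * ((d:ℝ) - 1) ^ a * ((m+3).choose a : ℝ) := by
  have hd' : (3:ℝ) ≤ d := by exact_mod_cast hd
  have hd1 : (0:ℝ) < (d:ℝ) - 1 := by linarith
  intro m
  induction m with
  | zero =>
    intro a s h
    have h1 : a = 0 := by omega
    have h2 : s = [] := List.length_eq_zero_iff.mp (by omega)
    subst h1 h2
    simp [NN_zero]
  | succ m ih =>
    intro a s h
    have hm3 : (0:ℝ) < (m:ℝ) + 3 := by positivity
    cases s with
    | nil =>
      obtain ⟨a, rfl⟩ : ∃ a', a = a' + 1 := ⟨a - 1, by simp at h; omega⟩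
      simp at h
      have hm : m = 2 * a + 1 := by omega
      have key : ∀ b : Fin d, NN d m [b] ≤ 4 * ((d:ℝ) - 1) ^ a * ((m+3).choose a : ℝ) / ((m:ℝ)+3) := by
        intro b
        rw [le_div_iff₀ hm3]
        have := ih a [b] (by simpa using hm)
        simp at this
        norm_num at this
        linarith
      rw [NN_succ]
      have h1 : ∑ b : Fin d, NN d m (redStep [] b) ≤ d * (4 * ((d:ℝ) - 1) ^ a * ((m+3).choose a : ℝ) / ((m:ℝ)+3)) := by
        have := Finset.sum_le_sum (fun b (_ : b ∈ (Finset.univ : Finset (Fin d))) => key b)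
        simpa [redStep] using this
      have h2 := ch2 (m+3) a
      set X : ℝ := ((m+3+1).choose (a+1) : ℝ) with hX
      set Y : ℝ := ((m+3).choose a : ℝ)
      have hX0 : 0 ≤ X := by positivity
      have hmr : (m:ℝ) = 2 * a + 1 := by exact_mod_cast hm
      have hY : Y = X * (a+1) / (m+4) := by
        rw [eq_div_iff (by positivity)]
        push_cast at h2
        linarith
      have hp : (0:ℝ) < ((d:ℝ)-1)^a := by positivity
      calc (((m+1:ℕ):ℝ) + 3) * ∑ b : Fin d, NN d m (redStep [] b)
          ≤ (((m+1:ℕ):ℝ) + 3) * (d * (4 * ((d:ℝ) - 1) ^ a * Y / ((m:ℝ)+3))) := by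
            apply mul_le_mul_of_nonneg_left h1; positivity
        _ = (d * ((d:ℝ) - 1) ^ a * X) * (2 * (a+1) / (a + 2)) := by
            rw [hY, hmr]; push_cast; rw [hmr]; field_simp; ring
        _ ≤ (d * ((d:ℝ) - 1) ^ a * X) * 2 := by
            apply mul_le_mul_of_nonneg_left _ (by positivity)
            rw [div_le_iff₀ (by positivity)]
            linarith
        _ ≤ _ := by
            simp only [List.length_nil, Nat.cast_zero, zero_add]
            rw [pow_succ]
            have : 0 ≤ ((d:ℝ)-1)^a * X := by positivity
            nlinarith
    | cons b r =>
      simp at h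
      have hm : m = 2 * a + r.length := by omega
      have hmr : (m:ℝ) = 2 * a + r.length := by exact_mod_cast hm
      have h0 := ih a r hm
      rw [NN_succ]
      have hc1 := ch1 (m+3) a (by omega)
      cases a with
      | zero =>
        have h1 : ∑ x : Fin d, NN d m (redStep (b :: r) x) ≤ NN d m r + ((d:ℝ)-1) * 0 := by
          apply redStep_sum_le
          intro x _
          rw [NN_big]
          simp; omega
        simp only [pow_zero, mul_one, Nat.choose_zero_right, Nat.cast_one, mul_zero, add_zero,
          Nat.cast_zero, zero_add, List.length_cons, Nat.cast_add] at h0 h1 hmr ⊢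
        have h6 : NN d m r ≤ 1 := by
          by_contra hh
          push Not at hh
          rw [← hmr] at h0
          nlinarith
        have h4 : ∑ x : Fin d, NN d m (redStep (b :: r) x) ≤ 1 := by linarith
        rw [← hmr]
        nlinarith
      | succ a =>
        have h1 : ∑ x : Fin d, NN d m (redStep (b :: r) x) ≤ NN d m r + ((d:ℝ)-1) *
            (((r.length:ℝ) + 2 + 3) * ((d:ℝ) - 1) ^ a * ((m+3).choose a : ℝ) / ((m:ℝ)+3)) := by
          apply redStep_sum_le
          intro x _
          rw [le_div_iff₀ hm3]
          have := ih a (x :: b :: r) (by simp; omega)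
          simp at this
          push_cast at this
          ring_nf at this ⊢
          linarith
        have hc2 := ch2 (m+3) a
        have e : ((m + 1 + 3).choose (a+1) : ℝ) = ((m+3+1).choose (a+1) : ℝ) := rfl
        rw [e]
        set X : ℝ := ((m+3+1).choose (a+1) : ℝ)
        set Y : ℝ := ((m+3).choose a : ℝ)
        set Z : ℝ := ((m+3).choose (a+1) : ℝ)
        have hY : Y = X * (a+1) / (m+4) := by
          rw [eq_div_iff (by positivity)]
          push_cast at hc2
          linarith
        have hZ : Z = X * (m+4-(a+1)) / (m+4) := by
          rw [eq_div_iff (by positivity)]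
          push_cast at hc1
          linarith
        have h5 : NN d m r ≤ ((r.length:ℝ) + 3) * ((d:ℝ)-1)^(a+1) * Z / (m+3) := by
          rw [le_div_iff₀ hm3]; linarith
        calc (((m+1:ℕ):ℝ) + 3) * ∑ x : Fin d, NN d m (redStep (b :: r) x)
          ≤ (((m+1:ℕ):ℝ) + 3) * (((r.length:ℝ) + 3) * ((d:ℝ)-1)^(a+1) * Z / (m+3) + ((d:ℝ)-1) *
            (((r.length:ℝ) + 2 + 3) * ((d:ℝ) - 1) ^ a * Y / ((m:ℝ)+3))) := by
              apply mul_le_mul_of_nonneg_left (h1.trans (by linarith)); positivity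
          _ = _ := by
              rw [hY, hZ, List.length_cons]; push_cast
              have hk : (r.length:ℝ) = m - 2 * (a+1) := by push_cast at hmr; linarith
              rw [hk]; field_simp; ring

lemma QQ_diag (d : ℕ) : ∀ (m : ℕ) (s : List (Fin d)), m = s.length → QQ d m s = 1 := by
  intro m
  induction m with
  | zero =>
    intro s h
    have h2 : s = [] := List.length_eq_zero_iff.mp (by omega)
    simp [QQ_zero, h2]
  | succ m ih =>
    intro s h
    cases s with
    | nil => simp at h
    | cons b r =>
      simp at h
      rw [QQ_succ _ _ _ (by simp), redStep_sum b r _ 0, ih _ h]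
      · simp
      · intro a _
        apply QQ_big
        simp; omega

lemma QQ_eq (d : ℕ) : ∀ (m a : ℕ) (s : List (Fin d)), m = 2 * a + s.length →
    (m:ℝ) * QQ d m s = (s.length : ℝ) * ((d:ℝ) - 1) ^ a * (m.choose a : ℝ) := by
  intro m
  induction m with
  | zero =>
    intro a s h
    have h2 : s = [] := List.length_eq_zero_iff.mp (by omega)
    subst h2
    simp
  | succ m ih =>
    intro a s h
    cases s with
    | nil => simp [QQ_succ_nil]
    | cons b r =>
      cases a with
      | zero =>
        rw [QQ_diag _ _ _ (by omega)]
        simp at h ⊢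
        exact_mod_cast h
      | succ a =>
        simp at h
        have hm : m = 2 * (a+1) + r.length := by omega
        have hmr : (m:ℝ) = 2 * (a + 1) + r.length := by exact_mod_cast hm
        have hm3 : (0:ℝ) < m := by rw [hmr]; positivity
        have h0 := ih (a+1) r hm
        have hc1 := ch1 m (a+1) (by omega)
        have hc2 := ch2 m a
        rw [QQ_succ _ _ _ (by simp), redStep_sum b r _
            (((r.length:ℝ) + 2) * ((d:ℝ) - 1) ^ a * (m.choose a : ℝ) / m)]
        · set X : ℝ := ((m+1).choose (a+1) : ℝ)
          set Y : ℝ := (m.choose a : ℝ)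
          set Z : ℝ := (m.choose (a+1) : ℝ)
          have hY : Y = X * (a+1) / (m+1) := by
            rw [eq_div_iff (by positivity)]
            linarith
          have hZ : Z = X * (m+1-(a+1)) / (m+1) := by
            rw [eq_div_iff (by positivity)]
            push_cast at hc1
            linarith
          have h5 : QQ d m r = ((r.length:ℝ)) * ((d:ℝ)-1)^(a+1) * Z / m := by
            rw [eq_div_iff hm3.ne']; linarith
          rw [h5, hY, hZ]; push_cast
          have hk : (r.length:ℝ) = m - 2 * (a+1) := by push_cast at hmr; linarith
          simp only [List.length_cons]; push_cast
          rw [hk]; field_simp; ring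
        · intro x _
          rw [eq_div_iff hm3.ne']
          have := ih a (x :: b :: r) (by simp; omega)
          simp at this
          ring_nf at this ⊢
          linarith

/-- partial row sums -/
noncomputable def TT (n a : ℕ) : ℝ := ∑ i ∈ Finset.range (a+1), (n.choose i : ℝ)

lemma TT_succ (n a : ℕ) : TT n (a+1) = TT n a + (n.choose (a+1) : ℝ) := by
  simp [TT, Finset.sum_range_succ]

lemma TT_pascal (n a : ℕ) : TT (n+1) (a+1) = TT n (a+1) + TT n a := by
  induction a with
  | zero => simp [TT, Finset.sum_range_succ]; ring
  | succ a ih =>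
    rw [TT_succ (n+1), ih, TT_succ n (a+1), TT_succ n a]
    rw [Nat.choose_succ_succ]
    push_cast
    ring

lemma gg_x {d : ℕ} (x y : Fin d) (s : List (Fin d)) (h : s.getLast? = some x) :
    gg x y s = s.length := by simp [gg, sg, h]

lemma GG_eq {d : ℕ} (x y : Fin d) : ∀ (m a : ℕ) (s : List (Fin d)), m = 2 * a + s.length →
    (s = [] ∨ s.getLast? = some x) →
    GG x y m s = ((d:ℝ) - 1) ^ a * ((s.length : ℝ) *
      (((s.length : ℝ) - 1) / 2 * (m.choose a : ℝ) + TT m a)) := by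
  intro m
  induction m with
  | zero =>
    intro a s h _
    have h2 : s = [] := List.length_eq_zero_iff.mp (by omega)
    subst h2
    simp [GG_zero]
  | succ m ih =>
    intro a s h hs
    cases s with
    | nil => simp [GG_succ_nil]
    | cons b r =>
      simp only [reduceCtorEq, false_or] at hs
      have hr : r = [] ∨ r.getLast? = some x := by
        cases r with
        | nil => simp
        | cons c r => right; simpa using hs
      have hq := QQ_eq d (m+1) a (b :: r) h
      simp at h
      have hm : m = 2 * a + r.length := by omega
      have h0 := ih a r hm hr
      have hmr : (m:ℝ) = 2 * a + r.length := by exact_mod_cast hm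
      cases a with
      | zero =>
        rw [GG_succ _ _ _ _ (by simp), gg_x _ _ _ hs, QQ_diag _ _ _ (by simp; omega),
          redStep_sum b r _ 0, h0]
        · simp [TT]; ring
        · intro z _
          apply GG_big
          simp; omega
      | succ a =>
        rw [GG_succ _ _ _ _ (by simp), gg_x _ _ _ hs, redStep_sum b r _
            (((d:ℝ) - 1) ^ a * (((r.length : ℝ) + 2) *
      ((((r.length : ℝ) + 2) - 1) / 2 * (m.choose a : ℝ) + TT m a))), h0]
        · have hc1 := ch1 m (a+1) (by omega)
          have hc2 := ch2 m a
          rw [TT_pascal, TT_succ]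
          set X : ℝ := ((m+1).choose (a+1) : ℝ)
          set Y : ℝ := (m.choose a : ℝ)
          set Z : ℝ := (m.choose (a+1) : ℝ)
          have hY : Y = X * (a+1) / (m+1) := by
            rw [eq_div_iff (by positivity)]
            linarith
          have hZ : Z = X * (m+1-(a+1)) / (m+1) := by
            rw [eq_div_iff (by positivity)]
            push_cast at hc1
            linarith
          have h5 : QQ d (m+1) (b :: r) = ((r.length:ℝ) + 1) * ((d:ℝ)-1)^(a+1) * X / (m+1) := by
            rw [eq_div_iff (by positivity)]; simp at hq; linarith
          rw [h5, hY, hZ]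
          have hk : (r.length:ℝ) = m - 2 * (a+1) := by push_cast at hmr; linarith
          simp only [List.length_cons]; push_cast
          rw [hk]; field_simp; ring
        · intro z _
          have := ih a (z :: b :: r) (by simp; omega) (by right; simpa using hs)
          rw [this]
          simp only [List.length_cons]; push_cast
          ring

lemma cb_bound (n : ℕ) : (2 * (n:ℝ) + 1) * (Nat.centralBinom n : ℝ) ^ 2 ≤ 16 ^ n := by
  induction n with
  | zero => simp
  | succ n ih =>
    have h : ((n:ℝ)+1) * (Nat.centralBinom (n+1) : ℝ) = 2 * (2 * n + 1) * Nat.centralBinom n := by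
      exact_mod_cast Nat.succ_mul_centralBinom_succ n
    have h2 : (Nat.centralBinom (n+1) : ℝ) = 2 * (2 * n + 1) * Nat.centralBinom n / (n+1) := by
      rw [eq_div_iff (by positivity)]; linarith
    rw [h2, pow_succ (16:ℝ)]
    set c : ℝ := (Nat.centralBinom n : ℝ)
    push_cast
    have : (2 * ((n:ℝ) + 1) + 1) * (2 * (2 * n + 1) * c / (n+1))^2 =
      ((2 * n + 1) * c^2) * (4 * ((2 * n + 3) * (2 * n+1)) / (n+1)^2) := by
      field_simp; ring
    rw [this]
    apply mul_le_mul ih _ (by positivity) (by positivity)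
    rw [div_le_iff₀ (by positivity)]
    nlinarith

end PF
namespace PF

/-! Lipschitz property and pair flips -/
lemma sg_abs {d : ℕ} (x y : Fin d) (o : Option (Fin d)) : |sg x y o| ≤ 1 := by
  unfold sg; split_ifs <;> simp

lemma gg_lip {d : ℕ} (x y : Fin d) (s : List (Fin d)) (a : Fin d) :
    |gg x y (redStep s a) - gg x y s| ≤ 1 := by
  rcases s with _ | ⟨b, _ | ⟨c, r⟩⟩
  · simpa [redStep, gg] using sg_abs x y _
  · by_cases h : a = b
    · simpa [redStep, gg, h] using sg_abs x y _
    · have := sg_abs x y (some b)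
      simp only [redStep, gg, h, if_false]
      simp
      ring_nf
      exact this
  · by_cases h : a = b
    · have := sg_abs x y (c :: r).getLast?
      simp only [redStep, gg, h, if_true, List.length_cons, List.getLast?_cons_cons]
      push_cast
      rw [← sub_mul, abs_mul]
      have e : (r.length:ℝ) + 1 - (r.length + 1 + 1) = -1 := by ring
      rw [e]; simpa using this
    · have := sg_abs x y (c :: r).getLast?
      simp only [redStep, gg, h, if_false, List.length_cons, List.getLast?_cons_cons]
      push_cast
      rw [← sub_mul, abs_mul]
      have e : (r.length:ℝ) + 1 + 1 + 1 - (r.length + 1 + 1) = 1 := by ring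
      rw [e]; simpa using this

lemma redStep_chain {d : ℕ} (s : List (Fin d)) (a : Fin d) (h : s.IsChain (· ≠ ·)) :
    (redStep s a).IsChain (· ≠ ·) := by
  cases s with
  | nil => simp [redStep]
  | cons b r =>
    by_cases hab : a = b
    · simp only [redStep, hab, if_true]
      exact h.tail
    · simp only [redStep, hab, if_false]
      exact List.isChain_cons_cons.mpr ⟨hab, h⟩

lemma redStep_twice {d : ℕ} (s : List (Fin d)) (a : Fin d) (h : s.IsChain (· ≠ ·)) :
    redStep (redStep s a) a = s := by
  rcases s with _ | ⟨b, _ | ⟨c, r⟩⟩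
  · simp [redStep]
  · by_cases hab : a = b <;> simp [redStep, hab]
  · by_cases hab : a = b
    · have := (List.isChain_cons_cons.mp h).1
      simp [redStep, hab, this]
    · simp [redStep, hab]

lemma foldl_pair {d : ℕ} (t t' : Fin d) (q : List (Fin d)) : ∀ (p s : List (Fin d)),
    s.IsChain (· ≠ ·) →
    (p ++ t :: t :: q).foldl redStep s = (p ++ t' :: t' :: q).foldl redStep s
  | [], s, h => by simp [redStep_twice _ _ h]
  | a :: p, s, h => by
    simpa using foldl_pair t t' q p _ (redStep_chain s a h)

lemma area_pair {d : ℕ} (x y t t' : Fin d) (q : List (Fin d)) : ∀ (p s : List (Fin d)),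
    s.IsChain (· ≠ ·) →
    |area x y s (p ++ t :: t :: q) - area x y s (p ++ t' :: t' :: q)| ≤ 2
  | [], s, h => by
    simp only [List.nil_append, area, redStep_twice _ _ h]
    have h1 := abs_le.mp (gg_lip x y s t)
    have h2 := abs_le.mp (gg_lip x y s t')
    rw [abs_le]
    constructor <;> linarith [h1.1, h1.2, h2.1, h2.2]
  | a :: p, s, h => by
    have := area_pair x y t t' q p _ (redStep_chain s a h)
    simpa [area] using this

lemma flip_split {d N : ℕ} (w : Fin N → Fin d) (i : ℕ) (hi : i + 1 < N) (t t' : Fin d)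
    (h : hasPair w i t) : ∃ p q, List.ofFn w = p ++ t :: t :: q ∧
      List.ofFn (flipAt w i t') = p ++ t' :: t' :: q := by
  have key : ∀ (u : Fin N → Fin d) (z : Fin d), hasPair u i z →
      (∀ j : Fin N, (j:ℕ) ≠ i → (j:ℕ) ≠ i + 1 → u j = w j) →
      List.ofFn u = (List.ofFn w).take i ++ z :: z :: (List.ofFn w).drop (i+2) := by
    intro u z hu hj
    apply List.ext_getElem
    · simp; omega
    · intro k h1 h2
      have hk : k < N := by simpa using h1
      rw [List.getElem_ofFn]
      rcases lt_trichotomy k i with hlt | heq | hgt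
      · rw [List.getElem_append_left (by simp; omega)]
        simp [hj ⟨k, hk⟩ (by simp; omega) (by simp; omega)]
      · rw [List.getElem_append_right (by simp; omega)]
        have e : k - (List.take i (List.ofFn w)).length = 0 := by simp; omega
        simp only [e, List.getElem_cons_zero]
        exact hu ⟨k, hk⟩ (Or.inl heq)
      · rw [List.getElem_append_right (by simp; omega)]
        by_cases h3 : k = i + 1
        · have e : k - (List.take i (List.ofFn w)).length = 1 := by simp; omega
          simp only [e, List.getElem_cons_zero, List.getElem_cons_succ]
          exact hu ⟨k, hk⟩ (Or.inr h3)
        · have e : k - (List.take i (List.ofFn w)).length = (k - (i+2)) + 1 + 1 := by simp; omega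
          simp only [e, List.getElem_cons_succ]
          rw [hj ⟨k, hk⟩ (by simp; omega) (by simpa using h3)]
          simp only [List.getElem_drop, List.getElem_ofFn]
          congr 1
          apply Fin.ext
          simp; omega
  refine ⟨_, _, key w t h (fun _ _ _ => rfl), key _ t' ?_ ?_⟩
  · intro p hp
    simp [flipAt, hp]
  · intro j h1 h2
    simp [flipAt, h1, h2]

/-! the test function -/
noncomputable def vv {d N : ℕ} (x y : Fin d) (w : Fin N → Fin d) : ℝ :=
  if FullyReducible w then area x y [] (List.ofFn w) else 0

lemma FR_iff {d N : ℕ} (w : Fin N → Fin d) :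
    FullyReducible w ↔ (List.ofFn w).foldl redStep [] = [] := by
  simp [FullyReducible, irrOf]

lemma NN_eq_sum (d N : ℕ) :
    NN d N [] = ∑ w : Fin N → Fin d, if FullyReducible w then (1:ℝ) else 0 := by
  unfold NN wsum
  refine Finset.sum_congr rfl fun w _ => ?_
  beta_reduce
  by_cases h : FullyReducible w
  · rw [if_pos h, if_pos ((FR_iff w).mp h)]
  · rw [if_neg h, if_neg (fun h' => h ((FR_iff w).mpr h'))]

lemma vv_flip {d N : ℕ} (x y : Fin d) (w : Fin N → Fin d) (i : ℕ) (hi : i + 1 < N) (t t' : Fin d)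
    (h : hasPair w i t) :
    (vv x y w - vv x y (flipAt w i t')) ^ 2 ≤ 4 * (if FullyReducible w then (1:ℝ) else 0) := by
  obtain ⟨p, q, h1, h2⟩ := flip_split w i hi t t' h
  have hF := foldl_pair t t' q p [] (by simp)
  have hA := area_pair x y t t' q p [] (by simp)
  have hiff : FullyReducible w ↔ FullyReducible (flipAt w i t') := by
    rw [FR_iff, FR_iff, h1, h2, hF]
  by_cases hw : FullyReducible w
  · rw [vv, vv, if_pos hw, if_pos (hiff.mp hw), h1, h2, if_pos hw]
    have := abs_le.mp hA
    nlinarith [this.1, this.2]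
  · rw [vv, vv, if_neg hw, if_neg (fun h' => hw (hiff.mpr h')), if_neg hw]
    simp

lemma energy {d N : ℕ} (x y : Fin d) :
    quadForm d N (vv x y) ≤ N * d ^ 2 * (4 * NN d N []) := by
  have hK : 0 ≤ NN d N [] := by
    rw [NN_eq_sum]; apply Finset.sum_nonneg; intro w _; split_ifs <;> simp
  unfold quadForm
  have h1 : ∀ i ∈ Finset.range (N-1), (∑ t : Fin d, ∑ t' : Fin d,
    if t < t' then
      (∑ w : Fin N → Fin d,
        if hasPair w i t then (vv x y w - vv x y (flipAt w i t')) ^ 2 else 0)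
    else 0) ≤ ∑ t : Fin d, ∑ t' : Fin d, 4 * NN d N [] := by
    intro i hi
    rw [Finset.mem_range] at hi
    refine Finset.sum_le_sum fun t _ => Finset.sum_le_sum fun t' _ => ?_
    split_ifs
    · rw [NN_eq_sum, Finset.mul_sum]
      refine Finset.sum_le_sum fun w _ => ?_
      by_cases hp : hasPair w i t
      · rw [if_pos hp]
        exact vv_flip x y w i (by omega) t t' hp
      · rw [if_neg hp]
        split_ifs <;> simp
    · positivity
  refine (Finset.sum_le_sum h1).trans ?_
  simp only [Finset.sum_const, Finset.card_univ, Fintype.card_fin, Finset.card_range, nsmul_eq_mul]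
  have : ((N - 1 : ℕ) : ℝ) ≤ N := by exact_mod_cast Nat.sub_le N 1
  have h2 : (0:ℝ) ≤ d * (d * (4 * NN d N [])) := by positivity
  nlinarith

/-! antisymmetry -/
lemma redStep_map {d : ℕ} (π : Equiv.Perm (Fin d)) (s : List (Fin d)) (a : Fin d) :
    redStep (s.map π) (π a) = (redStep s a).map π := by
  cases s with
  | nil => simp [redStep]
  | cons b r => by_cases h : a = b <;> simp [redStep, h]

lemma foldl_map_perm {d : ℕ} (π : Equiv.Perm (Fin d)) : ∀ (u s : List (Fin d)),
    (u.map π).foldl redStep (s.map π) = (u.foldl redStep s).map π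
  | [], s => by simp
  | a :: u, s => by
    simp only [List.map_cons, List.foldl_cons, redStep_map]
    exact foldl_map_perm π u _

lemma gg_swap {d : ℕ} (x y : Fin d) (hxy : x ≠ y) (s : List (Fin d)) :
    gg x y (s.map (Equiv.swap x y)) = - gg x y s := by
  unfold gg
  rw [List.length_map, List.getLast?_map, ← mul_neg]
  congr 1
  cases s.getLast? with
  | none => simp [sg]
  | some c =>
    by_cases h1 : c = x
    · subst h1; simp [sg, hxy.symm]
    · by_cases h2 : c = y
      · subst h2; simp [sg, h1]
      · simp [sg, Equiv.swap_apply_of_ne_of_ne h1 h2, h1, h2]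

lemma area_swap {d : ℕ} (x y : Fin d) (hxy : x ≠ y) : ∀ (u s : List (Fin d)),
    area x y (s.map (Equiv.swap x y)) (u.map (Equiv.swap x y)) = - area x y s u
  | [], s => by simp [area, gg_swap x y hxy]
  | a :: u, s => by
    simp only [List.map_cons, area, gg_swap x y hxy, redStep_map, area_swap x y hxy u]
    ring

lemma vv_sum {d N : ℕ} (x y : Fin d) (hxy : x ≠ y) :
    ∑ w : Fin N → Fin d, (vv x y w) = 0 := by
  have h : ∀ w : Fin N → Fin d, vv x y ((Equiv.arrowCongr (Equiv.refl _) (Equiv.swap x y)) w)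
      = - vv x y w := by
    intro w
    have e : List.ofFn ((Equiv.arrowCongr (Equiv.refl _) (Equiv.swap x y)) w)
        = (List.ofFn w).map (Equiv.swap x y) := by
      rw [List.map_ofFn]; rfl
    have h1 := foldl_map_perm (Equiv.swap x y) (List.ofFn w) []
    have h2 := area_swap x y hxy (List.ofFn w) []
    simp only [List.map_nil] at h1 h2
    have hiff : FullyReducible ((Equiv.arrowCongr (Equiv.refl _) (Equiv.swap x y)) w)
        ↔ FullyReducible w := by
      rw [FR_iff, FR_iff, e, h1]; simp
    unfold vv
    by_cases hw : FullyReducible w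
    · rw [if_pos hw, if_pos (hiff.mpr hw), e, h2]
    · rw [if_neg hw, if_neg (fun h' => hw (hiff.mp h'))]; simp
  have h2 := Equiv.sum_comp (Equiv.arrowCongr (Equiv.refl (Fin N)) (Equiv.swap x y))
    (fun w => vv x y w)
  simp only [h, Finset.sum_neg_distrib] at h2
  linarith

/-! lower bound on the norm -/
/-- indicator of a single excursion in branch `x` -/
noncomputable def ind {d : ℕ} (x : Fin d) : List (Fin d) → ℝ
  | [] => 0
  | a :: u => if a = x ∧ good [x] u then 1 else 0

lemma ind_sum {d : ℕ} (x y : Fin d) (m : ℕ) :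
    ∑ w : Fin (m+1) → Fin d, ind x (List.ofFn w) * vv x y w = GG x y m [x] := by
  have h := wsum_succ d m (fun u => ind x u * (if u.foldl redStep [] = [] then area x y [] u else 0))
  have h1 : ∑ w : Fin (m+1) → Fin d, ind x (List.ofFn w) * vv x y w =
      wsum d (m+1) (fun u => ind x u * (if u.foldl redStep [] = [] then area x y [] u else 0)) := by
    unfold wsum
    refine Finset.sum_congr rfl fun w _ => ?_
    unfold vv
    beta_reduce
    by_cases hw : FullyReducible w
    · rw [if_pos hw, if_pos ((FR_iff w).mp hw)]
    · rw [if_neg hw, if_neg (fun h' => hw ((FR_iff w).mpr h'))]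
  rw [h1, h, Finset.sum_eq_single x]
  · unfold GG wsum
    refine Finset.sum_congr rfl fun w _ => ?_
    by_cases hg : good [x] (List.ofFn w)
    · have := good_foldl _ _ hg
      simp [ind, hg, redStep, this, area, gg]
    · simp [ind, hg]
  · intro b _ hb
    simp [ind, hb, wsum]
  · simp

lemma ind_sq_sum {d : ℕ} (x : Fin d) (m : ℕ) :
    ∑ w : Fin (m+1) → Fin d, ind x (List.ofFn w) ^ 2 ≤ NN d (m+1) [] := by
  rw [NN_eq_sum]
  refine Finset.sum_le_sum fun w _ => ?_
  rw [List.ofFn_succ]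
  by_cases hg : w 0 = x ∧ good [x] (List.ofFn fun i => w i.succ)
  · have hF : FullyReducible w := by
      rw [FR_iff, List.ofFn_succ, List.foldl_cons, hg.1]
      exact good_foldl _ _ hg.2
    rw [if_pos hF]
    simp [ind, hg]
  · simp only [ind, hg, if_false]
    split_ifs <;> simp

lemma norm_lower {d : ℕ} (x y : Fin d) (n : ℕ) :
    ((4 * ((d:ℝ) - 1)) ^ n) ^ 2 ≤
      NN d (2 * (n + 1)) [] * ∑ w : Fin (2 * (n+1)) → Fin d, (vv x y w) ^ 2 := by
  have e : 2 * (n+1) = (2 * n + 1) + 1 := by ring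
  rw [e]
  have h1 := ind_sum x y (2 * n + 1)
  have h2 := GG_eq x y (2 * n + 1) n [x] (by simp) (by simp)
  have h3 : TT (2 * n + 1) n = 4 ^ n := by
    unfold TT
    exact_mod_cast Nat.sum_range_choose_halfway n
  rw [h3] at h2
  have h4 : GG x y (2 * n + 1) [x] = (4 * ((d:ℝ) - 1)) ^ n := by
    rw [h2, mul_pow]; simp; ring
  rw [← h4, ← h1]
  refine (Finset.sum_mul_sq_le_sq_mul_sq _ _ _).trans ?_
  exact mul_le_mul_of_nonneg_right (ind_sq_sum x _) (Finset.sum_nonneg fun _ _ => sq_nonneg _)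

lemma NN_final (d : ℕ) (hd : 3 ≤ d) (n : ℕ) :
    ((n:ℝ) + 1) ^ 3 * NN d (2 * (n+1)) [] ^ 2 ≤
      9 * 16 ^ 3 * ((d:ℝ) - 1) ^ 2 * ((4 * ((d:ℝ) - 1)) ^ n) ^ 2 := by
  have hd' : (3:ℝ) ≤ d := by exact_mod_cast hd
  have hd1 : (0:ℝ) < (d:ℝ) - 1 := by linarith
  have hK : 0 ≤ NN d (2 * (n+1)) [] := by
    rw [NN_eq_sum]; apply Finset.sum_nonneg; intro w _; split_ifs <;> simp
  have h := NN_bound d hd (2 * (n+1)) (n+1) [] (by simp)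
  have hc : ((2 * (n+1) + 3).choose (n+1) : ℝ) ≤ Nat.centralBinom (n+3) := by
    have h1 : (2 * (n+1) + 3).choose (n+1) ≤ (2 * (n+3)).choose (n+1) :=
      Nat.choose_le_choose _ (by omega)
    exact_mod_cast h1.trans (Nat.choose_le_centralBinom _ _)
  have hb := cb_bound (n+3)
  simp only [List.length_nil, Nat.cast_zero, zero_add] at h
  push_cast at h hb
  set K := NN d (2 * (n+1)) []
  set c : ℝ := ((2 * (n+1) + 3).choose (n+1) : ℝ)
  set B : ℝ := (Nat.centralBinom (n+3) : ℝ)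
  set e : ℝ := (d:ℝ) - 1
  have hp : 0 < e ^ (n+1) := by positivity
  have h2 : (2 * ((n:ℝ)+1) + 3) * K ≤ 3 * e ^ (n+1) * B :=
    h.trans (mul_le_mul_of_nonneg_left hc (by positivity))
  have h3 : ((2 * ((n:ℝ)+1) + 3) * K)^2 ≤ (3 * e ^ (n+1) * B)^2 :=
    pow_le_pow_left₀ (by positivity) h2 2
  have h4 : (2 * ((n:ℝ)+3)+1) * ((2 * ((n:ℝ)+1) + 3) * K)^2 ≤ 9 * (e^(n+1))^2 * 16^(n+3) := by
    calc _ ≤ (2 * ((n:ℝ)+3)+1) * (3 * e ^ (n+1) * B)^2 := by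
            apply mul_le_mul_of_nonneg_left h3; positivity
      _ = 9 * (e^(n+1))^2 * ((2 * ((n:ℝ)+3)+1) * B^2) := by ring
      _ ≤ _ := by apply mul_le_mul_of_nonneg_left hb; positivity
  have h5 : ((n:ℝ)+1)^3 * K^2 ≤ (2 * ((n:ℝ)+3)+1) * ((2 * ((n:ℝ)+1) + 3) * K)^2 := by
    rw [mul_pow, ← mul_assoc]
    apply mul_le_mul_of_nonneg_right _ (sq_nonneg _)
    have : (0:ℝ) ≤ n := by positivity
    calc ((n:ℝ)+1)^3 = (n+1) * (n+1)^2 := by ring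
      _ ≤ _ := by gcongr <;> linarith
  have h6 : (16:ℝ)^(n+3) = 16^3 * (4^n)^2 := by
    rw [← pow_mul, mul_comm n 2, pow_mul]; norm_num; ring
  calc _ ≤ _ := h5.trans h4
    _ = _ := by rw [h6, mul_pow]; ring

end PF

/-- the spectral gap of the pair-flip Hamiltonian restricted to the
fully reducible subspace is `O(n^{−2})`. -/
theorem pf_gap_upper_fully_reducible :
    ∀ d : ℕ, 3 ≤ d → ∃ C : ℝ, 0 < C ∧ ∀ n : ℕ, 1 ≤ n →
      ∃ v : (Fin (2 * n) → Fin d) → ℝ, v ≠ 0 ∧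
        (∀ w : Fin (2 * n) → Fin d, ¬ FullyReducible w → v w = 0) ∧
        (∑ w : Fin (2 * n) → Fin d, (if FullyReducible w then v w else 0)) = 0 ∧
        quadForm d (2 * n) v ≤
          (C / (n : ℝ) ^ 2) * ∑ w : Fin (2 * n) → Fin d, (v w) ^ 2 := by
  intro d hd
  have hd' : (3:ℝ) ≤ d := by exact_mod_cast hd
  have hd1 : (0:ℝ) < (d:ℝ) - 1 := by linarith
  refine ⟨8 * d ^ 2 * (9 * 16 ^ 3 * ((d:ℝ) - 1) ^ 2), by positivity, ?_⟩
  intro n hn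
  obtain ⟨n, rfl⟩ : ∃ k, n = k + 1 := ⟨n - 1, by omega⟩
  let x : Fin d := ⟨0, by omega⟩
  let y : Fin d := ⟨1, by omega⟩
  have hxy : x ≠ y := by simp [x, y, Fin.ext_iff]
  have hlow := PF.norm_lower x y n
  have hup := PF.NN_final d hd n
  have hen := PF.energy (N := 2 * (n+1)) x y
  have hA : (0:ℝ) < ((4 * ((d:ℝ) - 1)) ^ n) ^ 2 := by positivity
  have hK : 0 ≤ PF.NN d (2 * (n+1)) [] := by
    rw [PF.NN_eq_sum]; apply Finset.sum_nonneg; intro w _; split_ifs <;> simp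
  refine ⟨PF.vv x y, ?_, ?_, ?_, ?_⟩
  · intro h0
    rw [h0] at hlow
    simp at hlow
    linarith
  · intro w hw
    simp [PF.vv, hw]
  · refine Eq.trans (Finset.sum_congr rfl fun w _ => ?_) (PF.vv_sum (N := 2 * (n+1)) x y hxy)
    by_cases hw : FullyReducible w <;> simp [PF.vv, hw]
  · refine hen.trans ?_
    set K := PF.NN d (2 * (n+1)) []
    set A := ((4 * ((d:ℝ) - 1)) ^ n) ^ 2
    set V := ∑ w : Fin (2 * (n+1)) → Fin d, (PF.vv x y w) ^ 2
    set E : ℝ := 9 * 16 ^ 3 * ((d:ℝ) - 1) ^ 2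
    have hV : 0 ≤ V := Finset.sum_nonneg fun _ _ => sq_nonneg _
    have hKpos : 0 < K := by
      rcases hK.eq_or_lt with h | h
      · rw [← h] at hlow; linarith
      · exact h
    have hE : 0 ≤ E := by positivity
    have h1 : ((n:ℝ)+1)^3 * K^2 ≤ E * (K * V) :=
      hup.trans (mul_le_mul_of_nonneg_left hlow hE)
    have h2 : ((n:ℝ)+1)^3 * K ≤ E * V := by
      apply le_of_mul_le_mul_right _ hKpos
      linarith
    rw [div_mul_eq_mul_div, le_div_iff₀ (by positivity)]
    push_cast
    have h3 : (0:ℝ) ≤ 8 * d ^ 2 := by positivity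
    have h4 := mul_le_mul_of_nonneg_left h2 h3
    linarith
end
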